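/- arXiv:1710.00402 — 2 statements merged into one kernel-verified Lean document; each statement's English description precedes it below -/
import Mathlib

section
/- Let P be a simplicial poset over an infinite field k. If P is Buchsbaum as a poset (i.e., P is pure and the link of every vertex of the order complex Δ(P∖{0̂}) is Cohen–Macaulay over k), then the face ring A_P is a Buchsbaum module over A = k[x₁,...,xₙ]. -/
open scoped Classical
open MvPolynomial

noncomputable section

def IsSimplicialPoset (P : Type*) [Fintype P] [PartialOrder P] [OrderBot P] : Prop :=
  ∀ y : P, ∃ m : ℕ, Nonempty (Set.Icc (⊥ : P) y ≃o Finset (Fin m))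

def MUB {P : Type*} [PartialOrder P] (w y : P) : Set P :=
  {z | z ∈ upperBounds {w, y} ∧ ∀ z' ∈ upperBounds {w, y}, z' ≤ z → z' = z}

variable (P : Type) [Fintype P] [PartialOrder P] [OrderBot P]
variable (k : Type) [Field k]

/-- The defining ideal of the face ring of a simplicial poset. -/
def faceIdeal : Ideal (MvPolynomial P k) :=
  Ideal.span
    ({f | ∃ w y : P, upperBounds {w, y} = ∅ ∧ f = X w * X y} ∪
     {f | ∃ w y m : P, (upperBounds {w, y}).Nonempty ∧ IsGLB {w, y} m ∧
        f = X w * X y - X m * ∑ z ∈ (Set.toFinite (MUB w y)).toFinset, X z} ∪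
     {X (⊥ : P) - 1})

/-- The face ring `A_P = k[P]/I_P` of a simplicial poset. -/
abbrev FaceRing := MvPolynomial P k ⧸ faceIdeal P k

/-- The class of the variable corresponding to a face `y` in the face ring. -/
def fv (y : P) : FaceRing P k := Ideal.Quotient.mk _ (X y)

/-- `r` is a standard monomial with leading variable `z`: a product of powers of
variables along a strictly decreasing chain starting at `z`, with positive exponents. -/
def IsStdMonLead (r : FaceRing P k) (z : P) : Prop :=
  ∃ (c : ℕ) (w : Fin (c + 1) → P) (p : Fin (c + 1) → ℕ),
    StrictAnti w ∧ (∀ i, 0 < p i) ∧ w 0 = z ∧ r = ∏ i, (fv P k (w i)) ^ (p i)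


section Cohomology
variable (Q : Type) [Fintype Q] [PartialOrder Q]

/-- The simplicial coboundary operator of a complex `K` of finite chains in a poset `Q`
(each face being a chain is canonically oriented by the order of `Q`):
`(δf)(s) = Σ_{v ∈ s} (-1)^{|{u ∈ s : u < v}|} f(s \ {v})` for `s ∈ K`, and `0` otherwise. -/
def cDelta (K : Set (Finset Q)) : (Finset Q → k) →ₗ[k] (Finset Q → k) :=
  LinearMap.pi fun s =>
    if s ∈ K then
      ∑ v ∈ s, ((-1 : k) ^ ((s.filter fun u => u < v).card)) • LinearMap.proj (s.erase v)
    else 0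

/-- Cochains of (cohomological) degree `i`: functions supported on faces of `K` with
`i + 1` vertices. -/
def cGraded (K : Set (Finset Q)) (i : ℤ) : Submodule k (Finset Q → k) :=
  Submodule.pi Set.univ fun s => if s ∈ K ∧ (s.card : ℤ) = i + 1 then ⊤ else ⊥

/-- Degree-`i` cocycles. -/
def ZC (K : Set (Finset Q)) (i : ℤ) : Submodule k (Finset Q → k) :=
  LinearMap.ker (cDelta k Q K) ⊓ cGraded k Q K i

/-- Degree-`i` coboundaries. -/
def BC (K : Set (Finset Q)) (i : ℤ) : Submodule k (Finset Q → k) :=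
  Submodule.map (cDelta k Q K) (cGraded k Q K (i - 1))

/-- The degree-`i` cohomology (with coefficients in `k`) of a complex `K` of chains
in `Q`. -/
abbrev Coh (K : Set (Finset Q)) (i : ℤ) :=
  ↥(ZC k Q K i) ⧸ Submodule.comap (ZC k Q K i).subtype (BC k Q K i)

/-- The full complex of chains of `Q` minus its minimal elements: the order complex
`Δ(Q̄)` (including the empty face, so `Coh` of it is *reduced* cohomology). -/
def chainsK : Set (Finset Q) :=
  {s | (∀ q ∈ s, ¬ IsMin q) ∧ IsChain (· ≤ ·) (↑s : Set Q)}

/-- Reduced cohomology `H̃^i(Q)` of (the order complex of) a poset `Q`. -/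
abbrev ReducedCoh (i : ℤ) := Coh k Q (chainsK Q) i

/-- The relative complex of the pair `(Q, R)` for a subset `R ⊆ Q`: faces of the order
complex of `Q` not lying in `R`; `Coh` of it is the relative cohomology `H^i(Q, R)`. -/
def relK (R : Set Q) : Set (Finset Q) :=
  {s | s ∈ chainsK Q ∧ ¬ (↑s : Set Q) ⊆ R}

/-- Relative cohomology `H^i(Q, R)`. -/
abbrev RelCoh (R : Set Q) (i : ℤ) := Coh k Q (relK Q R) i

/-- The link of a face `F` of the order complex of `Q`. -/
def linkK (F : Finset Q) : Set (Finset Q) :=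
  {s | (∀ q ∈ s, q ∉ F) ∧ (∀ q ∈ s ∪ F, ¬ IsMin q) ∧
    IsChain (· ≤ ·) (↑(s ∪ F) : Set Q)}
end Cohomology

/-- The contrastar `cost_P(y) = {z : ¬ y ≤ z}`. -/
def cost {P : Type} [PartialOrder P] (y : P) : Set P := {z | ¬ y ≤ z}

set_option synthInstance.maxHeartbeats 1000000 in
set_option maxHeartbeats 1000000 in
/-- `A_P` is a Buchsbaum module over `A = k[x_1, …, x_n]` (acting through
`x_i ↦ x_i ∈ A_P`): every homogeneous system of parameters `θ_1, …, θ_d`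
(`d = dim A_P`, i.e. the Krull dimension of `A` modulo the annihilator of `A_P`;
the `θ_i` homogeneous elements of the irrelevant ideal with `A_P/(θ)A_P`
finite-dimensional) is a weak `A_P`-sequence:
`(θ_1, …, θ_{i-1})A_P : θ_i = (θ_1, …, θ_{i-1})A_P : m` for all `i`. -/
def IsBuchsbaumFaceRing (P : Type) [Fintype P] [PartialOrder P] [OrderBot P]
    (k : Type) [Field k] (n : ℕ) (x : Fin n → P) : Prop :=
  letI : Module (MvPolynomial (Fin n) k) (FaceRing P k) :=
    Module.compHom _
      (MvPolynomial.aeval (fun i => fv P k (x i)) :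
        MvPolynomial (Fin n) k →ₐ[k] FaceRing P k).toRingHom
  ∀ d : ℕ,
    ringKrullDim (MvPolynomial (Fin n) k ⧸
        Module.annihilator (MvPolynomial (Fin n) k) (FaceRing P k)) = (d : WithBot ℕ∞) →
    ∀ θ : Fin d → MvPolynomial (Fin n) k,
      (∀ i, θ i ∈ Ideal.span (Set.range (X : Fin n → MvPolynomial (Fin n) k)) ∧
        ∃ e : ℕ, (θ i).IsHomogeneous e) →
      FiniteDimensional k (FaceRing P k ⧸
        Submodule.span k {r : FaceRing P k | ∃ (i : Fin d) (s : FaceRing P k), r = θ i • s}) →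
      ∀ i : Fin d,
        {s : FaceRing P k | θ i • s ∈
          Submodule.span k {r : FaceRing P k |
            ∃ j : Fin d, j < i ∧ ∃ s' : FaceRing P k, r = θ j • s'}} =
        {s : FaceRing P k |
          ∀ a ∈ Ideal.span (Set.range (X : Fin n → MvPolynomial (Fin n) k)),
            a • s ∈ Submodule.span k {r : FaceRing P k |
              ∃ j : Fin d, j < i ∧ ∃ s' : FaceRing P k, r = θ j • s'}}


namespace BB

/-- sign of `v` in `s` -/
def sg {ι : Type} [PartialOrder ι] (s : Finset ι) (v : ι) : ℤ :=
  (-1) ^ ((s.filter fun u => u < v).card)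

theorem sg_mul_self {ι : Type} [PartialOrder ι] (s : Finset ι) (v : ι) :
    sg s v * sg s v = 1 := by
  unfold sg; rw [← mul_pow]; simp

theorem sg_erase {ι : Type} [PartialOrder ι] {s : Finset ι} {u v : ι} (hv : v ∈ s) :
    sg s u = sg (s.erase v) u * (if v < u then -1 else 1) := by
  unfold sg
  rw [Finset.filter_erase]
  split_ifs with h
  · have hm : v ∈ s.filter (fun w => w < u) := by simp [hv, h]
    rw [← Finset.card_erase_add_one hm, pow_succ]
  · have hm : v ∉ s.filter (fun w => w < u) := by simp [h]
    rw [Finset.erase_eq_of_notMem hm, mul_one]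

theorem sg_erase_self {ι : Type} [PartialOrder ι] {s : Finset ι} {v : ι} :
    sg (s.erase v) v = sg s v := by
  unfold sg
  rw [Finset.filter_erase]
  congr 2
  apply Finset.erase_eq_of_notMem
  simp

theorem sg_insert_self {ι : Type} [PartialOrder ι] {s : Finset ι} {v : ι} :
    sg (insert v s) v = sg s v := by
  unfold sg
  rw [Finset.filter_insert]; simp

theorem sg_anti {ι : Type} [PartialOrder ι] {s : Finset ι} {u v : ι} (hu : u ∈ s) (hv : v ∈ s)
    (h : u < v ∨ v < u) :
    sg s u * sg (s.erase u) v = - (sg s v * sg (s.erase v) u) := by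
  rw [sg_erase (s := s) (u := u) hv, sg_erase (s := s) (u := v) hu]
  rcases h with h | h
  · rw [if_neg h.not_gt, if_pos h]; ring
  · rw [if_pos h, if_neg h.not_gt]; ring

/-- weighted coboundary -/
def cob {ι : Type} [PartialOrder ι] {A : Type} [CommRing A] {X : Type} [AddCommGroup X] [Module A X]
    (w : ι → A) : (Finset ι → X) →ₗ[A] (Finset ι → X) :=
  LinearMap.pi fun s => ∑ v ∈ s, (sg s v) • (w v • LinearMap.proj (s.erase v))

theorem cob_apply {ι : Type} [PartialOrder ι] {A : Type} [CommRing A] {X : Type} [AddCommGroup X]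
    [Module A X] (w : ι → A) (f : Finset ι → X) (s : Finset ι) :
    cob w f s = ∑ v ∈ s, sg s v • (w v • f (s.erase v)) := by
  simp [cob]

theorem cob_cob {ι : Type} [PartialOrder ι] {A : Type} [CommRing A] {X : Type} [AddCommGroup X]
    [Module A X] (w : ι → A) (f : Finset ι → X) (s : Finset ι)
    (hs : ∀ u ∈ s, ∀ v ∈ s, u ≠ v → u < v ∨ v < u) :
    cob w (cob w f) s = 0 := by
  simp only [cob_apply, Finset.smul_sum]
  rw [Finset.sum_sigma']
  refine Finset.sum_involution (fun a _ => ⟨a.2, a.1⟩) ?_ ?_ ?_ ?_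
  · rintro ⟨v, u⟩ h
    simp only [Finset.mem_sigma, Finset.mem_erase] at h
    obtain ⟨hv, huv, hu⟩ := h
    simp only
    have e : (s.erase u).erase v = (s.erase v).erase u := Finset.erase_right_comm
    rw [e]
    have h1 := sg_anti hv hu (hs v hv u hu (Ne.symm huv))
    simp only [smul_comm (w _) (sg _ _), smul_smul (sg _ _) (sg _ _)]
    rw [h1, smul_comm (w v) (w u), neg_smul, neg_add_cancel]
  · rintro ⟨v, u⟩ h _ h2
    simp only [Finset.mem_sigma, Finset.mem_erase] at h
    simp only [Sigma.mk.injEq] at h2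
    exact h.2.1 h2.1
  · rintro ⟨v, u⟩ h
    simp only [Finset.mem_sigma, Finset.mem_erase] at h ⊢
    exact ⟨h.2.2, Ne.symm h.2.1, h.1⟩
  · rintro ⟨v, u⟩ h
    rfl

/-- contraction -/
def con {ι : Type} [PartialOrder ι] {X : Type} [AddCommGroup X] (z : ι)
    (f : Finset ι → X) : Finset ι → X :=
  fun s => if z ∈ s then 0 else sg s z • f (insert z s)

theorem cob_con {ι : Type} [PartialOrder ι] {A : Type} [CommRing A] {X : Type} [AddCommGroup X]
    [Module A X] (w : ι → A) (f : Finset ι → X) (z : ι) (s : Finset ι)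
    (hs : ∀ u ∈ s, u ≠ z → u < z ∨ z < u) :
    cob w (con z f) s + con z (cob w f) s = w z • f s := by
  by_cases hz : z ∈ s
  · have h1 : con z (cob w f) s = 0 := by simp [con, hz]
    rw [h1, add_zero, cob_apply, Finset.sum_eq_single z]
    · simp only [con, Finset.mem_erase, ne_eq, not_true_eq_false, false_and, if_false]
      rw [Finset.insert_erase hz, sg_erase_self, smul_comm (w z) (sg s z), smul_smul,
        sg_mul_self, one_smul]
    · intro u hu huz
      have : z ∈ s.erase u := by simp [hz, Ne.symm huz]
      simp [con, this]
    · intro h; exact absurd hz h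
  · have h1 : con z (cob w f) s = sg s z • cob w f (insert z s) := by simp [con, hz]
    rw [h1, cob_apply, cob_apply, Finset.sum_insert hz, Finset.erase_insert hz, sg_insert_self,
      smul_add, smul_smul, sg_mul_self, one_smul, Finset.smul_sum]
    rw [add_left_comm, ← Finset.sum_add_distrib]
    rw [Finset.sum_eq_zero, add_zero]
    intro u hu
    have huz : u ≠ z := fun h => hz (h ▸ hu)
    have hz' : z ∉ s.erase u := by simp [hz]
    have e : (insert z s).erase u = insert z (s.erase u) := by
      rw [Finset.erase_insert_of_ne (Ne.symm huz)]
    simp only [con, hz', if_false]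
    rw [e]
    have h2 := sg_anti (s := insert z s) (u := u) (v := z) (by simp [hu]) (by simp) (hs u hu huz)
    rw [Finset.erase_insert hz, sg_insert_self, e, sg_insert_self] at h2
    have h3 : sg s u * sg (s.erase u) z = - (sg s z * sg (insert z s) u) := by
      have a1 := sg_mul_self s z
      have a2 := sg_mul_self (s.erase u) z
      have : sg (insert z s) u * sg (s.erase u) z = - (sg s z * sg s u) := h2
      calc sg s u * sg (s.erase u) z = (sg s z * sg s z) * (sg s u * sg (s.erase u) z) := by
              rw [a1, one_mul]
        _ = -(sg s z * (-(sg s z * sg s u)) * sg (s.erase u) z) := by ring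
        _ = -(sg s z * (sg (insert z s) u * sg (s.erase u) z) * sg (s.erase u) z) := by rw [this]
        _ = -(sg s z * sg (insert z s) u) * (sg (s.erase u) z * sg (s.erase u) z) := by ring
        _ = _ := by rw [a2, mul_one]
    simp only [smul_comm (w _) (sg _ _), smul_smul (sg _ _) (sg _ _)]
    rw [h3, neg_smul, neg_add_cancel]

theorem cob_zero_card {ι : Type} [PartialOrder ι] {A : Type} [CommRing A] {X : Type}
    [AddCommGroup X] [Module A X] (w : ι → A) (h : Finset ι → X) (j : ℕ)
    (hh : ∀ τ, τ.card + 1 ≠ j → h τ = 0) (τ : Finset ι) (hτ : τ.card ≠ j) : cob w h τ = 0 := by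
  rw [cob_apply]
  refine Finset.sum_eq_zero fun v hv => ?_
  rw [hh, smul_zero, smul_zero]
  rw [Finset.card_erase_of_mem hv]
  have := Finset.card_pos.2 ⟨v, hv⟩
  omega

theorem con_zero_card {ι : Type} [PartialOrder ι] {X : Type}
    [AddCommGroup X] (z : ι) (f : Finset ι → X) (j : ℕ)
    (hh : ∀ τ, τ.card ≠ j → f τ = 0) (τ : Finset ι) (hτ : τ.card + 1 ≠ j) : con z f τ = 0 := by
  unfold con; split_ifs with h
  · rfl
  · rw [hh, smul_zero]
    rw [Finset.card_insert_of_notMem h]; exact hτ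

end BB

namespace BB

section RV
variable {A : Type} [CommRing A] {Ω Ω' : Type} [AddCommGroup Ω] [Module A Ω]
  [AddCommGroup Ω'] [Module A Ω'] {d : ℕ}

/-- relative vanishing of Koszul cohomology of `X / Y` below degree `q` -/
def RV (θ : Fin d → A) (X Y : Submodule A Ω) (q : ℕ) : Prop :=
  ∀ j < q, ∀ f : Finset (Fin d) → Ω, (∀ τ, f τ ∈ X) → (∀ τ, τ.card ≠ j → f τ = 0) →
    (∀ τ, cob θ f τ ∈ Y) →
    ∃ g : Finset (Fin d) → Ω, (∀ τ, g τ ∈ X) ∧ (∀ τ, τ.card + 1 ≠ j → g τ = 0) ∧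
      ∀ τ, f τ - cob θ g τ ∈ Y

theorem cob_mem {ι : Type} [PartialOrder ι] (θ : ι → A) (X : Submodule A Ω)
    (f : Finset ι → Ω) (hf : ∀ τ, f τ ∈ X) (τ) : cob θ f τ ∈ X := by
  rw [cob_apply]
  exact Submodule.sum_mem _ fun v _ => zsmul_mem (X.smul_mem _ (hf _)) _

theorem cob_map {ι : Type} [PartialOrder ι] (θ : ι → A) (L : Ω →ₗ[A] Ω')
    (f : Finset ι → Ω) (τ) : cob θ (fun τ => L (f τ)) τ = L (cob θ f τ) := by
  simp [cob_apply, map_sum]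

theorem cob_cob_fin (θ : Fin d → A) (f : Finset (Fin d) → Ω) : cob θ (cob θ f) = 0 := by
  funext s
  exact cob_cob θ f s fun u _ v _ h => lt_or_gt_of_ne h

theorem RV_shift (θ : Fin d → A) (D : Ω →ₗ[A] Ω) (Y0 Y1 Z1 : Submodule A Ω) (q : ℕ)
    (hD : ∀ f, D f ∈ Z1) (hex : ∀ h ∈ Z1, ∃ h', h - D h' ∈ Y1) (hY : ∀ f ∈ Y0, D f ∈ Y1)
    (h0 : RV θ ⊤ Y0 (q + 1)) (h1 : RV θ Z1 Y1 q) : RV θ (Y1.comap D) Y0 (q + 1) := by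
  intro j hj f hfX hfj hfY
  obtain ⟨g, -, hgj, hg⟩ := h0 j hj f (fun _ => trivial) hfj hfY
  rcases j with _ | j
  · refine ⟨0, fun τ => by simp, fun τ _ => rfl, fun τ => ?_⟩
    have : g = 0 := by funext τ; exact hgj τ (by omega)
    rw [← this]; exact hg τ
  obtain ⟨h, hhZ, hhj, hh⟩ := h1 j (by omega) (fun τ => D (g τ)) (fun τ => hD _)
    (fun τ hτ => by rw [hgj τ (by omega), map_zero]) (fun τ => by
      rw [cob_map]
      have e : D (cob θ g τ) = D (f τ) - D (f τ - cob θ g τ) := by rw [map_sub]; abel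
      rw [e]
      exact Y1.sub_mem (hfX τ) (hY _ (hg τ)))
  have hc : ∀ τ, ∃ h', h τ - D h' ∈ Y1 ∧ (τ.card + 1 ≠ j → h' = 0) := by
    intro τ
    by_cases hτ : τ.card + 1 = j
    · obtain ⟨h', h2⟩ := hex _ (hhZ τ)
      exact ⟨h', h2, fun h => absurd hτ h⟩
    · exact ⟨0, by simp [hhj τ hτ], fun _ => rfl⟩
  choose h' hh' hh'j using hc
  refine ⟨fun τ => g τ - cob θ h' τ, fun τ => ?_, fun τ hτ => ?_, fun τ => ?_⟩
  · rw [Submodule.mem_comap, map_sub, ← cob_map]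
    have e : D (g τ) - cob θ (fun τ => D (h' τ)) τ =
        (D (g τ) - cob θ h τ) + cob θ (fun τ => h τ - D (h' τ)) τ := by
      have : cob θ (fun τ => h τ - D (h' τ)) = cob θ h - cob θ (fun τ => D (h' τ)) := by
        rw [← map_sub]; rfl
      rw [this]; simp
    rw [e]
    exact Y1.add_mem (hh τ) (cob_mem θ Y1 _ hh' τ)
  · have : cob θ h' τ = 0 := cob_zero_card θ h' j hh'j τ (by omega)
    show g τ - cob θ h' τ = 0
    rw [hgj τ hτ, this, sub_zero]
  · have : cob θ (fun τ => g τ - cob θ h' τ) = cob θ g := by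
      have : cob θ (fun τ => g τ - cob θ h' τ) = cob θ g - cob θ (cob θ h') := by
        rw [← map_sub]; rfl
      rw [this, cob_cob_fin, sub_zero]
    rw [this]; exact hg τ

/-- the ideal generated by `θ` kills Koszul cohomology -/
theorem ideal_kill (θ : Fin d → A) (X Y : Submodule A Ω) (j : ℕ) (a : A)
    (ha : a ∈ Ideal.span (Set.range θ)) (f : Finset (Fin d) → Ω) (hfX : ∀ τ, f τ ∈ X)
    (hfj : ∀ τ, τ.card ≠ j → f τ = 0) (hfY : ∀ τ, cob θ f τ ∈ Y) :
    ∃ g : Finset (Fin d) → Ω, (∀ τ, g τ ∈ X) ∧ (∀ τ, τ.card + 1 ≠ j → g τ = 0) ∧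
      ∀ τ, a • f τ - cob θ g τ ∈ Y := by
  induction ha using Submodule.span_induction with
  | mem x hx =>
    obtain ⟨v, rfl⟩ := hx
    refine ⟨con v f, fun τ => ?_, fun τ hτ => ?_, fun τ => ?_⟩
    · unfold con; split_ifs
      · exact X.zero_mem
      · exact zsmul_mem (hfX _) _
    · exact con_zero_card v f j hfj τ hτ
    · have := cob_con θ f v τ (fun u _ h => lt_or_gt_of_ne h)
      rw [← this, add_sub_cancel_left]
      unfold con; split_ifs
      · exact Y.zero_mem
      · exact zsmul_mem (hfY _) _
  | zero => exact ⟨0, by simp, by simp, by simp⟩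
  | add x y _ _ hx hy =>
    obtain ⟨g, h1, h2, h3⟩ := hx
    obtain ⟨g', h1', h2', h3'⟩ := hy
    refine ⟨g + g', fun τ => X.add_mem (h1 τ) (h1' τ), fun τ hτ => by simp [h2 τ hτ, h2' τ hτ],
      fun τ => ?_⟩
    have := Y.add_mem (h3 τ) (h3' τ)
    rw [map_add, Pi.add_apply, add_smul]
    convert this using 1; abel
  | smul b x _ hx =>
    obtain ⟨g, h1, h2, h3⟩ := hx
    refine ⟨b • g, fun τ => X.smul_mem _ (h1 τ), fun τ hτ => by simp [h2 τ hτ],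
      fun τ => ?_⟩
    have := Y.smul_mem b (h3 τ)
    rw [map_smul, Pi.smul_apply, smul_assoc, ← smul_sub]
    exact this
end RV

section poly
variable {n : ℕ} {k : Type} [Field k]

/-- polynomials vanishing on the coordinate subspace `σ` -/
def pI (k : Type) [Field k] (σ : Finset (Fin n)) : Ideal (MvPolynomial (Fin n) k) where
  carrier := {a | ∀ u : Fin n →₀ ℕ, u.support ⊆ σ → coeff u a = 0}
  zero_mem' := by intro u _; simp
  add_mem' := by intro a b ha hb u hu; simp [ha u hu, hb u hu]
  smul_mem' := by
    intro c a ha u hu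
    rw [smul_eq_mul, coeff_mul]
    refine Finset.sum_eq_zero fun p hp => ?_
    rw [Finset.HasAntidiagonal.mem_antidiagonal] at hp
    rw [ha p.2, mul_zero]
    refine subset_trans ?_ hu
    rw [← hp]
    exact Finsupp.support_mono (by simp)

theorem mem_pI {σ : Finset (Fin n)} {a : MvPolynomial (Fin n) k} :
    a ∈ pI k σ ↔ ∀ u : Fin n →₀ ℕ, u.support ⊆ σ → coeff u a = 0 := Iff.rfl

theorem pI_anti {σ τ : Finset (Fin n)} (h : σ ⊆ τ) : pI k τ ≤ pI k σ :=
  fun _ ha u hu => ha u (hu.trans h)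

theorem X_mem_pI {σ : Finset (Fin n)} {b : Fin n} (hb : b ∉ σ) :
    (X b : MvPolynomial (Fin n) k) ∈ pI k σ := by
  intro u hu
  rw [coeff_X, if_neg]
  rintro rfl
  apply hb; apply hu; simp

theorem X_mul_mem_pI {σ : Finset (Fin n)} {b : Fin n} (hb : b ∈ σ) {a : MvPolynomial (Fin n) k}
    (h : X b * a ∈ pI k σ) : a ∈ pI k σ := by
  intro u hu
  have := h (Finsupp.single b 1 + u) (by
    intro c hc
    by_cases hcb : c = b
    · exact hcb ▸ hb
    · apply hu
      simp only [Finsupp.mem_support_iff, Finsupp.add_apply] at hc ⊢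
      rwa [Finsupp.single_eq_of_ne hcb, zero_add] at hc)
  rwa [coeff_X_mul] at this

theorem pI_insert {σ : Finset (Fin n)} {b : Fin n} {a : MvPolynomial (Fin n) k}
    (h : a ∈ pI k σ) : ∃ a', a - X b * a' ∈ pI k (insert b σ) := by
  refine ⟨a.divMonomial (Finsupp.single b 1), ?_⟩
  have e : a - X b * a.divMonomial (Finsupp.single b 1) = a.modMonomial (Finsupp.single b 1) := by
    have := divMonomial_add_modMonomial_single a b
    rw [sub_eq_iff_eq_add, add_comm]; exact this.symm
  rw [e]
  intro u hu
  by_cases hub : u b = 0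
  · rw [coeff_modMonomial_of_not_le]
    · apply h
      intro c hc
      have := hu hc
      rw [Finset.mem_insert] at this
      rcases this with rfl | h
      · simp [hub] at hc
      · exact h
    · intro hle
      have := hle b
      simp [hub] at this
  · apply coeff_modMonomial_of_le
    intro c
    by_cases hcb : c = b
    · subst hcb; simp; omega
    · simp [Finsupp.single_eq_of_ne hcb]

theorem RV_poly {d : ℕ} (θ : Fin d → MvPolynomial (Fin n) k) (σ : Finset (Fin n))
    (h : ∀ b ∈ σ, ∃ N : ℕ, ∃ c ∈ Ideal.span (Set.range θ), X b ^ N - c ∈ pI k σ) :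
    RV θ ⊤ (pI k σ) σ.card := by
  induction σ using Finset.induction_on with
  | empty => intro j hj; simp at hj
  | insert b σ hb ih =>
    have ih' := ih (fun c hc => by
      obtain ⟨N, c', h1, h2⟩ := h c (Finset.mem_insert_of_mem hc)
      exact ⟨N, c', h1, pI_anti (Finset.subset_insert _ _) h2⟩)
    rw [Finset.card_insert_of_notMem hb]
    intro j hj
    -- injectivity of `X b`
    have key : ∀ N : ℕ, ∀ f : Finset (Fin d) → MvPolynomial (Fin n) k,
        (∀ τ, τ.card ≠ j → f τ = 0) → (∀ τ, cob θ f τ ∈ pI k (insert b σ)) →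
        (∃ g : Finset (Fin d) → MvPolynomial (Fin n) k, (∀ τ, τ.card + 1 ≠ j → g τ = 0) ∧
          ∀ τ, X b ^ N * f τ - cob θ g τ ∈ pI k (insert b σ)) →
        (∃ g : Finset (Fin d) → MvPolynomial (Fin n) k, (∀ τ, τ.card + 1 ≠ j → g τ = 0) ∧
          ∀ τ, f τ - cob θ g τ ∈ pI k (insert b σ)) := by
      intro N
      induction N with
      | zero => intro f _ _ h; simpa using h
      | succ N ihN =>
        rintro f hfj hf ⟨g, hgj, hg⟩
        apply ihN f hfj hf
        rcases j with _ | j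
        · have hg0 : g = 0 := by funext τ; exact hgj τ (by omega)
          subst hg0
          refine ⟨0, by simp, fun τ => ?_⟩
          have := hg τ
          rw [map_zero, Pi.zero_apply, sub_zero] at this ⊢
          rw [pow_succ', mul_assoc] at this
          exact X_mul_mem_pI (by simp) this
        · obtain ⟨h', -, hh'j, hh'⟩ := ih' j (by omega) g (fun _ => trivial)
            (fun τ hτ => hgj τ (by omega)) (fun τ => by
              have h1 := pI_anti (k := k) (Finset.subset_insert b σ) (hg τ)
              have h2 : X b ^ (N + 1) * f τ ∈ pI k σ := by
                rw [pow_succ', mul_assoc]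
                exact Ideal.mul_mem_right _ _ (X_mem_pI hb)
              have := (pI k σ).sub_mem h2 h1
              rwa [sub_sub_cancel] at this)
          have hc : ∀ τ, ∃ a', g τ - cob θ h' τ - X b * a' ∈ pI k (insert b σ) ∧
              (τ.card + 1 ≠ j + 1 → a' = 0) := by
            intro τ
            by_cases hτ : τ.card + 1 = j + 1
            · obtain ⟨a', ha'⟩ := pI_insert (b := b) (hh' τ)
              exact ⟨a', ha', fun h => absurd hτ h⟩
            · refine ⟨0, ?_, fun _ => rfl⟩
              have : cob θ h' τ = 0 := cob_zero_card θ h' j hh'j τ (by omega)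
              simp [hgj τ hτ, this]
          choose g' hg' hg'j using hc
          refine ⟨g', hg'j, fun τ => ?_⟩
          apply X_mul_mem_pI (b := b) (by simp)
          have h1 := hg τ
          have h2 := cob_mem θ (pI k (insert b σ)) _ hg' τ
          have e : cob θ (fun τ => g τ - cob θ h' τ - X b * g' τ) τ =
              cob θ g τ - X b * cob θ g' τ := by
            have : cob θ (fun τ => g τ - cob θ h' τ - X b * g' τ) =
              cob θ g - cob θ (cob θ h') - (X b : MvPolynomial (Fin n) k) • cob θ g' := by
              rw [← map_smul, ← map_sub, ← map_sub]; rfl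
            rw [this, cob_cob_fin]; simp
          rw [e] at h2
          have := (pI k (insert b σ)).add_mem h1 h2
          convert this using 1
          ring
    intro f _ hfj hf
    obtain ⟨N, c, hc, hN⟩ := h b (by simp)
    obtain ⟨g, -, hgj, hg⟩ := ideal_kill θ ⊤ (pI k (insert b σ)) j c hc f (fun _ => trivial) hfj hf
    obtain ⟨g', h1, h2⟩ := key N f hfj hf ⟨g, hgj, fun τ => by
      have := (pI k (insert b σ)).add_mem (hg τ) (Ideal.mul_mem_right (f τ) _ hN)
      convert this using 1
      rw [smul_eq_mul]; ring⟩
    exact ⟨g', fun _ => trivial, h1, h2⟩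
end poly

end BB

namespace BB

section chains
variable {P : Type} [PartialOrder P] {k : Type} [Field k]

/-- chains -/
def Ch (c : Finset P) : Prop := ∀ u ∈ c, ∀ v ∈ c, u ≤ v ∨ v ≤ u

theorem Ch.lt {c : Finset P} (h : Ch c) : ∀ u ∈ c, ∀ v ∈ c, u ≠ v → u < v ∨ v < u := by
  intro u hu v hv huv
  rcases h u hu v hv with h | h
  · exact Or.inl (lt_of_le_of_ne h huv)
  · exact Or.inr (lt_of_le_of_ne h (Ne.symm huv))

theorem Ch.subset {c c' : Finset P} (h : Ch c) (hc : c' ⊆ c) : Ch c' :=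
  fun u hu v hv => h u (hc hu) v (hc hv)

theorem Ch.insert {c : Finset P} (h : Ch c) {y : P} (hy : ∀ z ∈ c, y ≤ z) : Ch (insert y c) := by
  intro u hu v hv
  rw [Finset.mem_insert] at hu hv
  rcases hu with rfl | hu
  · rcases hv with rfl | hv
    · exact Or.inl le_rfl
    · exact Or.inl (hy v hv)
  · rcases hv with rfl | hv
    · exact Or.inr (hy u hu)
    · exact h u hu v hv

/-- chains strictly above `y` -/
def Kab (y : P) : Set (Finset P) := {c | (∀ z ∈ c, y < z) ∧ Ch c}

theorem Kab.notMem {y : P} {c : Finset P} (h : c ∈ Kab y) : y ∉ c :=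
  fun hy => lt_irrefl y (h.1 y hy)

theorem Kab.erase {y : P} {c : Finset P} (h : c ∈ Kab y) (v : P) : c.erase v ∈ Kab y :=
  ⟨fun z hz => h.1 z (Finset.mem_of_mem_erase hz), h.2.subset (Finset.erase_subset _ _)⟩

theorem Kab.insert {y : P} {c : Finset P} (h : c ∈ Kab y) : Ch (insert y c) :=
  h.2.insert fun z hz => (h.1 z hz).le

/-- coboundaries on the upper part -/
def Wm (k : Type) [Field k] (y : P) (m : ℕ) : Submodule k (Finset P → k) where
  carrier := {h | ∃ ψ : Finset P → k, ∀ c ∈ Kab y, c.card = m → h c = cob (1 : P → k) ψ c}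
  zero_mem' := ⟨0, by simp⟩
  add_mem' := by
    rintro a b ⟨ψ, h⟩ ⟨ψ', h'⟩
    exact ⟨ψ + ψ', fun c hc hm => by simp [h c hc hm, h' c hc hm]⟩
  smul_mem' := by
    rintro t a ⟨ψ, h⟩
    exact ⟨t • ψ, fun c hc hm => by simp [h c hc hm]⟩

theorem mem_Wm {y : P} {m : ℕ} {h : Finset P → k} :
    h ∈ Wm k y m ↔ ∃ ψ : Finset P → k, ∀ c ∈ Kab y, c.card = m → h c = cob (1 : P → k) ψ c :=
  Iff.rfl

theorem cob_insert_min {A : Type} [CommRing A] (f : Finset P → A) (y : P) (c : Finset P)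
    (hc : c ∈ Kab y) :
    cob (1 : P → A) f (insert y c) = f c - cob (1 : P → A) (fun c => f (insert y c)) c := by
  have hy := Kab.notMem hc
  rw [cob_apply, cob_apply, Finset.sum_insert hy, Finset.erase_insert hy]
  have h1 : sg (insert y c) y = 1 := by
    unfold sg
    rw [Finset.filter_eq_empty_iff.2]
    · rfl
    · intro z hz
      rw [Finset.mem_insert] at hz
      rcases hz with rfl | hz
      · exact lt_irrefl _
      · exact (hc.1 z hz).not_gt
  rw [h1, sub_eq_add_neg, ← Finset.sum_neg_distrib]
  congr 1
  · simp
  · refine Finset.sum_congr rfl fun v hv => ?_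
    have hne : y ≠ v := fun h => hy (h ▸ hv)
    have h2 : sg (insert y c) v = - sg c v := by
      have := sg_erase (s := insert y c) (u := v) (v := y) (by simp)
      rw [this, Finset.erase_insert hy, if_pos (hc.1 v hv)]; ring
    rw [h2, Finset.erase_insert_of_ne hne]
    simp

theorem step (rk : P → ℕ) (hrk : StrictMono rk) (R : Set P) (q m : ℕ) (φ : Finset P → k)
    (h1 : ∀ c : Finset P, (∀ z ∈ c, z ∈ R) → Ch c → c.card = m + 1 → (∀ z ∈ c, q < rk z) →
      φ c = 0)
    (h2 : ∀ y ∈ R, rk y = q → (fun c => φ (insert y c)) ∈ Wm k y m) :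
    ∃ ψ : Finset P → k, (∀ c : Finset P, (∀ z ∈ c, q < rk z) → ψ c = 0) ∧
      ∀ c : Finset P, (∀ z ∈ c, z ∈ R) → Ch c → c.card = m + 1 → (∀ z ∈ c, q ≤ rk z) →
      φ c = cob (1 : P → k) ψ c := by
  have h3 : ∀ y, ∃ ψ : Finset P → k, y ∈ R → rk y = q → ∀ c ∈ Kab y, c.card = m →
      φ (insert y c) = cob (1 : P → k) ψ c := by
    intro y
    by_cases hy : y ∈ R ∧ rk y = q
    · obtain ⟨ψ, h⟩ := h2 y hy.1 hy.2
      exact ⟨ψ, fun _ _ => h⟩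
    · exact ⟨0, fun h h' => absurd ⟨h, h'⟩ hy⟩
  choose ψ hψ using h3
  refine ⟨fun c => ∑ y ∈ c.filter (fun y => rk y = q ∧ ∀ z ∈ c, y ≤ z), - ψ y (c.erase y),
    ?_, ?_⟩
  · intro c hc
    apply Finset.sum_eq_zero
    intro y hy
    rw [Finset.mem_filter] at hy
    exact absurd (hc y hy.1) (by omega)
  · intro c hcR hc hcm hcq
    by_cases hy : ∃ y ∈ c, rk y = q
    · obtain ⟨y, hyc, hyq⟩ := hy
      have hmin : ∀ z ∈ c, y ≤ z := by
        intro z hz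
        rcases hc y hyc z hz with h | h
        · exact h
        · rcases h.eq_or_lt with h | h
          · exact h.ge
          · have := hrk h; have := hcq z hz; omega
      have hK : c.erase y ∈ Kab y := by
        refine ⟨fun z hz => ?_, hc.subset (Finset.erase_subset _ _)⟩
        rw [Finset.mem_erase] at hz
        exact lt_of_le_of_ne (hmin z hz.2) (Ne.symm hz.1)
      have hi : insert y (c.erase y) = c := Finset.insert_erase hyc
      have hcard : (c.erase y).card = m := by
        rw [Finset.card_erase_of_mem hyc]; omega
      have h4 := hψ y (hcR y hyc) hyq _ hK hcard
      rw [hi] at h4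
      rw [h4]
      conv_rhs => rw [← hi]
      rw [cob_insert_min _ _ _ hK]
      have e0 : ∑ y' ∈ (c.erase y).filter (fun y' => rk y' = q ∧ ∀ z ∈ c.erase y, y' ≤ z),
          - ψ y' ((c.erase y).erase y') = 0 := by
        apply Finset.sum_eq_zero
        intro y' hy'
        rw [Finset.mem_filter] at hy'
        have := hrk (hK.1 y' hy'.1)
        omega
      rw [e0, zero_sub, cob_apply, cob_apply, ← Finset.sum_neg_distrib]
      refine Finset.sum_congr rfl fun v hv => ?_
      have hKv := Kab.erase hK v
      have e1 : (insert y ((c.erase y).erase v)).filter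
          (fun y' => rk y' = q ∧ ∀ z ∈ insert y ((c.erase y).erase v), y' ≤ z) = {y} := by
        ext y'
        simp only [Finset.mem_filter, Finset.mem_singleton]
        constructor
        · rintro ⟨h5, h6, -⟩
          rw [Finset.mem_insert] at h5
          rcases h5 with h5 | h5
          · exact h5
          · have := hrk (hKv.1 y' h5); omega
        · rintro rfl
          refine ⟨by simp, hyq, fun z hz => ?_⟩
          rw [Finset.mem_insert] at hz
          rcases hz with rfl | hz
          · exact le_rfl
          · exact (hKv.1 z hz).le
      rw [e1, Finset.sum_singleton, Finset.erase_insert (Kab.notMem hKv)]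
      simp
    · have hlt : ∀ z ∈ c, q < rk z := fun z hz =>
        lt_of_le_of_ne (hcq z hz) fun h => hy ⟨z, hz, h.symm⟩
      rw [h1 c hcR hc hcm hlt, cob_apply, Finset.sum_eq_zero]
      intro v hv
      rw [Finset.sum_eq_zero]
      · simp
      · intro y' hy'
        simp only [Finset.mem_filter, Finset.mem_erase] at hy'
        have := hlt y' hy'.1.2
        omega

theorem card_chain_le (rk : P → ℕ) (hrk : StrictMono rk) (c : Finset P) (hc : Ch c) (a r : ℕ)
    (h : ∀ z ∈ c, a < rk z ∧ rk z ≤ r) : c.card ≤ r - a := by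
  have : c.card ≤ (Finset.Ioc a r).card := by
    apply Finset.card_le_card_of_injOn rk
    · intro z hz; simpa using h z hz
    · intro u hu v hv huv
      by_contra hne
      rcases hc.lt u hu v hv hne with h | h
      · have := hrk h; omega
      · have := hrk h; omega
  simpa using this

theorem lift_closed (rk : P → ℕ) (hrk : StrictMono rk) (r : ℕ) (hr : ∀ y, rk y ≤ r)
    (R : Set P) (hR : ∀ y ∈ R, ∀ z, y ≤ z → z ∈ R)
    (van : ∀ v ∈ R, ∀ m, m + rk v < r → ∀ φ : Finset P → k,
      (∀ c ∈ Kab v, c.card = m + 1 → cob (1 : P → k) φ c = 0) → φ ∈ Wm k v m)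
    (i : ℕ) (φ : Finset P → k)
    (h : ∀ y ∈ R, rk y + i + 1 = r → (fun c => cob (1 : P → k) φ (insert y c)) ∈ Wm k y (i + 1)) :
    ∃ ψ : Finset P → k, (∀ c : Finset P, (∀ z ∈ c, r ≤ rk z + i) → ψ c = 0) ∧
      ∀ c : Finset P, (∀ z ∈ c, z ∈ R) → Ch c → c.card = i + 2 →
        cob (1 : P → k) φ c = cob (1 : P → k) ψ c := by
  suffices H : ∀ t q : ℕ, q + t + i + 1 = r → ∃ ψ : Finset P → k,
      (∀ c : Finset P, (∀ z ∈ c, r ≤ rk z + i) → ψ c = 0) ∧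
      ∀ c : Finset P, (∀ z ∈ c, z ∈ R) → Ch c → c.card = i + 2 → (∀ z ∈ c, q ≤ rk z) →
        cob (1 : P → k) φ c = cob (1 : P → k) ψ c by
    by_cases hir : i + 1 ≤ r
    · obtain ⟨ψ, a, b⟩ := H (r - (i + 1)) 0 (by omega)
      exact ⟨ψ, a, fun c h1 h2 h3 => b c h1 h2 h3 (fun _ _ => Nat.zero_le _)⟩
    · refine ⟨0, by simp, fun c h1 h2 h3 => ?_⟩
      exfalso
      obtain ⟨z, hz⟩ : c.Nonempty := Finset.card_pos.1 (by omega)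
      have hm : ∃ z0 ∈ c, ∀ z ∈ c, rk z0 ≤ rk z := Finset.exists_min_image c rk ⟨z, hz⟩
      obtain ⟨z0, hz0, hmin⟩ := hm
      have := card_chain_le rk hrk (c.erase z0) (h2.subset (Finset.erase_subset _ _)) (rk z0) r
        (fun w hw => ⟨by
          rw [Finset.mem_erase] at hw
          rcases h2.lt w hw.2 z0 hz0 hw.1 with h | h
          · have := hrk h; have := hmin w hw.2; omega
          · exact hrk h, hr w⟩)
      rw [Finset.card_erase_of_mem hz0] at this
      omega
  intro t
  induction t with
  | zero =>
    intro q hq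
    obtain ⟨ψ, a, b⟩ := step rk hrk R q (i + 1) (cob (1 : P → k) φ) (by
      intro c _ h2 h3 h4
      have := card_chain_le rk hrk c h2 q r (fun z hz => ⟨h4 z hz, hr z⟩)
      omega) (fun y hy hyq => h y hy (by omega))
    exact ⟨ψ, fun c hc => a c fun z hz => by have := hc z hz; omega, b⟩
  | succ t ih =>
    intro q hq
    obtain ⟨ψ, a, b⟩ := ih (q + 1) (by omega)
    obtain ⟨ψ', a', b'⟩ := step rk hrk R q (i + 1) (cob (1 : P → k) (φ - ψ)) (by
      intro c h1 h2 h3 h4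
      have := b c h1 h2 h3 h4
      rw [map_sub, Pi.sub_apply, this, sub_self]) (by
      intro y hy hyq
      apply van y hy (i + 1) (by omega)
      intro c hc hcm
      have h5 := cob_cob (1 : P → k) (φ - ψ) (insert y c) (Kab.insert hc).lt
      rw [cob_insert_min _ _ _ hc] at h5
      have h6 : cob (1 : P → k) (φ - ψ) c = 0 := by
        have := b c (fun z hz => hR y hy z (hc.1 z hz).le) hc.2 hcm (fun z hz => by
          have := hrk (hc.1 z hz); omega)
        rw [map_sub, Pi.sub_apply, this, sub_self]
      rw [h6, zero_sub, neg_eq_zero] at h5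
      exact h5)
    refine ⟨ψ + ψ', fun c hc => ?_, fun c h1 h2 h3 h4 => ?_⟩
    · rw [Pi.add_apply, a c hc, a' c (fun z hz => by have := hc z hz; omega), add_zero]
    · have := b' c h1 h2 h3 h4
      rw [map_sub, Pi.sub_apply, sub_eq_iff_eq_add] at this
      rw [this, map_add, Pi.add_apply, add_comm]

theorem cone (R : Set P) (ρ : P → P) (h1 : ∀ y ∈ R, ρ y ≤ y) (h2 : ∀ y ∈ R, ρ y ∈ R)
    (h3 : ∀ y ∈ R, ∀ z, y ≤ z → ρ y = ρ z) (m : ℕ) (f : Finset P → k)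
    (hf : ∀ c : Finset P, (∀ z ∈ c, z ∈ R) → Ch c → c.card = m + 3 → cob (1 : P → k) f c = 0) :
    ∃ g : Finset P → k, ∀ c : Finset P, (∀ z ∈ c, z ∈ R) → Ch c → c.card = m + 2 →
      f c = cob (1 : P → k) g c := by
  refine ⟨fun c => if h : c.Nonempty then con (ρ h.choose) f c else 0, fun c hR hc hm => ?_⟩
  obtain ⟨w, hw⟩ : c.Nonempty := Finset.card_pos.1 (by omega)
  have hconst : ∀ z ∈ c, ρ z = ρ w := by
    intro z hz
    rcases hc z hz w hw with h | h
    · exact h3 z (hR z hz) w h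
    · exact (h3 w (hR w hw) z h).symm
  have hle : ∀ z ∈ c, ρ w ≤ z := fun z hz => hconst z hz ▸ h1 z (hR z hz)
  have e : cob (1 : P → k) (fun c => if h : c.Nonempty then con (ρ h.choose) f c else 0) c =
      cob (1 : P → k) (con (ρ w) f) c := by
    rw [cob_apply, cob_apply]
    refine Finset.sum_congr rfl fun v hv => ?_
    have hne : (c.erase v).Nonempty := Finset.card_pos.1 (by
      rw [Finset.card_erase_of_mem hv]; omega)
    rw [dif_pos hne, hconst _ (Finset.mem_of_mem_erase hne.choose_spec)]
  rw [e]
  have := cob_con (1 : P → k) f (ρ w) c (fun u hu hne =>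
    Or.inr (lt_of_le_of_ne (hle u hu) (Ne.symm hne)))
  have h0 : con (ρ w) (cob (1 : P → k) f) c = 0 := by
    unfold con
    split_ifs with h
    · rfl
    · rw [hf _ ?_ (hc.insert hle) ?_, smul_zero]
      · intro z hz
        rw [Finset.mem_insert] at hz
        rcases hz with rfl | hz
        · exact h2 w (hR w hw)
        · exact hR z hz
      · rw [Finset.card_insert_of_notMem h, hm]
  rw [h0, add_zero] at this
  rw [this]; simp

end chains

end BB

namespace BB

/-- vertex set -/
def VV {P : Type} [PartialOrder P] {n : ℕ} (x : Fin n → P) (y : P) : Finset (Fin n) :=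
  Finset.univ.filter fun i => x i ≤ y

/-- what we use about the poset -/
structure Good {P : Type} [PartialOrder P] [OrderBot P] {n : ℕ} (x : Fin n → P) (r : ℕ)
    (k : Type) [Field k] : Prop where
  le_of : ∀ y z z' : P, z ≤ y → z' ≤ y → VV x z ⊆ VV x z' → z ≤ z'
  face : ∀ y : P, ∀ σ ⊆ VV x y, ∃ z ≤ y, VV x z = σ
  atom : ∀ i, VV x (x i) = {i}
  bot : VV x ⊥ = ∅
  rank_le : ∀ y, (VV x y).card ≤ r
  facet : ∀ y, ∃ z, y ≤ z ∧ (VV x z).card = r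
  van : ∀ v, v ≠ ⊥ → ∀ m, m + (VV x v).card < r → ∀ φ : Finset P → k,
      (∀ c ∈ Kab v, c.card = m + 1 → cob (1 : P → k) φ c = 0) → φ ∈ Wm k v m

set_option linter.unusedSectionVars false
section modlev
variable {P : Type} [PartialOrder P] [OrderBot P] {n : ℕ} {x : Fin n → P} {r : ℕ}
  {k : Type} [Field k]

theorem VV_mono {y z : P} (h : y ≤ z) : VV x y ⊆ VV x z := by
  intro i hi
  simp only [VV, Finset.mem_filter, Finset.mem_univ, true_and] at hi ⊢
  exact hi.trans h

theorem Good.eq_of (H : Good x r k) {y z z' : P} (h : z ≤ y) (h' : z' ≤ y)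
    (e : VV x z = VV x z') : z = z' :=
  le_antisymm (H.le_of y z z' h h' e.le) (H.le_of y z' z h' h e.ge)

theorem Good.strict (H : Good x r k) : StrictMono (fun y => (VV x y).card) := by
  intro y z h
  apply Finset.card_lt_card
  refine Finset.ssubset_iff_subset_ne.2 ⟨VV_mono h.le, fun e => ?_⟩
  exact h.ne (H.eq_of h.le le_rfl e)

theorem Good.ne_bot (H : Good x r k) {b : Fin n} {y : P} (h : b ∈ VV x y) : y ≠ ⊥ := by
  rintro rfl
  rw [H.bot] at h
  simp at h

theorem Wm_congr {y : P} {m : ℕ} {h h' : Finset P → k} (hh : h ∈ Wm k y m)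
    (e : ∀ c ∈ Kab y, c.card = m → h' c = h c) : h' ∈ Wm k y m := by
  obtain ⟨ψ, hψ⟩ := hh
  exact ⟨ψ, fun c hc hm => by rw [e c hc hm, hψ c hc hm]⟩

theorem coeff_cob {ι : Type} [PartialOrder ι] (u : Fin n →₀ ℕ)
    (f : Finset ι → MvPolynomial (Fin n) k) (c : Finset ι) :
    coeff u (cob (1 : ι → MvPolynomial (Fin n) k) f c) =
      cob (1 : ι → k) (fun c => coeff u (f c)) c := by
  rw [cob_apply, cob_apply, coeff_sum]
  refine Finset.sum_congr rfl fun v _ => ?_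
  simp only [Pi.one_apply, one_smul]
  exact map_zsmul (lcoeff k u) _ _

/-- the relative submodules -/
def Yi (x : Fin n → P) (r : ℕ) (k : Type) [Field k] (b : Fin n) (i : ℕ) :
    Submodule (MvPolynomial (Fin n) k) (Finset P → MvPolynomial (Fin n) k) where
  carrier := {f | ∀ (u : Fin n →₀ ℕ) (y : P), b ∈ VV x y → (VV x y).card + i = r →
    u.support ⊆ VV x y → (fun c => coeff u (f (insert y c))) ∈ Wm k y i}
  zero_mem' := by
    intro u y _ _ _
    exact Wm_congr (Submodule.zero_mem _) (fun c _ _ => by simp)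
  add_mem' := by
    intro f g hf hg u y h1 h2 h3
    exact Wm_congr (Submodule.add_mem _ (hf u y h1 h2 h3) (hg u y h1 h2 h3))
      (fun c _ _ => by simp)
  smul_mem' := by
    intro a f hf u y h1 h2 h3
    have : (∑ p ∈ Finset.HasAntidiagonal.antidiagonal u, coeff p.1 a •
        (fun c => coeff p.2 (f (insert y c)))) ∈ Wm k y i := by
      refine Submodule.sum_mem _ fun p hp => Submodule.smul_mem _ _ (hf _ y h1 h2 ?_)
      rw [Finset.HasAntidiagonal.mem_antidiagonal] at hp
      refine subset_trans ?_ h3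
      rw [← hp]
      exact Finsupp.support_mono (by simp)
    refine Wm_congr this (fun c _ _ => ?_)
    rw [Finset.sum_apply, Pi.smul_apply, smul_eq_mul, coeff_mul]
    rfl

theorem mem_Yi {b : Fin n} {i : ℕ} {f : Finset P → MvPolynomial (Fin n) k} :
    f ∈ Yi x r k b i ↔ ∀ (u : Fin n →₀ ℕ) (y : P), b ∈ VV x y → (VV x y).card + i = r →
    u.support ⊆ VV x y → (fun c => coeff u (f (insert y c))) ∈ Wm k y i := Iff.rfl

/-- differential -/
def dd (P : Type) [PartialOrder P] (n : ℕ) (k : Type) [Field k] :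
    (Finset P → MvPolynomial (Fin n) k) →ₗ[MvPolynomial (Fin n) k]
      (Finset P → MvPolynomial (Fin n) k) :=
  cob (1 : P → MvPolynomial (Fin n) k)

theorem dd_Yi (H : Good x r k) (b : Fin n) (i : ℕ) (f) (hf : f ∈ Yi x r k b i) :
    dd P n k f ∈ Yi x r k b (i + 1) := by
  intro u y h1 h2 h3
  obtain ⟨ψ, -, hψ⟩ := step (fun y => (VV x y).card) H.strict {z | y < z}
    ((VV x y).card + 1) i (fun c => coeff u (f c)) (by
      intro c hc1 hc2 hc3 hc4
      have := card_chain_le _ H.strict c hc2 _ r (fun z hz => ⟨hc4 z hz, H.rank_le z⟩)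
      omega) (by
      intro z hz hzq
      have hzq : (VV x z).card = (VV x y).card + 1 := hzq
      have := VV_mono (x := x) (le_of_lt hz)
      exact hf u z (this h1) (by omega) (h3.trans this))
  refine ⟨ψ - fun c => coeff u (f (insert y c)), fun c hc hcm => ?_⟩
  unfold dd
  simp only []
  rw [coeff_cob, cob_insert_min _ _ _ hc, map_sub, Pi.sub_apply]
  congr 1
  exact hψ c hc.1 hc.2 hcm (fun z hz => H.strict (hc.1 z hz))

theorem dd_dd (b : Fin n) (i : ℕ) (f) : dd P n k (dd P n k f) ∈ Yi x r k b i := by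
  intro u y _ _ _
  refine ⟨0, fun c hc _ => ?_⟩
  unfold dd
  simp only []
  rw [cob_cob _ _ _ (Kab.insert hc).lt]; simp

theorem assemble {ι : Type} (U : Finset (Fin n →₀ ℕ)) (G : (Fin n →₀ ℕ) → ι → k)
    (hG : ∀ u ∉ U, G u = 0) :
    ∃ g : ι → MvPolynomial (Fin n) k, ∀ u c, coeff u (g c) = G u c := by
  refine ⟨fun c => ∑ u ∈ U, monomial u (G u c), fun u c => ?_⟩
  rw [coeff_sum]
  simp only [coeff_monomial]
  rw [Finset.sum_ite_eq' U u]
  split_ifs with h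
  · rfl
  · rw [hG u h]; rfl

theorem lift_u (H : Good x r k) (b : Fin n) (i : ℕ) (f)
    (hf : dd P n k f ∈ Yi x r k b (i + 1)) (u : Fin n →₀ ℕ) :
    ∃ ψ : Finset P → k, (∀ c : Finset P, (∀ z ∈ c, r ≤ (VV x z).card + i) → ψ c = 0) ∧
      ∀ c : Finset P, (∀ z ∈ c, b ∈ VV x z ∧ u.support ⊆ VV x z) → Ch c → c.card = i + 2 →
        cob (1 : P → k) (fun c => coeff u (f c)) c = cob (1 : P → k) ψ c := by
  refine lift_closed (fun y => (VV x y).card) H.strict r H.rank_le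
    {z | b ∈ VV x z ∧ u.support ⊆ VV x z}
    (fun y hy z hyz => ⟨VV_mono hyz hy.1, hy.2.trans (VV_mono hyz)⟩)
    (fun v hv m hm φ hφ => H.van v (H.ne_bot hv.1) m hm φ hφ) i (fun c => coeff u (f c)) ?_
  intro y hy hyr
  have := hf u y hy.1 (by have hyr : (VV x y).card + i + 1 = r := hyr; omega) hy.2
  refine Wm_congr this (fun c hc hm => ?_)
  exact (coeff_cob u f (insert y c)).symm

theorem exact_Yi [Finite P] (H : Good x r k) (b : Fin n) (i : ℕ) (f)
    (hf : dd P n k f ∈ Yi x r k b (i + 2)) :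
    ∃ g, f - dd P n k g ∈ Yi x r k b (i + 1) := by
  have := Fintype.ofFinite P
  have hu : ∀ u : Fin n →₀ ℕ, ∃ g : Finset P → k,
      (u ∉ Finset.univ.biUnion (fun c => (f c).support) → g = 0) ∧
      ∀ y, b ∈ VV x y → (VV x y).card + (i + 1) = r → u.support ⊆ VV x y → ∀ c ∈ Kab y,
        c.card = i + 1 → coeff u (f (insert y c)) = cob (1 : P → k) g (insert y c) := by
    intro u
    by_cases hU : u ∈ Finset.univ.biUnion (fun c => (f c).support)
    swap
    · refine ⟨0, fun _ => rfl, fun y _ _ _ c _ _ => ?_⟩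
      have : ∀ c, coeff u (f c) = 0 := by
        intro c
        by_contra h
        exact hU (by simp only [Finset.mem_biUnion, Finset.mem_univ, true_and]
                     exact ⟨c, mem_support_iff.2 h⟩)
      rw [this]; simp
    obtain ⟨ψ, h1, h2⟩ := lift_u H b (i + 1) f hf u
    have hface : ∀ y, ∃ z, insert b u.support ⊆ VV x y → z ≤ y ∧ VV x z = insert b u.support := by
      intro y
      by_cases h : insert b u.support ⊆ VV x y
      · obtain ⟨z, hz⟩ := H.face y _ h
        exact ⟨z, fun _ => hz⟩
      · exact ⟨y, fun h' => absurd h' h⟩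
    choose ρ hρ using hface
    have hsub : ∀ y, (b ∈ VV x y ∧ u.support ⊆ VV x y) → insert b u.support ⊆ VV x y :=
      fun y hy => Finset.insert_subset hy.1 hy.2
    obtain ⟨g, hg⟩ := cone {z | b ∈ VV x z ∧ u.support ⊆ VV x z} ρ
      (fun y hy => (hρ y (hsub y hy)).1)
      (fun y hy => by
        have := (hρ y (hsub y hy)).2
        simp [this])
      (fun y hy z hyz => by
        have a := hρ y (hsub y hy)
        have b := hρ z (hsub z ⟨VV_mono hyz hy.1, hy.2.trans (VV_mono hyz)⟩)
        exact H.eq_of (a.1.trans hyz) b.1 (a.2.trans b.2.symm))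
      i ((fun c => coeff u (f c)) - ψ) (fun c a1 a2 a3 => by
        rw [map_sub, Pi.sub_apply, h2 c a1 a2 a3, sub_self])
    refine ⟨g, fun h => absurd hU h, fun y b1 b2 b3 c hc hcm => ?_⟩
    have hall : ∀ z ∈ insert y c, y ≤ z := by
      intro z hz
      rw [Finset.mem_insert] at hz
      rcases hz with rfl | hz
      · exact le_rfl
      · exact (hc.1 z hz).le
    have := hg (insert y c) (fun z hz => ⟨VV_mono (hall z hz) b1, b3.trans (VV_mono (hall z hz))⟩)
      (Kab.insert hc) (by rw [Finset.card_insert_of_notMem (Kab.notMem hc), hcm])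
    rw [← this, Pi.sub_apply, h1, sub_zero]
    intro z hz
    have := Finset.card_le_card (VV_mono (x := x) (hall z hz))
    omega
  choose G hG1 hG2 using hu
  obtain ⟨g, hg⟩ := assemble _ G hG1
  refine ⟨g, fun u y h1 h2 h3 => ⟨0, fun c hc hcm => ?_⟩⟩
  simp only [Pi.sub_apply, coeff_sub]
  unfold dd
  rw [coeff_cob, hG2 u y h1 h2 h3 c hc hcm]
  simp [hg]

/-- compatible families -/
def Nn (x : Fin n → P) (k : Type) [Field k] (b : Fin n) :
    Submodule (MvPolynomial (Fin n) k) (Finset P → MvPolynomial (Fin n) k) where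
  carrier := {f | ∀ y y' : P, b ∈ VV x y → y < y' → f {y'} - f {y} ∈ pI k (VV x y)}
  zero_mem' := by intro y y' _ _; simp
  add_mem' := by
    intro f g hf hg y y' h1 h2
    have := (pI k (VV x y)).add_mem (hf y y' h1 h2) (hg y y' h1 h2)
    convert this using 1
    simp only [Pi.add_apply]; ring
  smul_mem' := by
    intro a f hf y y' h1 h2
    have := (pI k (VV x y)).mul_mem_left a (hf y y' h1 h2)
    convert this using 1
    simp only [Pi.smul_apply, smul_eq_mul]; ring

/-- vanishing families -/
def p0 (x : Fin n → P) (k : Type) [Field k] (b : Fin n) :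
    Submodule (MvPolynomial (Fin n) k) (Finset P → MvPolynomial (Fin n) k) where
  carrier := {f | ∀ y : P, b ∈ VV x y → f {y} ∈ pI k (VV x y)}
  zero_mem' := by intro y _; simp
  add_mem' := by
    intro f g hf hg y h1
    exact (pI k (VV x y)).add_mem (hf y h1) (hg y h1)
  smul_mem' := by
    intro a f hf y h1
    exact (pI k (VV x y)).mul_mem_left a (hf y h1)

theorem mem_Nn {b : Fin n} {f : Finset P → MvPolynomial (Fin n) k} : f ∈ Nn x k b ↔
    ∀ y y' : P, b ∈ VV x y → y < y' → f {y'} - f {y} ∈ pI k (VV x y) := Iff.rfl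
theorem mem_p0 {b : Fin n} {f : Finset P → MvPolynomial (Fin n) k} : f ∈ p0 x k b ↔
    ∀ y : P, b ∈ VV x y → f {y} ∈ pI k (VV x y) := Iff.rfl

theorem cob_pair {A : Type} [CommRing A] (f : Finset P → A) {y y' : P} (h : y < y') :
    cob (1 : P → A) f (insert y {y'}) = f {y'} - f {y} := by
  rw [cob_insert_min]
  · congr 1
    rw [cob_apply, Finset.sum_singleton]
    simp [sg, Finset.filter_singleton]
  · refine ⟨fun z hz => ?_, fun u hu v hv => ?_⟩
    · rw [Finset.mem_singleton] at hz; exact hz ▸ h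
    · rw [Finset.mem_singleton] at hu hv; subst hu; subst hv; exact Or.inl le_rfl

theorem mem_Yi_zero {b : Fin n} {f : Finset P → MvPolynomial (Fin n) k} :
    f ∈ Yi x r k b 0 ↔ ∀ y, b ∈ VV x y → (VV x y).card = r → f {y} ∈ pI k (VV x y) := by
  constructor
  · intro h y h1 h2 u hu
    obtain ⟨ψ, hψ⟩ := h u y h1 h2 hu
    have := hψ ∅ ⟨by simp, fun u hu => by simp at hu⟩ rfl
    simpa [cob_apply] using this
  · intro h u y h1 h2 h3
    refine ⟨0, fun c _ hc => ?_⟩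
    rw [Finset.card_eq_zero] at hc
    subst hc
    simpa using h y h1 h2 u h3

theorem Nn_le (b : Fin n) : Nn x k b ≤ (Yi x r k b 1).comap (dd P n k) := by
  intro f hf u y h1 h2 h3
  refine ⟨0, fun c hc hcm => ?_⟩
  obtain ⟨z, rfl⟩ := Finset.card_eq_one.1 hcm
  have hyz := hc.1 z (by simp)
  unfold dd
  simp only []
  rw [cob_pair _ hyz]
  simpa using hf y z h1 hyz u h3

theorem decomp [Finite P] (H : Good x r k) (b : Fin n) (f)
    (hf : dd P n k f ∈ Yi x r k b 1) :
    ∃ g ∈ Nn x k b, f - g ∈ Yi x r k b 0 := by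
  have := Fintype.ofFinite P
  have hu : ∀ u : Fin n →₀ ℕ, ∃ ψ : Finset P → k,
      (u ∉ Finset.univ.biUnion (fun c => (f c).support) → ψ = 0) ∧
      (∀ y, (VV x y).card = r → ψ {y} = 0) ∧
      (∀ y y', b ∈ VV x y → u.support ⊆ VV x y → y < y' →
        coeff u (f {y'}) - coeff u (f {y}) = ψ {y'} - ψ {y}) := by
    intro u
    by_cases hU : u ∈ Finset.univ.biUnion (fun c => (f c).support)
    swap
    · have : ∀ c, coeff u (f c) = 0 := by
        intro c
        by_contra h
        exact hU (by simp only [Finset.mem_biUnion, Finset.mem_univ, true_and]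
                     exact ⟨c, mem_support_iff.2 h⟩)
      exact ⟨0, fun _ => rfl, by simp, by simp [this]⟩
    obtain ⟨ψ, h1, h2⟩ := lift_u H b 0 f hf u
    refine ⟨ψ, fun h => absurd hU h, fun y hy => h1 {y} (by simp [hy]), fun y y' a1 a2 a3 => ?_⟩
    have hall : ∀ z ∈ insert y ({y'} : Finset P), y ≤ z := by
      intro z hz
      simp only [Finset.mem_insert, Finset.mem_singleton] at hz
      rcases hz with rfl | rfl
      · exact le_rfl
      · exact a3.le
    have := h2 (insert y {y'}) (fun z hz => ⟨VV_mono (hall z hz) a1, a2.trans (VV_mono (hall z hz))⟩)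
      (Ch.insert (fun u hu v hv => by
        rw [Finset.mem_singleton] at hu hv; subst hu; subst hv; exact Or.inl le_rfl)
        (by simpa using a3.le)) (by
        rw [Finset.card_insert_of_notMem (by simpa using a3.ne)]; rfl)
    rwa [cob_pair _ a3, cob_pair _ a3] at this
  choose G hG1 hG2 hG3 using hu
  obtain ⟨g, hg⟩ := assemble _ G hG1
  refine ⟨f - g, ?_, ?_⟩
  · intro y y' h1 h2 u hu
    have := hG3 u y y' h1 hu h2
    simp only [Pi.sub_apply, coeff_sub, hg]
    linear_combination this
  · rw [sub_sub_cancel, mem_Yi_zero]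
    intro y _ hy u hu
    rw [hg, hG2 u y hy]

theorem Yi_zero_p0 (H : Good x r k) (b : Fin n) (f) (h : f ∈ Nn x k b) (h' : f ∈ Yi x r k b 0) :
    f ∈ p0 x k b := by
  rw [mem_Yi_zero] at h'
  intro y hy
  obtain ⟨z, hz, hzr⟩ := H.facet y
  have h1 := pI_anti (k := k) (VV_mono (x := x) hz) (h' z (VV_mono hz hy) hzr)
  rcases hz.eq_or_lt with rfl | hlt
  · exact h1
  · have := (pI k (VV x y)).sub_mem h1 (h y z hy hlt)
    rwa [sub_sub_cancel] at this

end modlev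

end BB

namespace BB

section rvlev
variable {P : Type} [PartialOrder P] [OrderBot P] {n : ℕ} {x : Fin n → P} {r : ℕ}
  {k : Type} [Field k]

theorem exists_proj {E : Type} [AddCommGroup E] [Module k E] (W : Submodule k E) :
    ∃ q : E →ₗ[k] E, (∀ w ∈ W, q w = 0) ∧ ∀ h, h - q h ∈ W := by
  obtain ⟨s, hs⟩ := (W.mkQ).exists_rightInverse_of_surjective (Submodule.range_mkQ W)
  refine ⟨s ∘ₗ W.mkQ, fun w hw => ?_, fun h => ?_⟩
  · have : W.mkQ w = 0 := by simpa using hw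
    rw [LinearMap.comp_apply, this, map_zero]
  · rw [← Submodule.Quotient.mk_eq_zero, ← Submodule.mkQ_apply, map_sub, LinearMap.comp_apply]
    have := LinearMap.congr_fun hs (W.mkQ h)
    rw [LinearMap.comp_apply, LinearMap.id_apply] at this
    rw [this, sub_self]

theorem proj_coeff [Fintype P] (q : (Finset P → k) →ₗ[k] (Finset P → k)) (u : Fin n →₀ ℕ)
    (F : Finset P → MvPolynomial (Fin n) k) (c : Finset P) :
    coeff u (∑ c' : Finset P, q (Pi.single c' 1) c • F c') = q (fun c' => coeff u (F c')) c := by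
  have e : (fun c' => coeff u (F c')) = ∑ c' : Finset P, coeff u (F c') •
      (Pi.single c' 1 : Finset P → k) := by
    funext c
    rw [Finset.sum_apply]
    simp [Pi.single_apply]
  rw [e, map_sum, Finset.sum_apply, coeff_sum]
  refine Finset.sum_congr rfl fun c' _ => ?_
  rw [coeff_smul, map_smul, Pi.smul_apply, smul_eq_mul, smul_eq_mul, mul_comm]

theorem cob_pi {ι κ : Type} [PartialOrder ι] {A : Type} [CommRing A] (θ : ι → A)
    (f : Finset ι → κ → A) (τ : Finset ι) (c : κ) :
    cob θ f τ c = cob θ (fun τ => f τ c) τ := by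
  rw [cob_apply, cob_apply, Finset.sum_apply]
  rfl

theorem RV_Yi [Finite P] (H : Good x r k) (b : Fin n) (i : ℕ) {d : ℕ}
    (θ : Fin d → MvPolynomial (Fin n) k)
    (hθ : ∀ y, ∀ b ∈ VV x y, ∃ N : ℕ, ∃ c ∈ Ideal.span (Set.range θ), X b ^ N - c ∈ pI k (VV x y)) :
    RV θ ⊤ (Yi x r k b i) (r - i) := by
  have := Fintype.ofFinite P
  intro j hj f _ hfj hf
  have hproj := fun y : P => exists_proj (Wm k y i)
  choose q hq1 hq2 using hproj
  have hy : ∀ (y : P) (c : Finset P), ∃ h : Finset (Fin d) → MvPolynomial (Fin n) k,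
      (∀ τ, τ.card + 1 ≠ j → h τ = 0) ∧ (b ∈ VV x y → (VV x y).card + i = r →
      ∀ τ, (∑ c' : Finset P, q y (Pi.single c' 1) c • f τ (insert y c')) - cob θ h τ
        ∈ pI k (VV x y)) := by
    intro y c
    by_cases hyy : b ∈ VV x y ∧ (VV x y).card + i = r
    swap
    · exact ⟨0, fun _ _ => rfl, fun h h' => absurd ⟨h, h'⟩ hyy⟩
    obtain ⟨h1, h2⟩ := hyy
    obtain ⟨h, -, a1, a2⟩ := RV_poly θ (VV x y) (hθ y) j (by omega)
      (fun τ => ∑ c' : Finset P, q y (Pi.single c' 1) c • f τ (insert y c')) (fun _ => trivial)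
      (fun τ hτ => by simp [hfj τ hτ]) (fun τ => by
        intro u hu
        have e : cob θ (fun τ => ∑ c' : Finset P, q y (Pi.single c' 1) c • f τ (insert y c')) τ
            = ∑ c' : Finset P, q y (Pi.single c' 1) c • cob θ f τ (insert y c') := by
          simp only [cob_pi, cob_apply, Finset.smul_sum]
          rw [Finset.sum_comm]
          refine Finset.sum_congr rfl fun c' _ => Finset.sum_congr rfl fun v _ => ?_
          rw [smul_comm (θ v), smul_comm (sg τ v)]
        rw [e, proj_coeff (q y) u (fun c' => cob θ f τ (insert y c')) c]
        rw [hq1 y _ (hf τ u y h1 h2 hu)]; rfl)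
    exact ⟨h, a1, fun _ _ => a2⟩
  choose h hhj hh using hy
  refine ⟨fun τ c => ∑ y ∈ c.filter (fun y => (VV x y).card + i = r ∧ ∀ z ∈ c, y ≤ z),
    h y (c.erase y) τ, fun _ => trivial, fun τ hτ => ?_, fun τ => ?_⟩
  · funext c
    exact Finset.sum_eq_zero fun y _ => hhj _ _ _ hτ
  · intro u y h1 h2 h3
    refine Wm_congr (hq2 y (fun c => coeff u (f τ (insert y c)))) fun c hc hcm => ?_
    rw [Pi.sub_apply, Pi.sub_apply, cob_pi]
    have e1 : (insert y c).filter (fun y' => (VV x y').card + i = r ∧ ∀ z ∈ insert y c, y' ≤ z)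
        = {y} := by
      ext y'
      simp only [Finset.mem_filter, Finset.mem_singleton]
      constructor
      · rintro ⟨h5, h6, -⟩
        rw [Finset.mem_insert] at h5
        rcases h5 with h5 | h5
        · exact h5
        · have : (VV x y).card < (VV x y').card := H.strict (hc.1 y' h5)
          omega
      · rintro rfl
        refine ⟨by simp, h2, fun z hz => ?_⟩
        rw [Finset.mem_insert] at hz
        rcases hz with rfl | hz
        · exact le_rfl
        · exact (hc.1 z hz).le
    simp only [e1, Finset.sum_singleton, Finset.erase_insert (Kab.notMem hc)]
    have h5 := hh y c h1 h2 τ u h3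
    rw [coeff_sub, proj_coeff (q y) u (fun c' => f τ (insert y c')) c] at h5
    rw [coeff_sub]
    have : (fun τ => h y c τ) = h y c := rfl
    rw [this]
    linear_combination h5

theorem RV_comap [Finite P] (H : Good x r k) (b : Fin n) {d : ℕ}
    (θ : Fin d → MvPolynomial (Fin n) k)
    (hθ : ∀ y, ∀ b ∈ VV x y, ∃ N : ℕ, ∃ c ∈ Ideal.span (Set.range θ), X b ^ N - c ∈ pI k (VV x y))
    (q : ℕ) : ∀ i, q + i = r →
    RV θ ((Yi x r k b (i + 1)).comap (dd P n k)) (Yi x r k b i) q := by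
  induction q with
  | zero => intro i _ j hj; omega
  | succ q ih =>
    intro i hi
    refine RV_shift θ (dd P n k) _ _ ((Yi x r k b (i + 1 + 1)).comap (dd P n k)) q
      (fun f => dd_dd b _ f) (fun h hh => exact_Yi H b i h hh) (fun f hf => dd_Yi H b i f hf) ?_
      (ih (i + 1) (by omega))
    have := RV_Yi H b i θ hθ
    rwa [show r - i = q + 1 by omega] at this

theorem RV_Nn [Finite P] (H : Good x r k) (b : Fin n) {d : ℕ}
    (θ : Fin d → MvPolynomial (Fin n) k)
    (hθ : ∀ y, ∀ b ∈ VV x y, ∃ N : ℕ, ∃ c ∈ Ideal.span (Set.range θ), X b ^ N - c ∈ pI k (VV x y)) :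
    RV θ (Nn x k b) (p0 x k b) r := by
  intro j hj f hfN hfj hf
  obtain ⟨g, hg1, hg2, hg3⟩ := RV_comap H b θ hθ r 0 rfl j hj f (fun τ => Nn_le b (hfN τ)) hfj
    (fun τ => mem_Yi_zero.2 fun y hy _ => hf τ y hy)
  have hc : ∀ τ, ∃ ν ∈ Nn x k b, g τ - ν ∈ Yi x r k b 0 ∧ (τ.card + 1 ≠ j → ν = 0) := by
    intro τ
    by_cases hτ : τ.card + 1 = j
    · obtain ⟨ν, h1, h2⟩ := decomp H b (g τ) (hg1 τ)
      exact ⟨ν, h1, h2, fun h => absurd hτ h⟩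
    · exact ⟨0, Submodule.zero_mem _, by rw [hg2 τ hτ, sub_zero]; exact Submodule.zero_mem _,
        fun _ => rfl⟩
  choose ν h1 h2 h3 using hc
  refine ⟨ν, h1, h3, fun τ => Yi_zero_p0 H b _ (Submodule.sub_mem _ (hfN τ) (cob_mem θ _ _ h1 τ)) ?_⟩
  have e : f τ - cob θ ν τ = (f τ - cob θ g τ) + cob θ (fun τ => g τ - ν τ) τ := by
    have : cob θ (fun τ => g τ - ν τ) = cob θ g - cob θ ν := by rw [← map_sub]; rfl
    rw [this]; simp
  rw [e]
  exact Submodule.add_mem _ (hg3 τ) (cob_mem θ _ _ h2 τ)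

end rvlev

end BB

namespace BB

section trunc
variable {n : ℕ} {k : Type} [Field k]

/-- degree truncation -/
def tr (m : ℤ) (a : MvPolynomial (Fin n) k) : MvPolynomial (Fin n) k :=
  ∑ u ∈ a.support.filter (fun u => (u.degree : ℤ) ≤ m), monomial u (coeff u a)

theorem coeff_tr (m : ℤ) (a : MvPolynomial (Fin n) k) (u : Fin n →₀ ℕ) :
    coeff u (tr m a) = if (u.degree : ℤ) ≤ m then coeff u a else 0 := by
  unfold tr
  rw [coeff_sum]
  simp only [coeff_monomial]
  rw [Finset.sum_ite_eq']
  simp only [Finset.mem_filter, mem_support_iff]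
  by_cases h : coeff u a = 0
  · simp [h]
  · simp [h]

theorem tr_zero (m : ℤ) : tr m (0 : MvPolynomial (Fin n) k) = 0 := by
  ext u; rw [coeff_tr]; simp

theorem tr_add (m : ℤ) (a b : MvPolynomial (Fin n) k) : tr m (a + b) = tr m a + tr m b := by
  ext u; simp only [coeff_tr, coeff_add]; split_ifs <;> simp

theorem tr_neg (m : ℤ) (a : MvPolynomial (Fin n) k) : tr m (-a) = - tr m a := by
  ext u; simp only [coeff_tr, coeff_neg]; split_ifs <;> simp

theorem tr_sub (m : ℤ) (a b : MvPolynomial (Fin n) k) : tr m (a - b) = tr m a - tr m b := by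
  ext u; simp only [coeff_tr, coeff_sub]; split_ifs <;> simp

theorem tr_mul (m : ℤ) (e : ℕ) (θ a : MvPolynomial (Fin n) k) (hθ : θ.IsHomogeneous e) :
    tr (m + e) (θ * a) = θ * tr m a := by
  ext u
  rw [coeff_tr, coeff_mul, coeff_mul]
  split_ifs with h
  · refine Finset.sum_congr rfl fun p hp => ?_
    rw [Finset.HasAntidiagonal.mem_antidiagonal] at hp
    by_cases hp1 : p.1.degree = e
    · rw [coeff_tr, if_pos]
      rw [← hp, map_add, hp1] at h
      push_cast at h; omega
    · rw [hθ.coeff_eq_zero hp1]; simp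
  · symm
    refine Finset.sum_eq_zero fun p hp => ?_
    rw [Finset.HasAntidiagonal.mem_antidiagonal] at hp
    by_cases hp1 : p.1.degree = e
    · rw [coeff_tr, if_neg, mul_zero]
      rw [← hp, map_add, hp1] at h
      push_cast at h; omega
    · rw [hθ.coeff_eq_zero hp1]; simp

theorem tr_pI (m : ℤ) (σ : Finset (Fin n)) (a : MvPolynomial (Fin n) k) (h : a ∈ pI k σ) :
    tr m a ∈ pI k σ := by
  intro u hu
  rw [coeff_tr, h u hu, ite_self]

end trunc

set_option linter.unusedSectionVars false
section L5
variable {n : ℕ} {k : Type} [Field k] {κ : Type} [Finite κ] {ι : Type} [PartialOrder ι] [Finite ι]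

/-- truncated Koszul vanishing on `S` -/
def TV (θ : ι → MvPolynomial (Fin n) k)
    (X Y : Submodule (MvPolynomial (Fin n) k) (κ → MvPolynomial (Fin n) k))
    (S : Finset ι) : Prop :=
  ∀ j < S.card, ∀ f : Finset ι → κ → MvPolynomial (Fin n) k, (∀ τ, f τ ∈ X) →
    (∀ τ, ¬ (τ ⊆ S ∧ τ.card = j) → f τ = 0) → (∀ τ ⊆ S, cob θ f τ ∈ Y) →
    ∃ g : Finset ι → κ → MvPolynomial (Fin n) k, (∀ τ, g τ ∈ X) ∧
      ∀ τ ⊆ S, f τ - cob θ g τ ∈ Y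

theorem sg_above {S : Finset ι} {t v : ι} (h : v < t) : sg (insert t S) v = sg S v := by
  unfold sg
  rw [Finset.filter_insert, if_neg h.not_gt]

theorem sg_top {S : Finset ι} {t : ι} (h : ∀ v ∈ S, v < t) : sg (insert t S) t = (-1) ^ S.card := by
  unfold sg
  rw [Finset.filter_insert, if_neg (lt_irrefl t), Finset.filter_true_of_mem h]

theorem cob_insert_top {A : Type} [CommRing A] {Ω : Type} [AddCommGroup Ω] [Module A Ω]
    (θ : ι → A) (f : Finset ι → Ω) (t : ι) (τ : Finset ι)
    (ht : ∀ v ∈ τ, v < t) :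
    cob θ f (insert t τ) = ((-1 : ℤ) ^ τ.card) • (θ t • f τ) +
      cob θ (fun τ => f (insert t τ)) τ := by
  have hn : t ∉ τ := fun h => lt_irrefl t (ht t h)
  rw [cob_apply, cob_apply, Finset.sum_insert hn, Finset.erase_insert hn, sg_top ht]
  congr 1
  refine Finset.sum_congr rfl fun v hv => ?_
  rw [sg_above (ht v hv), Finset.erase_insert_of_ne (ht v hv).ne']

theorem cob_congr {A : Type} [CommRing A] {Ω : Type} [AddCommGroup Ω] [Module A Ω]
    (θ : ι → A) (f g : Finset ι → Ω) (τ : Finset ι)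
    (h : ∀ v ∈ τ, f (τ.erase v) = g (τ.erase v)) : cob θ f τ = cob θ g τ := by
  rw [cob_apply, cob_apply]
  exact Finset.sum_congr rfl fun v hv => by rw [h v hv]

theorem TV_step (θ : ι → MvPolynomial (Fin n) k) (e : ι → ℕ) (he : ∀ i, 0 < e i)
    (hθ : ∀ i, (θ i).IsHomogeneous (e i))
    (X Y : Submodule (MvPolynomial (Fin n) k) (κ → MvPolynomial (Fin n) k))
    (hX : ∀ m : ℤ, ∀ f ∈ X, (fun c => tr m (f c)) ∈ X)
    (hY : ∀ m : ℤ, ∀ f ∈ Y, (fun c => tr m (f c)) ∈ Y)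
    (S : Finset ι) (t : ι) (ht : ∀ v ∈ S, v < t) (H : TV θ X Y (insert t S)) : TV θ X Y S := by
  have := Fintype.ofFinite ι
  have := Fintype.ofFinite κ
  have hn : t ∉ S := fun h => lt_irrefl t (ht t h)
  intro j hj
  -- one step
  have one : ∀ f : Finset ι → κ → MvPolynomial (Fin n) k, (∀ τ, f τ ∈ X) →
    (∀ τ, ¬ (τ ⊆ S ∧ τ.card = j) → f τ = 0) → (∀ τ ⊆ S, cob θ f τ ∈ Y) →
    ∃ g f' : Finset ι → κ → MvPolynomial (Fin n) k, (∀ τ, g τ ∈ X) ∧ (∀ τ, f' τ ∈ X) ∧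
      (∀ τ, ¬ (τ ⊆ S ∧ τ.card = j) → f' τ = 0) ∧ (∀ τ ⊆ S, cob θ f' τ ∈ Y) ∧
      ∀ τ ⊆ S, τ.card = j → f τ - (cob θ g τ + θ t • f' τ) ∈ Y := by
    intro f hfX hfj hfY
    obtain ⟨G, hGX, hG⟩ := H (j + 1) (by rw [Finset.card_insert_of_notMem hn]; omega)
      (fun τ => if t ∈ τ then f (τ.erase t) else 0)
      (fun τ => by
        split_ifs
        · exact hfX _
        · exact X.zero_mem)
      (fun τ hτ => by
        split_ifs with h
        · apply hfj
          rintro ⟨h1, h2⟩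
          apply hτ
          refine ⟨?_, ?_⟩
          · rw [← Finset.insert_erase h]; exact Finset.insert_subset_insert t h1
          · rw [← Finset.card_erase_add_one h, h2]
        · rfl)
      (fun τ hτ => by
        by_cases h : t ∈ τ
        · have hτS : τ.erase t ⊆ S := by
            intro v hv
            rw [Finset.mem_erase] at hv
            have := hτ hv.2
            rw [Finset.mem_insert] at this
            exact this.resolve_left hv.1
          rw [← Finset.insert_erase h, cob_insert_top _ _ _ _ fun v hv => ht v (hτS hv)]
          have e1 : cob θ (fun τ' => if t ∈ insert t τ' then f ((insert t τ').erase t) else 0)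
              (τ.erase t) = cob θ f (τ.erase t) := by
            apply cob_congr
            intro v hv
            rw [if_pos (Finset.mem_insert_self _ _), Finset.erase_insert]
            intro h'
            exact (Finset.notMem_erase t τ) (Finset.mem_of_mem_erase h')
          rw [e1, if_neg (Finset.notMem_erase t τ), smul_zero, smul_zero, zero_add]
          exact hfY _ hτS
        · rw [cob_apply, Finset.sum_eq_zero]
          · exact Y.zero_mem
          · intro v hv
            rw [if_neg fun h' => h (Finset.mem_of_mem_erase h'), smul_zero, smul_zero])
    refine ⟨fun τ => G (insert t τ), fun τ => if τ ⊆ S ∧ τ.card = j then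
      ((-1 : ℤ) ^ j) • G τ else 0, fun τ => hGX _, fun τ => ?_, fun τ hτ => if_neg hτ, ?_, ?_⟩
    · simp only []
      split_ifs
      · exact zsmul_mem (hGX _) _
      · exact X.zero_mem
    · intro τ hτ
      by_cases hτj : τ.card = j + 1
      · have h1 := hG τ (hτ.trans (Finset.subset_insert _ _))
        have hnτ : t ∉ τ := fun h => hn (hτ h)
        simp only [hnτ, if_false, zero_sub] at h1
        have h2 : cob θ (fun τ => if τ ⊆ S ∧ τ.card = j then ((-1 : ℤ) ^ j) • G τ else 0) τ =
            ((-1 : ℤ) ^ j) • cob θ G τ := by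
          rw [cob_apply, cob_apply, Finset.smul_sum]
          refine Finset.sum_congr rfl fun v hv => ?_
          rw [if_pos ⟨(Finset.erase_subset _ _).trans hτ, by
            rw [Finset.card_erase_of_mem hv]; omega⟩]
          rw [smul_comm (θ v) ((-1 : ℤ) ^ j), smul_comm (sg τ v) ((-1 : ℤ) ^ j)]
        rw [h2]
        exact zsmul_mem (neg_mem_iff.1 h1) _
      · rw [cob_apply, Finset.sum_eq_zero]
        · exact Y.zero_mem
        · intro v hv
          rw [if_neg, smul_zero, smul_zero]
          rintro ⟨-, h⟩
          rw [Finset.card_erase_of_mem hv] at h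
          have := Finset.card_pos.2 ⟨v, hv⟩
          omega
    · intro τ hτ hτj
      have h1 := hG (insert t τ) (Finset.insert_subset_insert t hτ)
      have hnτ : t ∉ τ := fun h => hn (hτ h)
      rw [if_pos (Finset.mem_insert_self _ _), Finset.erase_insert hnτ,
        cob_insert_top _ _ _ _ fun v hv => ht v (hτ hv), hτj] at h1
      simp only []
      rw [if_pos ⟨hτ, hτj⟩, smul_comm (θ t), add_comm]
      exact h1
  -- truncation
  let eS : Finset ι → ℤ := fun τ => ∑ v ∈ τ, (e v : ℤ)
  let Pr : ℤ → (Finset ι → κ → MvPolynomial (Fin n) k) → Finset ι → κ → MvPolynomial (Fin n) k :=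
    fun E f τ c => tr (E + eS τ) (f τ c)
  have Prcob : ∀ E f, Pr E (cob θ f) = cob θ (Pr E f) := by
    intro E f
    funext τ c
    have hadd : ∀ (m : ℤ) (s : Finset ι) (F : ι → MvPolynomial (Fin n) k),
        tr m (∑ v ∈ s, F v) = ∑ v ∈ s, tr m (F v) := fun m s F =>
      map_sum (⟨⟨tr m, tr_zero m⟩, tr_add m⟩ : MvPolynomial (Fin n) k →+ MvPolynomial (Fin n) k) F s
    have hzs : ∀ (m z : ℤ) (a : MvPolynomial (Fin n) k), tr m (z • a) = z • tr m a := fun m z a =>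
      map_zsmul (⟨⟨tr m, tr_zero m⟩, tr_add m⟩ : MvPolynomial (Fin n) k →+ MvPolynomial (Fin n) k) z a
    show tr (E + eS τ) (cob θ f τ c) = _
    rw [cob_pi, cob_pi, cob_apply, cob_apply, hadd]
    refine Finset.sum_congr rfl fun v hv => ?_
    rw [hzs, smul_eq_mul, smul_eq_mul]
    congr 1
    have e1 : E + eS τ = (E + eS (τ.erase v)) + e v := by
      simp only [eS]
      rw [← Finset.add_sum_erase _ _ hv]; ring
    rw [e1, tr_mul _ _ _ _ (hθ v)]
  have main : ∀ N : ℕ, ∀ E : ℤ, E + eS Finset.univ < N →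
      ∀ f : Finset ι → κ → MvPolynomial (Fin n) k, (∀ τ, f τ ∈ X) →
      (∀ τ, ¬ (τ ⊆ S ∧ τ.card = j) → f τ = 0) → (∀ τ ⊆ S, cob θ f τ ∈ Y) →
      ∃ g : Finset ι → κ → MvPolynomial (Fin n) k, (∀ τ, g τ ∈ X) ∧
        ∀ τ ⊆ S, τ.card = j → Pr E f τ - cob θ g τ ∈ Y := by
    intro N
    induction N with
    | zero =>
      intro E hE f hfX hfj hfY
      refine ⟨0, fun τ => X.zero_mem, fun τ _ _ => ?_⟩
      have : Pr E f τ = 0 := by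
        funext c
        ext u
        show coeff u (tr (E + eS τ) (f τ c)) = 0
        rw [coeff_tr, if_neg]
        have : eS τ ≤ eS Finset.univ :=
          Finset.sum_le_sum_of_subset_of_nonneg (Finset.subset_univ _) (fun _ _ _ => by positivity)
        push_cast at hE
        have h0 : (0 : ℤ) ≤ u.degree := by positivity
        omega
      rw [this]; simp
    | succ N ih =>
      intro E hE f hfX hfj hfY
      obtain ⟨g, f', h1, h2, h3, h4, h5⟩ := one f hfX hfj hfY
      obtain ⟨g', a1, a2⟩ := ih (E - e t) (by
        have := he t
        push_cast at hE; omega) f' h2 h3 h4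
      refine ⟨fun τ => Pr E g τ + θ t • g' τ, fun τ => X.add_mem (hX _ _ (h1 τ))
        (X.smul_mem _ (a1 τ)), fun τ hτ hτj => ?_⟩
      have e1 : cob θ (fun τ => Pr E g τ + θ t • g' τ) = cob θ (Pr E g) + θ t • cob θ g' := by
        rw [← map_smul, ← map_add]; rfl
      have e2 : Pr E f τ - cob θ (fun τ => Pr E g τ + θ t • g' τ) τ =
          (fun c => tr (E + eS τ) ((f τ - (cob θ g τ + θ t • f' τ)) c)) +
          θ t • (Pr (E - e t) f' τ - cob θ g' τ) := by
        rw [e1, ← Prcob]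
        funext c
        simp only [Pi.add_apply, Pi.sub_apply, Pi.smul_apply, smul_eq_mul, tr_sub, tr_add, Pr]
        have : E + eS τ = (E - e t + eS τ) + e t := by ring
        have e3 : tr (E + eS τ) (θ t * f' τ c) = θ t * tr (E - e t + eS τ) (f' τ c) := by
          rw [this, tr_mul _ _ _ _ (hθ t)]
        rw [e3]; ring
      rw [e2]
      exact Y.add_mem (hY _ _ (h5 τ hτ hτj)) (Y.smul_mem _ (a2 τ hτ hτj))
  intro f hfX hfj hfY
  let B : ℕ := Finset.univ.sup fun τ => Finset.univ.sup fun c => (f τ c).support.sup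
    fun u => u.degree
  have hB : ∀ τ c u, coeff u (f τ c) ≠ 0 → u.degree ≤ B := by
    intro τ c u h
    calc u.degree ≤ (f τ c).support.sup fun u => u.degree :=
          Finset.le_sup (f := fun u : Fin n →₀ ℕ => u.degree) (mem_support_iff.2 h)
      _ ≤ Finset.univ.sup fun c => (f τ c).support.sup fun u => u.degree :=
          Finset.le_sup (f := fun c => (f τ c).support.sup fun u => u.degree) (Finset.mem_univ c)
      _ ≤ B := Finset.le_sup (f := fun τ => Finset.univ.sup fun c => (f τ c).support.sup
            fun u => u.degree) (Finset.mem_univ τ)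
  obtain ⟨g, g1, g2⟩ := main ((B : ℤ) + eS Finset.univ + 1).toNat B (by
    have : (0 : ℤ) ≤ eS Finset.univ := Finset.sum_nonneg fun _ _ => by positivity
    omega) f hfX hfj hfY
  have hPr : Pr B f = f := by
    funext τ c
    ext u
    show coeff u (tr (B + eS τ) (f τ c)) = _
    rw [coeff_tr]
    split_ifs with h
    · rfl
    · by_contra h'
      have := hB τ c u (Ne.symm h')
      have : (0 : ℤ) ≤ eS τ := Finset.sum_nonneg fun _ _ => by positivity
      omega
  rw [hPr] at g2
  refine ⟨fun τ => if τ.card + 1 = j then g τ else 0, fun τ => ?_, fun τ hτ => ?_⟩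
  · simp only []
    split_ifs
    · exact g1 τ
    · exact X.zero_mem
  · by_cases hτj : τ.card = j
    · have : cob θ (fun τ => if τ.card + 1 = j then g τ else 0) τ = cob θ g τ := by
        apply cob_congr
        intro v hv
        rw [if_pos]
        rw [Finset.card_erase_of_mem hv]
        have := Finset.card_pos.2 ⟨v, hv⟩
        omega
      rw [this]
      exact g2 τ hτ hτj
    · rw [hfj τ fun h => hτj h.2, cob_zero_card θ _ j (fun τ h => if_neg h) τ hτj]
      simp

theorem TV_down (θ : ι → MvPolynomial (Fin n) k) (e : ι → ℕ) (he : ∀ i, 0 < e i)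
    (hθ : ∀ i, (θ i).IsHomogeneous (e i))
    (X Y : Submodule (MvPolynomial (Fin n) k) (κ → MvPolynomial (Fin n) k))
    (hX : ∀ m : ℤ, ∀ f ∈ X, (fun c => tr m (f c)) ∈ X)
    (hY : ∀ m : ℤ, ∀ f ∈ Y, (fun c => tr m (f c)) ∈ Y)
    (htot : ∀ u v : ι, u ≤ v ∨ v ≤ u) (T U : Finset ι) (hTU : ∀ v ∈ T, ∀ u ∈ U, v < u)
    (H : TV θ X Y (T ∪ U)) : TV θ X Y T := by
  induction hU : U.card generalizing U with
  | zero => rw [Finset.card_eq_zero] at hU; subst hU; simpa using H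
  | succ N ih =>
    obtain ⟨t, ht, hmax⟩ := U.exists_maximal (Finset.card_pos.1 (by omega))
    have hlt : ∀ v ∈ U.erase t, v < t := by
      intro v hv
      rw [Finset.mem_erase] at hv
      rcases htot v t with h | h
      · exact lt_of_le_of_ne h hv.1
      · exact absurd (le_antisymm (hmax hv.2 h) h) hv.1
    apply ih (U.erase t) (fun v hv u hu => hTU v hv u (Finset.mem_of_mem_erase hu))
    · apply TV_step θ e he hθ X Y hX hY _ t
      · intro v hv
        rw [Finset.mem_union] at hv
        rcases hv with hv | hv
        · exact hTU v hv t ht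
        · exact hlt v hv
      · rw [← Finset.union_insert, Finset.insert_erase ht]; exact H
    · rw [Finset.card_erase_of_mem ht]; omega

theorem TV_final (θ : ι → MvPolynomial (Fin n) k)
    (X Y : Submodule (MvPolynomial (Fin n) k) (κ → MvPolynomial (Fin n) k))
    (T : Finset ι) (i : ι) (hi : i ∈ T) (H : TV θ X Y T)
    (s : ι → κ → MvPolynomial (Fin n) k) (hs : ∀ v, s v ∈ X)
    (h : ∑ v ∈ T, θ v • s v ∈ Y) :
    ∃ t : ι → κ → MvPolynomial (Fin n) k, (∀ v, t v ∈ X) ∧ 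
      s i - ∑ v ∈ T.erase i, θ v • t v ∈ Y := by
  have hTc := Finset.card_pos.2 ⟨i, hi⟩
  have hinj : ∀ v ∈ T, ∀ w ∈ T, T.erase v = T.erase w → v = w := by
    intro v hv w hw h
    by_contra hne
    have : v ∈ T.erase w := Finset.mem_erase.2 ⟨hne, hv⟩
    rw [← h] at this
    exact Finset.notMem_erase v T this
  have hval : ∀ v ∈ T, (∑ w ∈ T, if T.erase v = T.erase w then sg T w • s w else 0) =
      sg T v • s v := by
    intro v hv
    rw [Finset.sum_eq_single v]
    · rw [if_pos rfl]
    · intro w hw hne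
      rw [if_neg fun h => hne (hinj v hv w hw h).symm]
    · intro h; exact absurd hv h
  obtain ⟨g, g1, g2⟩ := H (T.card - 1) (by omega)
    (fun τ => ∑ v ∈ T, if τ = T.erase v then sg T v • s v else 0)
    (fun τ => X.sum_mem fun v _ => by
      split_ifs
      · exact zsmul_mem (hs v) _
      · exact X.zero_mem)
    (fun τ hτ => Finset.sum_eq_zero fun v hv => by
      rw [if_neg]
      rintro rfl
      exact hτ ⟨Finset.erase_subset _ _, Finset.card_erase_of_mem hv⟩)
    (fun τ hτ => by
      by_cases hT : τ = T
      · subst hT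
        rw [cob_apply]
        have : ∀ v ∈ τ, sg τ v • (θ v • ∑ w ∈ τ, if τ.erase v = τ.erase w then sg τ w • s w else 0)
            = θ v • s v := by
          intro v hv
          rw [hval v hv, smul_comm (θ v), smul_smul, sg_mul_self, one_smul]
        rw [Finset.sum_congr rfl this]
        exact h
      · rw [cob_zero_card θ _ T.card]
        · exact Y.zero_mem
        · intro τ hτ
          refine Finset.sum_eq_zero fun v hv => ?_
          rw [if_neg]
          rintro rfl
          exact hτ (Finset.card_erase_add_one hv)
        · intro hc
          exact hT (Finset.eq_of_subset_of_card_le hτ hc.ge))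
  have h1 := g2 (T.erase i) (Finset.erase_subset _ _)
  rw [hval i hi, cob_apply] at h1
  refine ⟨fun v => sg T i • (sg (T.erase i) v • g ((T.erase i).erase v)),
    fun v => zsmul_mem (zsmul_mem (g1 _) _) _, ?_⟩
  have h2 := zsmul_mem h1 (sg T i)
  rw [smul_sub, smul_smul, sg_mul_self, one_smul, Finset.smul_sum] at h2
  convert h2 using 3
  rename_i v _
  rw [smul_comm (θ v), smul_comm (θ v)]

end L5

section concl
variable {P : Type} [PartialOrder P] [OrderBot P] {n : ℕ} {x : Fin n → P} {r : ℕ}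
  {k : Type} [Field k]

theorem reg_Nn [Finite P] (H : Good x r k) (b : Fin n) {d : ℕ} (hd : d ≤ r)
    (θ : Fin d → MvPolynomial (Fin n) k) (e : Fin d → ℕ) (he : ∀ i, 0 < e i)
    (hhom : ∀ i, (θ i).IsHomogeneous (e i))
    (hθ : ∀ y, ∀ b ∈ VV x y, ∃ N : ℕ, ∃ c ∈ Ideal.span (Set.range θ), X b ^ N - c ∈ pI k (VV x y))
    (i : Fin d) (s : Fin d → Finset P → MvPolynomial (Fin n) k) (hs : ∀ v, s v ∈ Nn x k b)
    (h : ∑ v ∈ Finset.univ.filter (fun v => v ≤ i), θ v • s v ∈ p0 x k b) :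
    ∃ t : Fin d → Finset P → MvPolynomial (Fin n) k, (∀ v, t v ∈ Nn x k b) ∧ 
      s i - ∑ v ∈ Finset.univ.filter (fun v => v < i), θ v • t v ∈ p0 x k b := by
  have h0 := RV_Nn H b θ hθ
  have h1 : TV θ (Nn x k b) (p0 x k b) Finset.univ := by
    intro j hj f a1 a2 a3
    rw [Finset.card_univ, Fintype.card_fin] at hj
    obtain ⟨g, g1, -, g3⟩ := h0 j (by omega) f a1 (fun τ hτ => a2 τ fun h => hτ h.2)
      (fun τ => a3 τ (Finset.subset_univ _))
    exact ⟨g, g1, fun τ _ => g3 τ⟩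
  have h2 := TV_down θ e he hhom (Nn x k b) (p0 x k b) (fun m f hf y y' a1 a2 => by
      have := tr_pI m _ _ (hf y y' a1 a2)
      rwa [tr_sub] at this)
    (fun m f hf y a1 => tr_pI m _ _ (hf y a1)) le_total (Finset.univ.filter (fun v => v ≤ i))
    (Finset.univ.filter (fun v => ¬ v ≤ i)) (by
      intro v hv u hu
      simp only [Finset.mem_filter, Finset.mem_univ, true_and, not_le] at hv hu
      exact lt_of_le_of_lt hv hu) (by
      convert h1
      ext v
      simp only [Finset.mem_union, Finset.mem_filter, Finset.mem_univ, true_and, iff_true]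
      tauto)
  obtain ⟨t, t1, t2⟩ := TV_final θ _ _ _ i (by simp) h2 s hs h
  refine ⟨t, t1, ?_⟩
  convert t2 using 3
  ext v
  simp only [Finset.mem_filter, Finset.mem_univ, true_and, Finset.mem_erase]
  rw [lt_iff_le_and_ne]; tauto

end concl

end BB

namespace BB

section facering
variable {P : Type} [Fintype P] [PartialOrder P] [OrderBot P] {n : ℕ} {x : Fin n → P} {r : ℕ}
  {k : Type} [Field k]

/-- squarefree monomial -/
def sqm (k : Type) [Field k] (σ : Finset (Fin n)) : MvPolynomial (Fin n) k := ∏ b ∈ σ, X b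

theorem sqm_mem_pI {σ τ : Finset (Fin n)} (h : ¬ σ ⊆ τ) : sqm k σ ∈ pI k τ := by
  obtain ⟨b, hb, hb'⟩ := Finset.not_subset.1 h
  unfold sqm
  rw [← Finset.mul_prod_erase _ _ hb]
  exact Ideal.mul_mem_right _ _ (X_mem_pI hb')

theorem Good.glb (H : Good x r k) {w y t m : P} (hw : w ≤ t) (hy : y ≤ t) (hm : IsGLB {w, y} m) :
    VV x m = VV x w ∩ VV x y := by
  obtain ⟨z, hz, hzV⟩ := H.face t (VV x w ∩ VV x y) (Finset.inter_subset_left.trans (VV_mono hw))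
  apply subset_antisymm
  · exact Finset.subset_inter (VV_mono (hm.1 (by simp))) (VV_mono (hm.1 (by simp)))
  · rw [← hzV]
    apply VV_mono
    apply hm.2
    intro a ha
    simp only [Set.mem_insert_iff, Set.mem_singleton_iff] at ha
    rcases ha with rfl | rfl
    · exact H.le_of t _ _ hz hw (hzV ▸ Finset.inter_subset_left)
    · exact H.le_of t _ _ hz hy (hzV ▸ Finset.inter_subset_right)

theorem Good.exists_glb (H : Good x r k) {w y t : P} (hw : w ≤ t) (hy : y ≤ t) :
    ∃ m, IsGLB {w, y} m := by
  obtain ⟨z, hz, hzV⟩ := H.face t (VV x w ∩ VV x y) (Finset.inter_subset_left.trans (VV_mono hw))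
  refine ⟨z, ?_, ?_⟩
  · intro a ha
    simp only [Set.mem_insert_iff, Set.mem_singleton_iff] at ha
    rcases ha with rfl | rfl
    · exact H.le_of t _ _ hz hw (hzV ▸ Finset.inter_subset_left)
    · exact H.le_of t _ _ hz hy (hzV ▸ Finset.inter_subset_right)
  · intro a ha
    have h1 : a ≤ w := ha (by simp)
    have h2 : a ≤ y := ha (by simp)
    apply H.le_of t _ _ (h1.trans hw) hz
    rw [hzV]
    exact Finset.subset_inter (VV_mono h1) (VV_mono h2)

theorem mem_ub {w y z : P} : z ∈ upperBounds ({w, y} : Set P) ↔ w ≤ z ∧ y ≤ z := by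
  simp [upperBounds]

theorem Good.mub_V (H : Good x r k) {w y z : P} (hz : z ∈ MUB w y) :
    VV x z = VV x w ∪ VV x y := by
  have hz1 := mem_ub.1 hz.1
  obtain ⟨z', hz', hV⟩ := H.face z (VV x w ∪ VV x y)
    (Finset.union_subset (VV_mono hz1.1) (VV_mono hz1.2))
  have : z' = z := hz.2 z' (mem_ub.2 ⟨H.le_of z _ _ hz1.1 hz' (hV ▸ Finset.subset_union_left),
    H.le_of z _ _ hz1.2 hz' (hV ▸ Finset.subset_union_right)⟩) hz'
  rw [← this, hV]

theorem Good.exists_mub (H : Good x r k) {w y t : P} (hw : w ≤ t) (hy : y ≤ t) :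
    ∃ z ∈ MUB w y, z ≤ t := by
  obtain ⟨z', hz', hV⟩ := H.face t (VV x w ∪ VV x y)
    (Finset.union_subset (VV_mono hw) (VV_mono hy))
  refine ⟨z', ⟨mem_ub.2 ⟨H.le_of t _ _ hw hz' (hV ▸ Finset.subset_union_left),
    H.le_of t _ _ hy hz' (hV ▸ Finset.subset_union_right)⟩, fun z hz hzz => ?_⟩, hz'⟩
  have hz1 := mem_ub.1 hz
  refine H.eq_of hzz le_rfl (subset_antisymm (VV_mono hzz) ?_)
  rw [hV]
  exact Finset.union_subset (VV_mono hz1.1) (VV_mono hz1.2)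

/-- restriction to a face, on polynomials -/
def rh0 (x : Fin n → P) (k : Type) [Field k] (y : P) :
    MvPolynomial P k →ₐ[k] MvPolynomial (Fin n) k :=
  aeval fun z => if z ≤ y then sqm k (VV x z) else 0

theorem rh0_X (y z : P) : rh0 x k y (X z) = if z ≤ y then sqm k (VV x z) else 0 := by
  simp [rh0]

theorem rh0_ker (H : Good x r k) (y : P) : ∀ a ∈ faceIdeal P k, rh0 x k y a = 0 := by
  suffices h : faceIdeal P k ≤ RingHom.ker (rh0 x k y) from fun a ha => h ha
  unfold faceIdeal
  rw [Ideal.span_le]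
  rintro f ((⟨w, z, h, rfl⟩ | ⟨w, z, m, h, hm, rfl⟩) | rfl)
  · rw [SetLike.mem_coe, RingHom.mem_ker, map_mul, rh0_X, rh0_X]
    split_ifs with h1 h2
    · exfalso
      have : y ∈ upperBounds ({w, z} : Set P) := mem_ub.2 ⟨h1, h2⟩
      rw [h] at this
      exact this
    all_goals simp
  · rw [SetLike.mem_coe, RingHom.mem_ker, map_sub, map_mul, map_mul, map_sum]
    simp only [rh0_X]
    by_cases hwz : w ≤ y ∧ z ≤ y
    · obtain ⟨h1, h2⟩ := hwz
      obtain ⟨z0, hz0, hz0y⟩ := H.exists_mub h1 h2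
      rw [Finset.sum_eq_single z0]
      · have hmy : m ≤ y := le_trans (hm.1 (by simp)) h1
        rw [if_pos h1, if_pos h2, if_pos hmy, if_pos hz0y, H.glb h1 h2 hm, H.mub_V hz0]
        unfold sqm
        rw [mul_comm (∏ b ∈ VV x w ∩ VV x z, _), Finset.prod_union_inter, sub_self]
      · intro z1 hz1 hne
        rw [Set.Finite.mem_toFinset] at hz1
        rw [if_neg]
        intro h
        exact hne (H.eq_of h hz0y (by rw [H.mub_V hz0, H.mub_V hz1]))
      · intro h
        exact absurd ((Set.Finite.mem_toFinset _).2 hz0) h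
    · rw [Finset.sum_eq_zero, mul_zero, sub_zero]
      · by_cases h1 : w ≤ y
        · rw [if_neg fun h2 => hwz ⟨h1, h2⟩, mul_zero]
        · rw [if_neg h1, zero_mul]
      · intro z1 hz1
        rw [Set.Finite.mem_toFinset] at hz1
        have := mem_ub.1 hz1.1
        rw [if_neg]
        intro h
        exact hwz ⟨this.1.trans h, this.2.trans h⟩
  · rw [SetLike.mem_coe, RingHom.mem_ker, map_sub, rh0_X, if_pos bot_le, H.bot]
    simp [sqm]

/-- restriction to a face -/
def rh (H : Good x r k) (y : P) : FaceRing P k →ₐ[k] MvPolynomial (Fin n) k :=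
  Ideal.Quotient.liftₐ (faceIdeal P k) (rh0 x k y) (rh0_ker H y)

theorem rh_mk (H : Good x r k) (y : P) (a : MvPolynomial P k) :
    rh H y (Ideal.Quotient.mk _ a) = rh0 x k y a := rfl

theorem rh_fv (H : Good x r k) (y z : P) :
    rh H y (fv P k z) = if z ≤ y then sqm k (VV x z) else 0 := by
  unfold fv
  rw [rh_mk, rh0_X]

/-- the structure map -/
def ph (x : Fin n → P) (k : Type) [Field k] : MvPolynomial (Fin n) k →ₐ[k] FaceRing P k :=
  aeval fun i => fv P k (x i)

theorem ph_X (i : Fin n) : ph x k (X i) = fv P k (x i) := by simp [ph]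

theorem congr_hom {σ : Type} (f g : MvPolynomial σ k →ₐ[k] MvPolynomial (Fin n) k)
    (I : Ideal (MvPolynomial (Fin n) k)) (h : ∀ z, f (X z) - g (X z) ∈ I) (p) :
    f p - g p ∈ I := by
  have : (Ideal.Quotient.mkₐ k I).comp f = (Ideal.Quotient.mkₐ k I).comp g := by
    apply algHom_ext
    intro z
    exact Ideal.Quotient.eq.2 (h z)
  exact Ideal.Quotient.eq.1 (AlgHom.congr_fun this p)

theorem mem_VV {i : Fin n} {y : P} : i ∈ VV x y ↔ x i ≤ y := by simp [VV]

theorem rh_ph_X (H : Good x r k) (y : P) (i : Fin n) :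
    rh H y (ph x k (X i)) = if i ∈ VV x y then X i else 0 := by
  rw [ph_X, rh_fv, H.atom]
  simp [sqm, mem_VV]

theorem rh_ph (H : Good x r k) (y : P) (a) : rh H y (ph x k a) - a ∈ pI k (VV x y) := by
  refine congr_hom ((rh H y).comp (ph x k)) (AlgHom.id k _) _ (fun i => ?_) a
  rw [AlgHom.comp_apply, rh_ph_X, AlgHom.id_apply]
  split_ifs with h
  · simp
  · rw [zero_sub, neg_mem_iff]; exact X_mem_pI h

theorem rh_compat (H : Good x r k) {y y' : P} (h : y ≤ y') (s) :
    rh H y' s - rh H y s ∈ pI k (VV x y) := by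
  obtain ⟨p, rfl⟩ := Ideal.Quotient.mk_surjective s
  rw [rh_mk, rh_mk]
  refine congr_hom _ _ _ (fun z => ?_) p
  rw [rh0_X, rh0_X]
  by_cases h1 : z ≤ y
  · rw [if_pos h1, if_pos (h1.trans h), sub_self]; exact Submodule.zero_mem _
  · rw [if_neg h1, sub_zero]
    split_ifs with h2
    · apply sqm_mem_pI
      intro hs
      exact h1 (H.le_of y' _ _ h2 h hs)
    · exact Submodule.zero_mem _

theorem fv_bot : fv P k ⊥ = 1 := by
  unfold fv
  rw [← map_one (Ideal.Quotient.mk (faceIdeal P k)), Ideal.Quotient.eq]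
  exact Ideal.subset_span (Or.inr rfl)

theorem fv_mul_zero {w y : P} (h : upperBounds ({w, y} : Set P) = ∅) : fv P k w * fv P k y = 0 := by
  unfold fv
  rw [← map_mul, Ideal.Quotient.eq_zero_iff_mem]
  exact Ideal.subset_span (Or.inl (Or.inl ⟨w, y, h, rfl⟩))

theorem fv_mul {w y m : P} (h : (upperBounds ({w, y} : Set P)).Nonempty) (hm : IsGLB {w, y} m) :
    fv P k w * fv P k y = fv P k m * ∑ z ∈ (Set.toFinite (MUB w y)).toFinset, fv P k z := by
  unfold fv
  rw [← map_mul, ← map_sum, ← map_mul, Ideal.Quotient.eq]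
  exact Ideal.subset_span (Or.inl (Or.inr ⟨w, y, m, h, hm, rfl⟩))

theorem Good.eq_bot (H : Good x r k) {m : P} (h : VV x m = ∅) : m = ⊥ :=
  H.eq_of (y := m) le_rfl bot_le (by rw [h, H.bot])

theorem fv_le (H : Good x r k) (N : ℕ) : ∀ {m z : P}, (VV x m).card = N → m ≤ z →
    fv P k m * fv P k z = ph x k (sqm k (VV x m)) * fv P k z := by
  induction N with
  | zero =>
    intro m z h _
    rw [Finset.card_eq_zero] at h
    rw [H.eq_bot h, fv_bot, H.bot]
    simp [sqm]
  | succ N ih =>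
    intro m z h hmz
    obtain ⟨i, hi⟩ : (VV x m).Nonempty := Finset.card_pos.1 (by omega)
    obtain ⟨m', hm', hV⟩ := H.face m ((VV x m).erase i) (Finset.erase_subset _ _)
    have hcard : (VV x m').card = N := by
      rw [hV, Finset.card_erase_of_mem hi]; omega
    have hxi : x i ≤ m := mem_VV.1 hi
    have hglb : IsGLB {m', x i} (⊥ : P) := by
      obtain ⟨t, ht⟩ := H.exists_glb hm' hxi
      have := H.glb hm' hxi ht
      rw [hV, H.atom, Finset.erase_inter, Finset.inter_singleton_of_mem hi,
        Finset.erase_singleton] at this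
      rwa [H.eq_bot this] at ht
    have h1 : fv P k m' * fv P k (x i) * fv P k z = fv P k m * fv P k z := by
      rw [fv_mul ⟨m, mem_ub.2 ⟨hm', hxi⟩⟩ hglb, fv_bot, one_mul, Finset.sum_mul,
        Finset.sum_eq_single m]
      · intro w hw hne
        rw [Set.Finite.mem_toFinset] at hw
        apply fv_mul_zero
        rw [Set.eq_empty_iff_forall_notMem]
        intro t ht
        have ht := mem_ub.1 ht
        apply hne
        refine H.eq_of ht.1 (hmz.trans ht.2) ?_
        rw [H.mub_V hw, hV, H.atom]
        ext j
        simp only [Finset.mem_union, Finset.mem_erase, Finset.mem_singleton]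
        constructor
        · rintro (h | rfl)
          · exact h.2
          · exact hi
        · intro hj
          by_cases hji : j = i
          · exact Or.inr hji
          · exact Or.inl ⟨hji, hj⟩
      · intro hnot
        exfalso
        apply hnot
        rw [Set.Finite.mem_toFinset]
        refine ⟨mem_ub.2 ⟨hm', hxi⟩, fun t ht htm => ?_⟩
        have ht := mem_ub.1 ht
        refine H.eq_of htm le_rfl (subset_antisymm (VV_mono htm) ?_)
        intro j hj
        by_cases hji : j = i
        · subst hji; exact mem_VV.2 ht.2
        · exact VV_mono ht.1 (by rw [hV, Finset.mem_erase]; exact ⟨hji, hj⟩)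
    rw [← h1]
    have h2 := ih hcard (hm'.trans hmz)
    rw [mul_right_comm, h2, hV]
    unfold sqm
    rw [← Finset.prod_erase_mul _ _ hi, map_mul, ph_X]
    ring

/-- indicator exponent -/
def ind (σ : Finset (Fin n)) : Fin n →₀ ℕ := ∑ b ∈ σ, Finsupp.single b 1

theorem ind_apply (σ : Finset (Fin n)) (i : Fin n) : ind σ i = if i ∈ σ then 1 else 0 := by
  unfold ind
  rw [Finsupp.finsetSum_apply]
  simp [Finsupp.single_apply]

theorem sqm_eq (σ : Finset (Fin n)) : sqm k σ = monomial (ind σ) 1 := by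
  unfold sqm ind
  rw [monomial_sum_one]
  rfl

/-- basis elements of the face ring -/
def mon (x : Fin n → P) (k : Type) [Field k] (y : P) (u : Fin n →₀ ℕ) : FaceRing P k :=
  ph x k (monomial (u - ind (VV x y)) 1) * fv P k y

theorem ind_le {σ : Finset (Fin n)} {u : Fin n →₀ ℕ} (h : σ ⊆ u.support) : ind σ ≤ u := by
  intro i
  rw [ind_apply]
  split_ifs with hi
  · have := h hi
    rw [Finsupp.mem_support_iff] at this
    omega
  · exact Nat.zero_le _

theorem supp_add_ind {σ : Finset (Fin n)} {u : Fin n →₀ ℕ} (h : u.support ⊆ σ) :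
    (u + ind σ).support = σ := by
  ext i
  rw [Finsupp.mem_support_iff, Finsupp.add_apply, ind_apply]
  by_cases hi : i ∈ σ
  · simp [hi]
  · have : u i = 0 := by
      by_contra h'
      exact hi (h (Finsupp.mem_support_iff.2 h'))
    simp [hi, this]

theorem span_mon (H : Good x r k) (s : FaceRing P k) :
    s ∈ Submodule.span k {t : FaceRing P k | ∃ (y : P) (u : Fin n →₀ ℕ), u.support = VV x y ∧
      t = mon x k y u} := by
  set S := Submodule.span k {t : FaceRing P k | ∃ (y : P) (u : Fin n →₀ ℕ), u.support = VV x y ∧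
      t = mon x k y u} with hS
  have hgen : ∀ (y : P) (u : Fin n →₀ ℕ), u.support ⊆ VV x y →
      ph x k (monomial u 1) * fv P k y ∈ S := by
    intro y u hu
    apply Submodule.subset_span
    refine ⟨y, u + ind (VV x y), supp_add_ind hu, ?_⟩
    unfold mon
    rw [add_tsub_cancel_right]
  have hmul : ∀ (w : P), ∀ t ∈ S, t * fv P k w ∈ S := by
    intro w t ht
    induction ht using Submodule.span_induction with
    | zero => rw [zero_mul]; exact S.zero_mem
    | add a b _ _ ha hb => rw [add_mul]; exact S.add_mem ha hb
    | smul c a _ ha => rw [smul_mul_assoc]; exact S.smul_mem c ha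
    | mem t ht =>
      obtain ⟨y, u, hu, rfl⟩ := ht
      unfold mon
      rw [mul_assoc]
      by_cases hub : (upperBounds ({y, w} : Set P)).Nonempty
      · obtain ⟨t, ht⟩ := hub
        have ht1 := mem_ub.1 ht
        obtain ⟨m, hm⟩ := H.exists_glb ht1.1 ht1.2
        rw [fv_mul ⟨t, ht⟩ hm, Finset.mul_sum, Finset.mul_sum]
        refine Submodule.sum_mem _ fun z hz => ?_
        rw [Set.Finite.mem_toFinset] at hz
        have hz1 := mem_ub.1 hz.1
        have hmy : m ≤ y := hm.1 (by simp)
        have hmz : m ≤ z := hmy.trans hz1.1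
        rw [fv_le H _ rfl hmz, ← mul_assoc, ← map_mul, sqm_eq, monomial_mul, one_mul]
        apply hgen
        intro i hi
        apply VV_mono hz1.1
        rw [Finsupp.mem_support_iff, Finsupp.add_apply] at hi
        by_contra hiy
        apply hi
        have h1 : u i = 0 := by
          by_contra h'
          exact hiy (hu ▸ Finsupp.mem_support_iff.2 h')
        have h2 : i ∉ VV x m := fun h => hiy (VV_mono hmy h)
        rw [ind_apply, if_neg h2, Finsupp.tsub_apply, h1]; simp
      · rw [fv_mul_zero (Set.not_nonempty_iff_eq_empty.1 hub), mul_zero]; exact S.zero_mem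
  obtain ⟨p, rfl⟩ := Ideal.Quotient.mk_surjective s
  induction p using MvPolynomial.induction_on with
  | C a =>
    have h1 : (1 : FaceRing P k) ∈ S := by
      have := hgen ⊥ 0 (by simp)
      rw [fv_bot, mul_one] at this
      convert this using 1
      rw [← map_one (ph x k)]; rfl
    have := S.smul_mem a h1
    convert this using 1
    have h2 : (C a : MvPolynomial P k) = a • 1 := C_eq_smul_one
    rw [h2]; rfl
  | add p q hp hq => rw [map_add]; exact S.add_mem hp hq
  | mul_X p w hp => rw [map_mul]; exact hmul w _ hp

theorem rh_ph_monomial (H : Good x r k) (z : P) (u : Fin n →₀ ℕ) (hu : u.support ⊆ VV x z) :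
    rh H z (ph x k (monomial u 1)) = monomial u 1 := by
  rw [monomial_eq, map_one, one_mul, Finsupp.prod, map_prod, map_prod]
  refine Finset.prod_congr rfl fun i hi => ?_
  rw [map_pow, map_pow, rh_ph_X, if_pos (hu hi)]

theorem rh_mon (H : Good x r k) (y z : P) (u : Fin n →₀ ℕ) (hu : u.support = VV x y) :
    rh H z (mon x k y u) = if y ≤ z then monomial u 1 else 0 := by
  unfold mon
  rw [map_mul, rh_fv]
  split_ifs with h
  · rw [rh_ph_monomial, sqm_eq, monomial_mul, one_mul, tsub_add_cancel_of_le (ind_le hu.ge)]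
    refine subset_trans ?_ (VV_mono h)
    rw [← hu]
    exact Finsupp.support_mono tsub_le_self
  · rw [mul_zero]

/-- the inverse construction, componentwise -/
def Psi (x : Fin n → P) (k : Type) [Field k] (y : P) :
    MvPolynomial (Fin n) k →ₗ[k] FaceRing P k :=
  (basisMonomials (Fin n) k).constr k fun u => if u.support = VV x y then mon x k y u else 0

theorem Psi_monomial (y : P) (u : Fin n →₀ ℕ) (c : k) :
    Psi x k y (monomial u c) = c • if u.support = VV x y then mon x k y u else 0 := by
  have : (monomial u c : MvPolynomial (Fin n) k) = c • basisMonomials (Fin n) k u := by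
    simp [smul_monomial]
  rw [this, map_smul, Psi, Module.Basis.constr_basis]

theorem Psi_pI (y : P) (a) (ha : a ∈ pI k (VV x y)) : Psi x k y a = 0 := by
  rw [← support_sum_monomial_coeff a, map_sum]
  refine Finset.sum_eq_zero fun u hu => ?_
  rw [Psi_monomial, if_neg, smul_zero]
  intro h
  exact mem_support_iff.1 hu (ha u h.le)

theorem Psi_rh (H : Good x r k) (s : FaceRing P k) : ∑ z : P, Psi x k z (rh H z s) = s := by
  have hs := span_mon H s
  induction hs using Submodule.span_induction with
  | zero => simp
  | add a b _ _ ha hb =>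
    conv_rhs => rw [← ha, ← hb]
    rw [← Finset.sum_add_distrib]
    simp only [map_add]
  | smul c a _ ha =>
    conv_rhs => rw [← ha]
    rw [Finset.smul_sum]
    simp only [map_smul]
  | mem t ht =>
    obtain ⟨y, u, hu, rfl⟩ := ht
    simp only [rh_mon H y _ u hu]
    rw [Finset.sum_eq_single y]
    · rw [if_pos le_rfl, Psi_monomial, one_smul, if_pos hu]
    · intro z _ hne
      split_ifs with h
      · rw [Psi_monomial, one_smul, if_neg]
        intro h'
        exact hne (H.eq_of le_rfl h (by rw [← h', hu]))
      · exact map_zero _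
    · intro h; exact absurd (Finset.mem_univ _) h

theorem rh_inj (H : Good x r k) (s : FaceRing P k) (h : ∀ z, rh H z s ∈ pI k (VV x z)) : s = 0 := by
  rw [← Psi_rh H s]
  exact Finset.sum_eq_zero fun z _ => Psi_pI z _ (h z)

theorem coeff_rh_Psi (H : Good x r k) (y z : P) (u : Fin n →₀ ℕ) (a) :
    coeff u (rh H z (Psi x k y a)) = if y ≤ z ∧ u.support = VV x y then coeff u a else 0 := by
  induction a using MvPolynomial.induction_on' with
  | monomial v c =>
    rw [Psi_monomial, map_smul, coeff_smul, coeff_monomial]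
    by_cases hv : v.support = VV x y
    · rw [if_pos hv, rh_mon H y z v hv]
      by_cases hyz : y ≤ z
      · by_cases hvu : v = u
        · subst hvu; simp [hyz, hv, coeff_monomial]
        · simp [hyz, hvu, coeff_monomial]
      · simp [hyz]
    · rw [if_neg hv, map_zero, coeff_zero, smul_zero]
      split_ifs with h1 h2
      · subst h2; exact absurd h1.2 hv
      · rfl
      · rfl
  | add p q hp hq =>
    rw [map_add, map_add, coeff_add, hp, hq, coeff_add]
    split_ifs <;> simp

theorem rh_surj (H : Good x r k) (F : P → MvPolynomial (Fin n) k)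
    (hF : ∀ y y', y ≤ y' → F y' - F y ∈ pI k (VV x y)) (z : P) :
    rh H z (∑ y : P, Psi x k y (F y)) - F z ∈ pI k (VV x z) := by
  intro u hu
  obtain ⟨y0, hy0, hV⟩ := H.face z u.support hu
  rw [coeff_sub, map_sum, coeff_sum]
  simp only [coeff_rh_Psi]
  rw [Finset.sum_eq_single y0]
  · rw [if_pos ⟨hy0, hV.symm⟩]
    have := hF y0 z hy0 u hV.ge
    rw [coeff_sub] at this
    linear_combination -this
  · intro y _ hne
    rw [if_neg]
    rintro ⟨h1, h2⟩
    exact hne (H.eq_of h1 hy0 (by rw [← h2, hV]))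
  · intro h; exact absurd (Finset.mem_univ _) h

end facering

end BB

namespace BB

section concl
variable {P : Type} [Fintype P] [PartialOrder P] [OrderBot P] {n : ℕ} {x : Fin n → P} {r : ℕ}
  {k : Type} [Field k]

theorem rh_ph_mul (H : Good x r k) (y : P) (a) (s : FaceRing P k) :
    rh H y (ph x k a * s) - a * rh H y s ∈ pI k (VV x y) := by
  rw [map_mul, ← sub_mul]
  exact Ideal.mul_mem_right _ _ (rh_ph H y a)

theorem rh_ph_sum (H : Good x r k) (y : P) {d : ℕ} (J : Finset (Fin d))
    (θ : Fin d → MvPolynomial (Fin n) k) (S : Fin d → FaceRing P k) :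
    rh H y (∑ v ∈ J, ph x k (θ v) * S v) - ∑ v ∈ J, θ v * rh H y (S v) ∈ pI k (VV x y) := by
  rw [map_sum, ← Finset.sum_sub_distrib]
  exact Ideal.sum_mem _ fun v _ => rh_ph_mul H y _ _

theorem concl (H : Good x r k) (b : Fin n) {d : ℕ} (hd : d ≤ r)
    (θ : Fin d → MvPolynomial (Fin n) k) (e : Fin d → ℕ) (he : ∀ i, 0 < e i)
    (hhom : ∀ i, (θ i).IsHomogeneous (e i))
    (hθ : ∀ y, ∀ b ∈ VV x y, ∃ N : ℕ, ∃ c ∈ Ideal.span (Set.range θ), X b ^ N - c ∈ pI k (VV x y))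
    (i : Fin d) (S : Fin d → FaceRing P k)
    (h : ∑ v ∈ Finset.univ.filter (fun v => v ≤ i), ph x k (θ v) * S v = 0) :
    ∃ T : Fin d → FaceRing P k,
      ph x k (X b) * S i = ∑ v ∈ Finset.univ.filter (fun v => v < i), ph x k (θ v) * T v := by
  let s : Fin d → Finset P → MvPolynomial (Fin n) k := fun v c => ∑ y ∈ c, rh H y (S v)
  have s1 : ∀ v y, s v {y} = rh H y (S v) := fun v y => Finset.sum_singleton _ _
  obtain ⟨t, ht, ht2⟩ := reg_Nn H b hd θ e he hhom hθ i s (by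
    intro v y y' _ hy
    rw [s1, s1]
    exact rh_compat H hy.le _) (by
    intro y _
    have := rh_ph_sum H y (Finset.univ.filter (fun v => v ≤ i)) θ S
    rw [h, map_zero, zero_sub, neg_mem_iff] at this
    rw [Finset.sum_apply]
    simpa [s1] using this)
  let F : Fin d → P → MvPolynomial (Fin n) k := fun v y =>
    if b ∈ VV x y then X b * t v {y} else 0
  have hF : ∀ v, ∀ y y', y ≤ y' → F v y' - F v y ∈ pI k (VV x y) := by
    intro v y y' hy
    simp only [F]
    by_cases hb : b ∈ VV x y
    · rw [if_pos hb, if_pos (VV_mono hy hb), ← mul_sub]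
      rcases eq_or_lt_of_le hy with rfl | hy
      · simp
      · exact Ideal.mul_mem_left _ _ (ht v y y' hb hy)
    · rw [if_neg hb, sub_zero]
      split_ifs
      · exact Ideal.mul_mem_right _ _ (X_mem_pI hb)
      · exact Submodule.zero_mem _
  refine ⟨fun v => ∑ y : P, Psi x k y (F v y), ?_⟩
  rw [← sub_eq_zero]
  apply rh_inj H
  intro z
  rw [map_sub]
  have h1 := rh_ph_sum H z (Finset.univ.filter (fun v => v < i)) θ
    (fun v => ∑ y : P, Psi x k y (F v y))
  have h2 : ∑ v ∈ Finset.univ.filter (fun v => v < i), θ v * rh H z (∑ y : P, Psi x k y (F v y))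
      - ∑ v ∈ Finset.univ.filter (fun v => v < i), θ v * F v z ∈ pI k (VV x z) := by
    rw [← Finset.sum_sub_distrib]
    refine Ideal.sum_mem _ fun v _ => ?_
    rw [← mul_sub]
    exact Ideal.mul_mem_left _ _ (rh_surj H (F v) (hF v) z)
  have h3 := rh_ph_mul H z (X b) (S i)
  have h4 : X b * rh H z (S i) - ∑ v ∈ Finset.univ.filter (fun v => v < i), θ v * F v z ∈
      pI k (VV x z) := by
    by_cases hb : b ∈ VV x z
    · have := Ideal.mul_mem_left _ (X b) (ht2 z hb)
      rw [Pi.sub_apply, s1, Finset.sum_apply, mul_sub, Finset.mul_sum] at this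
      convert this using 3 with v hv
      simp only [F, if_pos hb, Pi.smul_apply, smul_eq_mul]; ring
    · apply Ideal.sub_mem
      · exact Ideal.mul_mem_right _ _ (X_mem_pI hb)
      · refine Ideal.sum_mem _ fun v _ => ?_
        simp [F, if_neg hb]
  have := Ideal.sub_mem _ (Ideal.add_mem _ h3 h4) (Ideal.add_mem _ h1 h2)
  convert this using 1
  ring

/-- the degree `N` component -/
def hc (N : ℕ) (a : MvPolynomial (Fin n) k) : MvPolynomial (Fin n) k := tr N a - tr (N - 1) a

theorem coeff_hc (N : ℕ) (a : MvPolynomial (Fin n) k) (u : Fin n →₀ ℕ) :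
    coeff u (hc N a) = if u.degree = N then coeff u a else 0 := by
  unfold hc
  rw [coeff_sub, coeff_tr, coeff_tr]
  by_cases h : u.degree = N
  · rw [if_pos h, if_pos (by omega), if_neg (by omega), sub_zero]
  · rw [if_neg h]
    by_cases h2 : (u.degree : ℤ) ≤ N
    · rw [if_pos h2, if_pos (by omega), sub_self]
    · rw [if_neg h2, if_neg (by omega), sub_self]

theorem tr_span (m : ℤ) {d : ℕ} (θ : Fin d → MvPolynomial (Fin n) k) (e : Fin d → ℕ)
    (hhom : ∀ i, (θ i).IsHomogeneous (e i)) (a) (ha : a ∈ Ideal.span (Set.range θ)) :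
    tr m a ∈ Ideal.span (Set.range θ) := by
  induction ha using Submodule.span_induction with
  | mem _ h =>
    obtain ⟨i, rfl⟩ := h
    have := tr_mul (m - e i) (e i) (θ i) 1 (hhom i)
    rw [mul_one, sub_add_cancel] at this
    rw [this]
    exact Ideal.mul_mem_right _ _ (Ideal.subset_span ⟨i, rfl⟩)
  | zero => rw [tr_zero]; exact Submodule.zero_mem _
  | add a b _ _ ha hb => rw [tr_add]; exact Submodule.add_mem _ ha hb
  | smul c a hc ih => 
    obtain ⟨f, rfl⟩ := (Ideal.mem_span_range_iff_exists_fun).1 hc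
    rw [smul_eq_mul, Finset.mul_sum]
    have h0 : ∀ J : Finset (Fin d), tr m (∑ i ∈ J, c * (f i * θ i)) ∈ Ideal.span (Set.range θ) := by
      intro J
      induction J using Finset.induction_on with
      | empty => rw [Finset.sum_empty, tr_zero]; exact Submodule.zero_mem _
      | insert i J hi ih => 
        rw [Finset.sum_insert hi, tr_add]
        refine Submodule.add_mem _ ?_ ih
        have := tr_mul (m - e i) (e i) (θ i) (c * f i) (hhom i)
        rw [sub_add_cancel] at this
        rw [← mul_assoc, mul_comm, this]
        exact Ideal.mul_mem_right _ _ (Ideal.subset_span ⟨i, rfl⟩)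
    exact h0 _

theorem hc_poly (b : Fin n) (J : Finset ℕ) (g : ℕ → k) (N : ℕ) (hN : N ∈ J)
    (c : MvPolynomial (Fin n) k) :
    hc N ((∑ l ∈ J, g l • X b ^ l) - c) = C (g N) * X b ^ N - hc N c := by
  ext u
  rw [coeff_hc, coeff_sub, coeff_sub, coeff_hc, coeff_sum, coeff_C_mul]
  have hX : ∀ l, coeff u (X b ^ l : MvPolynomial (Fin n) k) = 
      if Finsupp.single b l = u then 1 else 0 := fun l => by
    rw [MvPolynomial.coeff_X_pow]
  by_cases h : u.degree = N
  · rw [if_pos h, if_pos h, Finset.sum_eq_single N]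
    · rw [coeff_smul, smul_eq_mul]
    · intro l _ hl
      rw [coeff_smul, hX, if_neg, smul_zero]
      rintro rfl
      rw [Finsupp.degree_single] at h
      exact hl h
    · intro h; exact absurd hN h
  · rw [if_neg h, if_neg h, hX, if_neg]
    · simp
    · rintro rfl
      exact h (Finsupp.degree_single _ _)

set_option maxHeartbeats 1000000 in
theorem sop (H : Good x r k) {d : ℕ}
    (θ : Fin d → MvPolynomial (Fin n) k) (e : Fin d → ℕ)
    (hhom : ∀ i, (θ i).IsHomogeneous (e i))
    (hfin : FiniteDimensional k (FaceRing P k ⧸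
        Submodule.span k {s : FaceRing P k | ∃ (i : Fin d) (t : FaceRing P k), s = ph x k (θ i) * t}))
    (y : P) (b : Fin n) (hb : b ∈ VV x y) :
    ∃ N : ℕ, ∃ c ∈ Ideal.span (Set.range θ), X b ^ N - c ∈ pI k (VV x y) := by
  set W := Submodule.span k
    {s : FaceRing P k | ∃ (i : Fin d) (t : FaceRing P k), s = ph x k (θ i) * t} with hW
  have hdep : ¬ LinearIndependent k (fun l : ℕ => W.mkQ (ph x k (X b ^ l))) := by
    intro h
    exact Set.infinite_univ_iff.2 inferInstance (Set.finite_univ_iff.2 h.finite)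
  rw [linearIndependent_iff'] at hdep
  push Not at hdep
  obtain ⟨J, g, hg, N, hN, hgN⟩ := hdep
  have h1 : ph x k (∑ l ∈ J, g l • X b ^ l) ∈ W := by
    rw [← Submodule.ker_mkQ W, LinearMap.mem_ker, ← hg, map_sum, map_sum]
    simp only [map_smul]
  have h2 : ∀ s ∈ W, ∃ c ∈ Ideal.span (Set.range θ), rh H y s - c ∈ pI k (VV x y) := by
    intro s hs
    induction hs using Submodule.span_induction with
    | mem _ h =>
      obtain ⟨i, t, rfl⟩ := h
      exact ⟨_, Ideal.mul_mem_right _ _ (Ideal.subset_span ⟨i, rfl⟩), rh_ph_mul H y _ _⟩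
    | zero => exact ⟨0, Submodule.zero_mem _, by simp⟩
    | add a b _ _ ha hb =>
      obtain ⟨c, h1, h2⟩ := ha
      obtain ⟨c', h1', h2'⟩ := hb
      refine ⟨c + c', Ideal.add_mem _ h1 h1', ?_⟩
      have := Ideal.add_mem _ h2 h2'
      convert this using 1
      rw [map_add]; ring
    | smul a s _ hs =>
      obtain ⟨c, h1, h2⟩ := hs
      refine ⟨C a * c, Ideal.mul_mem_left _ _ h1, ?_⟩
      have := Ideal.mul_mem_left _ (C a) h2
      convert this using 1
      rw [map_smul, smul_eq_C_mul]; ring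
  obtain ⟨c, hc1, hc2⟩ := h2 _ h1
  have h3 : (∑ l ∈ J, g l • X b ^ l) - c ∈ pI k (VV x y) := by
    have := Ideal.sub_mem _ hc2 (rh_ph H y (∑ l ∈ J, g l • X b ^ l))
    convert this using 1
    ring
  have h4 : hc N ((∑ l ∈ J, g l • X b ^ l) - c) ∈ pI k (VV x y) :=
    Ideal.sub_mem _ (tr_pI _ _ _ h3) (tr_pI _ _ _ h3)
  have h5 := hc_poly b J g N hN c
  rw [h5] at h4
  refine ⟨N, C (g N)⁻¹ * hc N c, Ideal.mul_mem_left _ _ (Ideal.sub_mem _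
    (tr_span _ θ e hhom _ hc1) (tr_span _ θ e hhom _ hc1)), ?_⟩
  have := Ideal.mul_mem_left _ (C (g N)⁻¹) h4
  rwa [mul_sub, ← mul_assoc, ← C_mul, inv_mul_cancel₀ hgN, C_1, one_mul] at this

end concl
end BB

namespace BB

section dimension
variable {P : Type} [Fintype P] [PartialOrder P] [OrderBot P] {n : ℕ} {x : Fin n → P} {r : ℕ}
  {k : Type} [Field k]

theorem dim_pI (σ : Finset (Fin n)) :
    ringKrullDim (MvPolynomial (Fin n) k ⧸ pI k σ) ≤ (σ.card : WithBot ℕ∞) := by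
  let f : MvPolynomial σ k →ₐ[k] MvPolynomial (Fin n) k ⧸ pI k σ :=
    (Ideal.Quotient.mkₐ k (pI k σ)).comp (rename (Subtype.val))
  have hf : Function.Surjective f := by
    rw [← AlgHom.range_eq_top, eq_top_iff]
    intro a _
    obtain ⟨p, rfl⟩ := Ideal.Quotient.mk_surjective a
    induction p using MvPolynomial.induction_on with
    | C a => exact Subalgebra.algebraMap_mem f.range a
    | add p q hp hq => rw [map_add]; exact Subalgebra.add_mem _ (hp trivial) (hq trivial)
    | mul_X p b hp =>
      rw [map_mul]
      refine Subalgebra.mul_mem _ (hp trivial) ?_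
      by_cases hb : b ∈ σ
      · refine ⟨X ⟨b, hb⟩, ?_⟩
        change Ideal.Quotient.mk _ (rename _ _) = _
        rw [rename_X]
      · rw [Ideal.Quotient.eq_zero_iff_mem.2 (X_mem_pI hb)]
        exact Subalgebra.zero_mem _
  refine (ringKrullDim_le_of_surjective f.toRingHom hf).trans ?_
  rw [MvPolynomial.ringKrullDim_of_isNoetherianRing, ringKrullDim_eq_zero_of_field]
  simp

theorem dim_le (H : Good x r k) (I : Ideal (MvPolynomial (Fin n) k))
    (hI : ∀ a, (∀ y : P, a ∈ pI k (VV x y)) → a ∈ I) :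
    ringKrullDim (MvPolynomial (Fin n) k ⧸ I) ≤ (r : WithBot ℕ∞) := by
  rw [ringKrullDim_quotient]
  refine iSup_le fun p => ?_
  have h0 : (Finset.univ.inf fun y : P => pI k (VV x y)) ≤ p.head.1.asIdeal := by
    refine le_trans ?_ p.head.2
    intro a ha
    apply hI
    intro y
    exact (Finset.inf_le (Finset.mem_univ y) : (Finset.univ.inf fun y : P => pI k (VV x y)) ≤ _) ha
  obtain ⟨y, -, hy⟩ := (Ideal.IsPrime.inf_le' p.head.1.2).1 h0
  have hall : ∀ i, (p i).1 ∈ PrimeSpectrum.zeroLocus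
      ((pI k (VV x y) : Ideal (MvPolynomial (Fin n) k)) : Set (MvPolynomial (Fin n) k)) := by
    intro i
    have h1 : p.head ≤ p i := LTSeries.head_le p i
    exact le_trans hy h1
  let q : LTSeries (PrimeSpectrum.zeroLocus
      ((pI k (VV x y) : Ideal (MvPolynomial (Fin n) k)) : Set (MvPolynomial (Fin n) k))) :=
    ⟨p.length, fun i => ⟨(p i).1, hall i⟩, fun i => p.step i⟩
  have h2 := Order.LTSeries.length_le_krullDim q
  rw [← ringKrullDim_quotient] at h2
  refine le_trans h2 (le_trans (dim_pI (VV x y)) ?_)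
  exact_mod_cast H.rank_le y

end dimension
end BB

namespace BB

section good
variable {P : Type} [Fintype P] [PartialOrder P] [OrderBot P] {n : ℕ} {x : Fin n → P} {r : ℕ}
  {k : Type} [Field k]

theorem simp_struct (hP : IsSimplicialPoset P)
    (hinj : Function.Injective x) (hatom : ∀ i, IsAtom (x i))
    (hsurj : ∀ a : P, IsAtom a → ∃ i, x i = a) (y : P) :
    ∃ (m : ℕ) (e : Set.Icc (⊥ : P) y ≃o Finset (Fin m)) (g : Fin m → Fin n),
      Function.Injective g ∧ ∀ z (hz : z ≤ y), VV x z = (e ⟨z, bot_le, hz⟩).image g := by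
  obtain ⟨m, ⟨e⟩⟩ := hP y
  have hbot : ∀ a : Set.Icc (⊥ : P) y, a.1 = ⊥ ↔ e a = ∅ := by
    intro a
    have h0 : e ⟨⊥, le_rfl, bot_le⟩ = ∅ := by
      rw [← Finset.subset_empty]
      have : (⟨⊥, le_rfl, bot_le⟩ : Set.Icc (⊥ : P) y) ≤ e.symm ∅ := (bot_le : ⊥ ≤ (e.symm ∅).1)
      have h2 := e.monotone this
      rwa [e.apply_symm_apply] at h2
    constructor
    · intro h
      rw [← h0]
      congr 1
      exact Subtype.ext h
    · intro h
      rw [← h0] at h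
      exact congrArg Subtype.val (e.injective h)
  have hat : ∀ j, IsAtom (e.symm {j}).1 := by
    intro j
    constructor
    · rw [Ne, hbot, e.apply_symm_apply]
      exact Finset.singleton_ne_empty j
    · intro z hz
      have hz' : (⟨z, bot_le, hz.le.trans (e.symm {j}).2.2⟩ : Set.Icc (⊥ : P) y) < e.symm {j} := hz
      have h2 := e.strictMono hz'
      rw [e.apply_symm_apply] at h2
      have h3 := Finset.ssubset_singleton_iff.1 h2
      exact (hbot _).2 h3
  choose g hg using fun j => hsurj _ (hat j)
  refine ⟨m, e, g, ?_, ?_⟩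
  · intro j j' h
    have h1 : (e.symm {j}).1 = (e.symm {j'}).1 := by rw [← hg, ← hg, h]
    have h2 := e.symm.injective (Subtype.ext h1)
    exact Finset.singleton_injective h2
  · intro z hz
    ext i
    rw [Finset.mem_image, mem_VV]
    constructor
    · intro hi
      have h1 : e ⟨x i, bot_le, hi.trans hz⟩ ≠ ∅ := fun h => (hatom i).1 ((hbot _).2 h)
      obtain ⟨j, hj⟩ := Finset.nonempty_iff_ne_empty.2 h1
      have h2 : e.symm {j} ≤ ⟨x i, bot_le, hi.trans hz⟩ := by
        rw [OrderIso.symm_apply_le]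
        exact Finset.singleton_subset_iff.2 hj
      have h3 : (e.symm {j}).1 ≤ x i := h2
      have h4 : (e.symm {j}).1 = x i := by
        rcases eq_or_lt_of_le h3 with h | h
        · exact h
        · exact absurd ((hatom i).2 _ h) (hat j).1
      refine ⟨j, ?_, hinj (by rw [hg, h4])⟩
      have h5 : (⟨x i, bot_le, hi.trans hz⟩ : Set.Icc (⊥ : P) y) ≤ ⟨z, bot_le, hz⟩ := hi
      exact e.monotone h5 hj
    · rintro ⟨j, hj, rfl⟩
      have h2 : e.symm {j} ≤ ⟨z, bot_le, hz⟩ := by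
        rw [OrderIso.symm_apply_le]
        exact Finset.singleton_subset_iff.2 hj
      rw [hg]
      exact h2

theorem cDelta_apply (K : Set (Finset P)) (f : Finset P → k) (s : Finset P) :
    cDelta k P K f s = if s ∈ K then cob (1 : P → k) f s else 0 := by
  unfold cDelta
  rw [LinearMap.pi_apply]
  split_ifs
  · rw [cob_apply, LinearMap.sum_apply]
    refine Finset.sum_congr rfl fun v _ => ?_
    simp only [sg, LinearMap.smul_apply, LinearMap.proj_apply, Pi.one_apply, one_mul,
      smul_eq_mul, zsmul_eq_mul]
    push_cast
    rfl
  · rfl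

theorem mem_cGraded {K : Set (Finset P)} {i : ℤ} {f : Finset P → k} :
    f ∈ cGraded k P K i ↔ ∀ s, ¬ (s ∈ K ∧ (s.card : ℤ) = i + 1) → f s = 0 := by
  unfold cGraded
  rw [Submodule.mem_pi]
  refine forall_congr' fun s => ?_
  split_ifs with h
  · exact ⟨fun _ h' => absurd h h', fun _ _ => trivial⟩
  · exact ⟨fun h' _ => (Submodule.mem_bot k).1 (h' trivial), fun h' _ => (Submodule.mem_bot k).2 (h' h)⟩

theorem van_of_coh (v : P) (m : ℕ) (h : Subsingleton (Coh k P (Kab v) ((m : ℤ) - 1)))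
    (φ : Finset P → k) (hφ : ∀ c ∈ Kab v, c.card = m + 1 → cob (1 : P → k) φ c = 0) :
    φ ∈ Wm k v m := by
  rw [Submodule.Quotient.subsingleton_iff] at h
  let φ' : Finset P → k := fun c => if c ∈ Kab v ∧ c.card = m then φ c else 0
  have h1 : φ' ∈ ZC k P (Kab v) ((m : ℤ) - 1) := by
    refine ⟨?_, ?_⟩
    · rw [SetLike.mem_coe, LinearMap.mem_ker]
      funext s
      rw [cDelta_apply]
      split_ifs with hs
      · by_cases hc : s.card = m + 1
        · rw [Pi.zero_apply, ← hφ s hs hc, cob_apply, cob_apply]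
          refine Finset.sum_congr rfl fun u hu => ?_
          congr 2
          simp only [φ']
          rw [if_pos ⟨Kab.erase hs u, by rw [Finset.card_erase_of_mem hu, hc]; rfl⟩]
        · rw [cob_apply]
          refine Finset.sum_eq_zero fun u hu => ?_
          simp only [φ']
          rw [if_neg, smul_zero, smul_zero]
          rintro ⟨-, h2⟩
          rw [Finset.card_erase_of_mem hu] at h2
          have := Finset.card_pos.2 ⟨u, hu⟩
          omega
      · rfl
    · rw [SetLike.mem_coe, mem_cGraded]
      intro s hs
      simp only [φ']
      rw [if_neg]
      rintro ⟨h1, h2⟩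
      exact hs ⟨h1, by omega⟩
  have h2 : (⟨φ', h1⟩ : ZC k P (Kab v) ((m : ℤ) - 1)) ∈
      Submodule.comap (ZC k P (Kab v) ((m : ℤ) - 1)).subtype (BC k P (Kab v) ((m : ℤ) - 1)) := by
    rw [h]; trivial
  obtain ⟨ψ, -, hψ⟩ := h2
  refine mem_Wm.2 ⟨ψ, fun c hc hm => ?_⟩
  have h3 := congrFun hψ c
  rw [cDelta_apply, if_pos hc] at h3
  rw [h3]
  change φ c = φ' c
  simp only [φ']
  rw [if_pos ⟨hc, hm⟩]

theorem ne_bot_iff {q : P} : ¬ IsMin q ↔ q ≠ ⊥ := by rw [isMin_iff_eq_bot]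

theorem chain_iff {c : Finset P} : IsChain (· ≤ ·) (c : Set P) ↔ Ch c := by
  constructor
  · intro h u hu v hv
    by_cases huv : u = v
    · exact Or.inl huv.le
    · exact h hu hv huv
  · intro h u hu v hv _
    exact h u hu v hv

theorem exists_sat (v : P) : ∃ G : Finset P, ((∀ g ∈ G, g < v ∧ g ≠ ⊥) ∧ Ch G) ∧
    ∀ t, t ≠ ⊥ → t < v → (∀ g ∈ G, t ≤ g ∨ g ≤ t) → t ∈ G := by
  have hne : ({G : Finset P | (∀ g ∈ G, g < v ∧ g ≠ ⊥) ∧ Ch G}).Nonempty :=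
    ⟨∅, by simp, fun u hu => by simp at hu⟩
  obtain ⟨G, hG⟩ := (Set.toFinite {G : Finset P | (∀ g ∈ G, g < v ∧ g ≠ ⊥) ∧ Ch G}).exists_maximal hne
  refine ⟨G, hG.1, fun t ht htv hc => ?_⟩
  have : insert t G ∈ {G : Finset P | (∀ g ∈ G, g < v ∧ g ≠ ⊥) ∧ Ch G} := by
    refine ⟨fun g hg => ?_, ?_⟩
    · rcases Finset.mem_insert.1 hg with rfl | hg
      · exact ⟨htv, ht⟩
      · exact hG.1.1 g hg
    · intro a ha b hb
      rcases Finset.mem_insert.1 ha with rfl | ha1 <;> rcases Finset.mem_insert.1 hb with rfl | hb1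
      · exact Or.inl le_rfl
      · exact hc b hb1
      · exact (hc a ha1).symm
      · exact hG.1.2 a ha1 b hb1
  exact hG.2 this (Finset.subset_insert _ _) (Finset.mem_insert_self _ _)

theorem link_eq (v : P) (hv : v ≠ ⊥) : ∃ G : Finset P, G ∈ linkK P ({v} : Finset P) ∧
    linkK P (insert v G) = Kab v := by
  obtain ⟨G, ⟨hG1, hG2⟩, hG3⟩ := exists_sat v
  refine ⟨G, ⟨?_, ?_, ?_⟩, ?_⟩
  · intro q hq h
    rw [Finset.mem_singleton] at h
    exact (hG1 q hq).1.ne h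
  · intro q hq
    rw [ne_bot_iff]
    rcases Finset.mem_union.1 hq with h | h
    · exact (hG1 q h).2
    · rw [Finset.mem_singleton] at h; rwa [h]
  · rw [chain_iff]
    intro a ha b hb
    rw [Finset.mem_union, Finset.mem_singleton] at ha hb
    rcases ha with ha | rfl <;> rcases hb with hb | rfl
    · exact hG2 a ha b hb
    · exact Or.inl (hG1 a ha).1.le
    · exact Or.inr (hG1 b hb).1.le
    · exact Or.inl le_rfl
  · ext s
    constructor
    · rintro ⟨h1, h2, h3⟩
      rw [chain_iff] at h3
      refine ⟨fun z hz => ?_, h3.subset Finset.subset_union_left⟩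
      have hzv : z ≠ v := fun h => h1 z hz (h ▸ Finset.mem_insert_self _ _)
      have hzs : z ∈ s ∪ insert v G := Finset.mem_union_left _ hz
      rcases h3.lt z hzs v (Finset.mem_union_right _ (Finset.mem_insert_self _ _)) hzv with h | h
      · exfalso
        refine h1 z hz (Finset.mem_insert_of_mem (hG3 z (ne_bot_iff.1 (h2 z hzs)) h fun g hg => ?_))
        exact h3 z hzs g (Finset.mem_union_right _ (Finset.mem_insert_of_mem hg))
      · exact h
    · rintro ⟨h1, h2⟩
      refine ⟨fun q hq h => ?_, fun q hq => ?_, ?_⟩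
      · have hvq := h1 q hq
        rcases Finset.mem_insert.1 h with rfl | h
        · exact lt_irrefl _ hvq
        · exact lt_asymm hvq (hG1 q h).1
      · rw [ne_bot_iff]
        rcases Finset.mem_union.1 hq with h | h
        · exact ((bot_le).trans_lt (h1 q h)).ne'
        · rcases Finset.mem_insert.1 h with rfl | h
          · exact hv
          · exact (hG1 q h).2
      · rw [chain_iff]
        intro a ha b hb
        rw [Finset.mem_union, Finset.mem_insert] at ha hb
        rcases ha with ha | rfl | ha <;> rcases hb with hb | rfl | hb
        · exact h2 a ha b hb
        · exact Or.inr (h1 a ha).le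
        · exact Or.inr ((hG1 b hb).1.trans (h1 a ha)).le
        · exact Or.inl (h1 b hb).le
        · exact Or.inl le_rfl
        · exact Or.inr (hG1 b hb).1.le
        · exact Or.inl ((hG1 a ha).1.trans (h1 b hb)).le
        · exact Or.inl (hG1 a ha).1.le
        · exact hG2 a ha b hb

theorem exists_good (hP : IsSimplicialPoset P)
    (hinj : Function.Injective x) (hatom : ∀ i, IsAtom (x i))
    (hsurj : ∀ a : P, IsAtom a → ∃ i, x i = a)
    (hpure : ∀ y z : P, IsMax y → IsMax z → Order.height y = Order.height z)
    (hCM : ∀ v : P, v ≠ ⊥ → ∀ G : Finset P, G ∈ linkK P ({v} : Finset P) →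
      ∀ i : ℤ, (∃ s ∈ linkK P (insert v G), (i : ℤ) < (s.card : ℤ) - 1) →
        Subsingleton (Coh k P (linkK P (insert v G)) i)) :
    ∃ r, Good x r k := by
  have le_of : ∀ y z z' : P, z ≤ y → z' ≤ y → VV x z ⊆ VV x z' → z ≤ z' := by
    intro y z z' hz hz' h
    obtain ⟨m, e, g, hg, he⟩ := simp_struct hP hinj hatom hsurj y
    rw [he z hz, he z' hz', Finset.image_subset_image_iff hg] at h
    have h2 := e.le_iff_le.1 h
    exact h2
  have face : ∀ y : P, ∀ σ ⊆ VV x y, ∃ z ≤ y, VV x z = σ := by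
    intro y σ h
    obtain ⟨m, e, g, hg, he⟩ := simp_struct hP hinj hatom hsurj y
    refine ⟨(e.symm (Finset.univ.filter fun j => g j ∈ σ)).1, (e.symm _).2.2, ?_⟩
    rw [he _ (e.symm _).2.2]
    have h2 : (⟨(e.symm (Finset.univ.filter fun j => g j ∈ σ)).1, bot_le,
      (e.symm (Finset.univ.filter fun j => g j ∈ σ)).2.2⟩ : Set.Icc (⊥ : P) y) =
        e.symm (Finset.univ.filter fun j => g j ∈ σ) := rfl
    rw [h2, e.apply_symm_apply]
    ext i
    simp only [Finset.mem_image, Finset.mem_filter, Finset.mem_univ, true_and]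
    constructor
    · rintro ⟨j, hj, rfl⟩; exact hj
    · intro hi
      have h3 := h hi
      rw [he y le_rfl, Finset.mem_image] at h3
      obtain ⟨j, -, rfl⟩ := h3
      exact ⟨j, hi, rfl⟩
  have hstr : StrictMono (fun y => (VV x y).card) := by
    intro z z' h
    refine Finset.card_lt_card ⟨VV_mono h.le, fun h' => ?_⟩
    exact absurd (le_of z' z' z le_rfl h.le h') (not_le_of_gt h)
  have hheight : ∀ y : P, Order.height y = ((VV x y).card : ℕ∞) := by
    intro y
    apply le_antisymm
    · have := Order.height_le_height_apply_of_strictMono _ hstr y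
      rwa [Order.height_nat] at this
    · have : ∀ N : ℕ, ∀ y : P, (VV x y).card = N → (N : ℕ∞) ≤ Order.height y := by
        intro N
        induction N with
        | zero => intro y _; simp
        | succ N ih =>
          intro y hy
          obtain ⟨i, hi⟩ := Finset.card_pos.1 (by rw [hy]; omega : 0 < (VV x y).card)
          obtain ⟨z, hz, hzV⟩ := face y ((VV x y).erase i) (Finset.erase_subset _ _)
          have hc : (VV x z).card = N := by
            rw [hzV, Finset.card_erase_of_mem hi, hy]; rfl
          have hlt : z < y := lt_of_le_of_ne hz (by rintro rfl; omega)
          have h1 := ih z hc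
          have h2 : Order.height z + 1 ≤ Order.height y := Order.height_add_one_le hlt
          push_cast
          exact le_trans (by gcongr) h2
      exact this _ y rfl
  obtain ⟨y0, hy0, hy0m⟩ := Finite.exists_le_maximal (p := fun _ : P => True) (a := (⊥ : P)) trivial
  have hmax : ∀ y : P, ∃ z, y ≤ z ∧ (VV x z).card = (VV x y0).card := by
    intro y
    obtain ⟨z, hz, hzm⟩ := Finite.exists_le_maximal (p := fun _ : P => True) (a := y) trivial
    refine ⟨z, hz, ?_⟩
    have := hpure z y0 (fun a ha => hzm.2 trivial ha) (fun a ha => hy0m.2 trivial ha)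
    rw [hheight, hheight] at this
    exact_mod_cast this
  have hchain : ∀ v : P, ∀ l : ℕ, ∀ z, v ≤ z → (VV x z).card = (VV x v).card + l →
      ∃ c ∈ Kab v, c.card = l ∧ ∀ u ∈ c, u ≤ z := by
    intro v l
    induction l with
    | zero => 
      intro z _ _
      exact ⟨∅, ⟨by simp, fun u hu => by simp at hu⟩, rfl, by simp⟩
    | succ l ih =>
      intro z hvz hc
      obtain ⟨i, hi, hiv⟩ := Finset.exists_mem_notMem_of_card_lt_card
        (by omega : (VV x v).card < (VV x z).card)
      obtain ⟨z', hz, hzV⟩ := face z ((VV x z).erase i) (Finset.erase_subset _ _)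
      have hcz : (VV x z').card = (VV x v).card + l := by
        rw [hzV, Finset.card_erase_of_mem hi, hc]; rfl
      have hlt : z' < z := lt_of_le_of_ne hz (by rintro rfl; omega)
      have hvz' : v ≤ z' := le_of z v z' hvz hz (by
        rw [hzV]
        intro j hj
        exact Finset.mem_erase.2 ⟨fun h => hiv (h ▸ hj), VV_mono hvz hj⟩)
      obtain ⟨c, hc1, hc2, hc3⟩ := ih z' hvz' hcz
      refine ⟨insert z c, ⟨?_, ?_⟩, ?_, ?_⟩
      · intro u hu
        rcases Finset.mem_insert.1 hu with rfl | hu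
        · exact hvz'.trans_lt hlt
        · exact hc1.1 u hu
      · intro a ha b hb
        rcases Finset.mem_insert.1 ha with rfl | ha1 <;> rcases Finset.mem_insert.1 hb with rfl | hb1
        · exact Or.inl le_rfl
        · exact Or.inr ((hc3 b hb1).trans hz)
        · exact Or.inl ((hc3 a ha1).trans hz)
        · exact hc1.2 a ha1 b hb1
      · rw [Finset.card_insert_of_notMem, hc2]
        intro h
        exact absurd (hc3 z h) (not_le_of_gt hlt)
      · intro u hu
        rcases Finset.mem_insert.1 hu with rfl | hu
        · exact le_rfl
        · exact (hc3 u hu).trans hz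
  refine ⟨(VV x y0).card, le_of, face, ?_, ?_, ?_, hmax, ?_⟩
  · intro i
    ext j
    rw [mem_VV, Finset.mem_singleton]
    constructor
    · intro h
      rcases eq_or_lt_of_le h with h | h
      · exact hinj h
      · exact absurd ((hatom i).2 _ h) (hatom j).1
    · rintro rfl; exact le_rfl
  · ext j
    rw [mem_VV]
    simp [(hatom j).1]
  · intro y
    obtain ⟨z, hz, hc⟩ := hmax y
    rw [← hc]
    exact Finset.card_le_card (VV_mono hz)
  · intro v hv m hm φ hφ
    obtain ⟨G, hG, hK⟩ := link_eq v hv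
    obtain ⟨z, hz, hc⟩ := hmax v
    obtain ⟨c, hc1, hc2, -⟩ := hchain v ((VV x y0).card - (VV x v).card) z hz (by omega)
    have := hCM v hv G hG ((m : ℤ) - 1) ⟨c, hK ▸ hc1, by omega⟩
    rw [hK] at this
    exact van_of_coh v m this φ hφ

end good
end BB

namespace BB

section final
variable {P : Type} [Fintype P] [PartialOrder P] [OrderBot P] {n : ℕ} {x : Fin n → P} {r : ℕ}
  {k : Type} [Field k]

theorem aux_neg {R : Type} [CommRing R] (a b : R) : a * b + a * (-b) = 0 := by ring

/-- membership in the submodule generated by part of the parameters -/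
theorem mem_Wspan {d : ℕ} (θ : Fin d → MvPolynomial (Fin n) k) (i : Fin d) (s : FaceRing P k) :
    s ∈ Submodule.span k {s : FaceRing P k | ∃ j : Fin d, j < i ∧ ∃ s', s = ph x k (θ j) * s'} ↔
    ∃ T : Fin d → FaceRing P k,
      s = ∑ v ∈ Finset.univ.filter (fun v => v < i), ph x k (θ v) * T v := by
  constructor
  · intro hs
    induction hs using Submodule.span_induction with
    | mem _ h =>
      obtain ⟨j, hj, t, rfl⟩ := h
      refine ⟨fun v => if v = j then t else 0, ?_⟩
      rw [Finset.sum_eq_single j]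
      · simp only [if_true]
      · intro v _ hv
        simp only [if_neg hv, mul_zero]
      · intro h
        exact absurd hj (by simpa using h)
    | zero => exact ⟨fun _ => 0, by simp⟩
    | add a b _ _ ha hb =>
      obtain ⟨T, rfl⟩ := ha
      obtain ⟨T', rfl⟩ := hb
      refine ⟨fun v => T v + T' v, ?_⟩
      rw [← Finset.sum_add_distrib]
      exact Finset.sum_congr rfl fun v _ => (mul_add _ _ _).symm
    | smul c a _ ha =>
      obtain ⟨T, rfl⟩ := ha
      refine ⟨fun v => c • T v, ?_⟩
      rw [Finset.smul_sum]
      exact Finset.sum_congr rfl fun v _ => (mul_smul_comm _ _ _).symm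
  · rintro ⟨T, rfl⟩
    refine Submodule.sum_mem _ fun v hv => Submodule.subset_span ?_
    exact ⟨v, (Finset.mem_filter.1 hv).2, T v, rfl⟩

theorem pos_degree (θ : MvPolynomial (Fin n) k)
    (h : θ ∈ Ideal.span (Set.range (X : Fin n → MvPolynomial (Fin n) k)))
    (he : ∃ e : ℕ, θ.IsHomogeneous e) : ∃ e : ℕ, 0 < e ∧ θ.IsHomogeneous e := by
  obtain ⟨e, he⟩ := he
  rcases Nat.eq_zero_or_pos e with rfl | h0
  · refine ⟨1, one_pos, ?_⟩
    have h1 : constantCoeff θ = 0 := by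
      have : Ideal.span (Set.range (X : Fin n → MvPolynomial (Fin n) k)) ≤
          RingHom.ker (constantCoeff : MvPolynomial (Fin n) k →+* k) := by
        rw [Ideal.span_le]
        rintro _ ⟨i, rfl⟩
        simp [RingHom.mem_ker]
      exact this h
    have h2 : θ = 0 := by
      rw [← totalDegree_zero_iff_isHomogeneous, totalDegree_eq_zero_iff_eq_C] at he
      rw [he, ← constantCoeff_eq, h1, C_0]
    rw [h2]
    exact isHomogeneous_zero _ _ _
  · exact ⟨e, h0, he⟩

set_option maxHeartbeats 1000000 in
theorem main (H : Good x r k) (d : ℕ)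
    (I : Ideal (MvPolynomial (Fin n) k)) (hI : ∀ a, (∀ s : FaceRing P k, ph x k a * s = 0) → a ∈ I)
    (hdim : ringKrullDim (MvPolynomial (Fin n) k ⧸ I) = (d : WithBot ℕ∞))
    (θ : Fin d → MvPolynomial (Fin n) k)
    (hθ : ∀ i, θ i ∈ Ideal.span (Set.range (X : Fin n → MvPolynomial (Fin n) k)) ∧
        ∃ e : ℕ, (θ i).IsHomogeneous e)
    (hfin : FiniteDimensional k (FaceRing P k ⧸
        Submodule.span k {s : FaceRing P k | ∃ (i : Fin d) (t : FaceRing P k), s = ph x k (θ i) * t}))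
    (i : Fin d) (s : FaceRing P k)
    (hs : ph x k (θ i) * s ∈ Submodule.span k
      {s : FaceRing P k | ∃ j : Fin d, j < i ∧ ∃ s', s = ph x k (θ j) * s'})
    (a : MvPolynomial (Fin n) k)
    (ha : a ∈ Ideal.span (Set.range (X : Fin n → MvPolynomial (Fin n) k))) :
    ph x k a * s ∈ Submodule.span k
      {s : FaceRing P k | ∃ j : Fin d, j < i ∧ ∃ s', s = ph x k (θ j) * s'} := by
  choose e he hhom using fun i => pos_degree (θ i) (hθ i).1 (hθ i).2
  have hd : d ≤ r := by
    have := dim_le H I (fun a ha => hI a fun s => rh_inj H _ fun z => by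
      rw [map_mul]
      refine Ideal.mul_mem_right _ _ ?_
      have := Ideal.add_mem _ (rh_ph H z a) (ha z)
      rwa [sub_add_cancel] at this)
    rw [hdim] at this
    exact_mod_cast this
  have hsop := sop H θ e hhom hfin
  rw [mem_Wspan] at hs
  obtain ⟨T0, hT0⟩ := hs
  induction ha using Submodule.span_induction with
  | mem _ h =>
    obtain ⟨b, rfl⟩ := h
    rw [mem_Wspan]
    let S : Fin d → FaceRing P k := fun v => if v = i then s else - T0 v
    have hS : S i = s := if_pos rfl
    have hsum : ∑ v ∈ Finset.univ.filter (fun v => v ≤ i), ph x k (θ v) * S v = 0 := by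
      have h1 : Finset.univ.filter (fun v : Fin d => v ≤ i) =
          insert i (Finset.univ.filter (fun v => v < i)) := by
        ext v
        simp only [Finset.mem_filter, Finset.mem_univ, true_and, Finset.mem_insert]
        exact le_iff_eq_or_lt
      rw [h1, Finset.sum_insert (by simp), hS, hT0, ← Finset.sum_add_distrib]
      refine Finset.sum_eq_zero fun v hv => ?_
      have hv2 : v ≠ i := (Finset.mem_filter.1 hv).2.ne
      simp only [S]
      rw [if_neg hv2]
      exact aux_neg _ _
    obtain ⟨T, hT⟩ := concl H b hd θ e he hhom hsop i S hsum
    rw [hS] at hT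
    exact ⟨T, hT⟩
  | zero => rw [map_zero, zero_mul]; exact Submodule.zero_mem _
  | add a b _ _ ha hb => rw [map_add, add_mul]; exact Submodule.add_mem _ ha hb
  | smul c a _ ha =>
    rw [mem_Wspan] at ha ⊢
    obtain ⟨T, hT⟩ := ha
    refine ⟨fun v => ph x k c * T v, ?_⟩
    rw [smul_eq_mul, map_mul, mul_assoc, hT, Finset.mul_sum]
    exact Finset.sum_congr rfl fun v _ => by ring

end final
end BB

set_option maxHeartbeats 1000000 in
/-- Theorem 5.4 (forward direction): if the simplicial poset `P` is Buchsbaum over the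
infinite field `k` (pure, and every vertex link of the order complex `Δ(P̄)` is
Cohen–Macaulay over `k`), then `A_P` is a Buchsbaum `A`-module. -/
theorem buchsbaum_poset_implies_buchsbaum_module
    (P : Type) [Fintype P] [PartialOrder P] [OrderBot P]
    (k : Type) [Field k] (hk : Infinite k)
    (hP : IsSimplicialPoset P) (n : ℕ) (x : Fin n → P)
    (hinj : Function.Injective x) (hatom : ∀ i, IsAtom (x i))
    (hsurj : ∀ a : P, IsAtom a → ∃ i, x i = a)
    (hpure : ∀ y z : P, IsMax y → IsMax z → Order.height y = Order.height z)
    (hCM : ∀ v : P, v ≠ ⊥ → ∀ G : Finset P, G ∈ linkK P ({v} : Finset P) →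
      ∀ i : ℤ, (∃ s ∈ linkK P (insert v G), (i : ℤ) < (s.card : ℤ) - 1) →
        Subsingleton (Coh k P (linkK P (insert v G)) i)) :
    IsBuchsbaumFaceRing P k n x := by
  obtain ⟨r, H⟩ := BB.exists_good (x := x) (k := k) hP hinj hatom hsurj hpure hCM
  unfold IsBuchsbaumFaceRing
  intro d hd θ hθ hfin i
  letI : Module (MvPolynomial (Fin n) k) (FaceRing P k) :=
    Module.compHom _
      (MvPolynomial.aeval (fun i => fv P k (x i)) :
        MvPolynomial (Fin n) k →ₐ[k] FaceRing P k).toRingHom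
  ext s
  constructor
  · intro hs a ha
    exact BB.main H d _ (fun a h => Module.mem_annihilator.2 h) hd θ hθ hfin i s hs a ha
  · intro h
    exact h (θ i) (hθ i).1

end
end

section
/- Let P be a simplicial poset over an infinite field k such that the face ring A_P is a Buchsbaum A-module. Then P is pure: all maximal faces of P have the same dimension. -/
open scoped Classical
open MvPolynomial

noncomputable section

variable (P : Type) [Fintype P] [PartialOrder P] [OrderBot P]
variable (k : Type) [Field k]

section PosetPart

variable {P : Type} [Fintype P] [PartialOrder P] [OrderBot P]

/-- The vertex set of a face. -/
def vsupp {n : ℕ} (x : Fin n → P) (w : P) : Finset (Fin n) :=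
  Finset.univ.filter fun i => x i ≤ w

lemma mem_vsupp {n : ℕ} (x : Fin n → P) (w : P) (i : Fin n) : i ∈ vsupp x w ↔ x i ≤ w := by
  simp [vsupp]

lemma iso_bot {z : P} {m : ℕ} (e : Set.Icc (⊥ : P) z ≃o Finset (Fin m)) :
    e ⟨⊥, le_rfl, bot_le⟩ = ∅ := by
  have h : (⟨⊥, le_rfl, bot_le⟩ : Set.Icc (⊥ : P) z) ≤ e.symm ∅ := by
    rw [← Subtype.coe_le_coe]; exact bot_le
  have := e.monotone h
  rw [e.apply_symm_apply] at this
  exact Finset.subset_empty.1 this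

lemma iso_atom {z : P} {m : ℕ} (e : Set.Icc (⊥ : P) z ≃o Finset (Fin m)) (j : Fin m) :
    IsAtom ((e.symm {j}).1) := by
  constructor
  · intro h
    have h1 : e.symm {j} = ⟨⊥, le_rfl, bot_le⟩ := Subtype.ext h
    have h2 := congrArg e h1
    rw [e.apply_symm_apply, iso_bot] at h2
    simp at h2
  · intro b hb
    have hbz : b ∈ Set.Icc (⊥ : P) z := ⟨bot_le, hb.le.trans (e.symm {j}).2.2⟩
    have h1 : (⟨b, hbz⟩ : Set.Icc (⊥ : P) z) < e.symm {j} := by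
      rw [← Subtype.coe_lt_coe]; exact hb
    have h2 := e.strictMono h1
    rw [e.apply_symm_apply] at h2
    have h3 : e ⟨b, hbz⟩ = ∅ := by
      have := Finset.ssubset_singleton_iff.1 h2
      exact this
    rw [← iso_bot e] at h3
    exact congrArg Subtype.val (e.injective h3)

lemma iso_of_atom {z : P} {m : ℕ} (e : Set.Icc (⊥ : P) z ≃o Finset (Fin m)) {a : P}
    (ha : IsAtom a) (haz : a ≤ z) : ∃ j, e ⟨a, bot_le, haz⟩ = {j} := by
  have h1 : e ⟨a, bot_le, haz⟩ ≠ ∅ := by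
    intro h
    rw [← iso_bot e] at h
    exact ha.1 (congrArg Subtype.val (e.injective h))
  obtain ⟨j, hj⟩ := Finset.nonempty_iff_ne_empty.2 h1
  refine ⟨j, ?_⟩
  have h2 : e.symm {j} ≤ ⟨a, bot_le, haz⟩ := by
    rw [OrderIso.symm_apply_le]
    simpa using hj
  have h3 : (e.symm {j}).1 ≤ a := h2
  rcases ha.le_iff.1 h3 with h4 | h4
  · exact absurd h4 (iso_atom e j).1
  · have : (⟨a, bot_le, haz⟩ : Set.Icc (⊥ : P) z) = e.symm {j} := Subtype.ext h4.symm
    rw [this, e.apply_symm_apply]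

lemma exists_join (hP : IsSimplicialPoset P) {n : ℕ} {x : Fin n → P}
    (hatom : ∀ i, IsAtom (x i)) {w y z : P} (hw : w ≤ z) (hy : y ≤ z) :
    ∃ u, u ≤ z ∧ w ≤ u ∧ y ≤ u ∧ (∀ v, v ≤ z → w ≤ v → y ≤ v → u ≤ v) ∧
      vsupp x u = vsupp x w ∪ vsupp x y := by
  obtain ⟨m, ⟨e⟩⟩ := hP z
  set w' : Set.Icc (⊥ : P) z := ⟨w, bot_le, hw⟩
  set y' : Set.Icc (⊥ : P) z := ⟨y, bot_le, hy⟩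
  set u := e.symm (e w' ∪ e y') with hu
  have hwu : w' ≤ u := by
    rw [hu, OrderIso.le_symm_apply]; exact Finset.subset_union_left
  have hyu : y' ≤ u := by
    rw [hu, OrderIso.le_symm_apply]; exact Finset.subset_union_right
  refine ⟨u.1, u.2.2, hwu, hyu, ?_, ?_⟩
  · intro v hv hwv hyv
    have : u ≤ ⟨v, bot_le, hv⟩ := by
      rw [hu, OrderIso.symm_apply_le]
      exact Finset.union_subset (e.monotone hwv) (e.monotone hyv)
    exact this
  · ext i
    rw [Finset.mem_union, mem_vsupp, mem_vsupp, mem_vsupp]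
    constructor
    · intro hi
      have hiz := hi.trans u.2.2
      obtain ⟨j, hj⟩ := iso_of_atom e (hatom i) hiz
      have h1 : (⟨x i, bot_le, hiz⟩ : Set.Icc (⊥ : P) z) ≤ u := hi
      rw [hu, OrderIso.le_symm_apply, hj] at h1
      have h2 : j ∈ e w' ∪ e y' := by simpa using h1
      rcases Finset.mem_union.1 h2 with h | h
      · left
        have : e ⟨x i, bot_le, hiz⟩ ≤ e w' := by rw [hj]; simpa using h
        exact (e.le_iff_le.1 this : _)
      · right
        have : e ⟨x i, bot_le, hiz⟩ ≤ e y' := by rw [hj]; simpa using h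
        exact (e.le_iff_le.1 this : _)
    · rintro (h | h)
      · exact h.trans hwu
      · exact h.trans hyu

lemma exists_meet (hP : IsSimplicialPoset P) {w y z : P} (hw : w ≤ z) (hy : y ≤ z) :
    ∃ m, IsGLB {w, y} m := by
  obtain ⟨m, ⟨e⟩⟩ := hP z
  set w' : Set.Icc (⊥ : P) z := ⟨w, bot_le, hw⟩
  set y' : Set.Icc (⊥ : P) z := ⟨y, bot_le, hy⟩
  set u := e.symm (e w' ∩ e y') with hu
  have hwu : u ≤ w' := by
    rw [hu, OrderIso.symm_apply_le]; exact Finset.inter_subset_left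
  have hyu : u ≤ y' := by
    rw [hu, OrderIso.symm_apply_le]; exact Finset.inter_subset_right
  refine ⟨u.1, ?_, ?_⟩
  · rintro b (rfl | rfl)
    · exact hwu
    · exact hyu
  · intro v hv
    have hvw : v ≤ w := hv (by simp)
    have hvy : v ≤ y := hv (by simp)
    have : (⟨v, bot_le, hvw.trans hw⟩ : Set.Icc (⊥ : P) z) ≤ u := by
      rw [hu, OrderIso.le_symm_apply]
      exact Finset.subset_inter (e.monotone (show _ ≤ w' from hvw))
        (e.monotone (show _ ≤ y' from hvy))
    exact this

lemma exists_compl (hP : IsSimplicialPoset P) {w : P} (hw : w ≠ ⊥) :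
    ∃ a c : P, IsAtom a ∧ IsGLB {a, c} ⊥ ∧ w ∈ MUB a c := by
  obtain ⟨m, ⟨e⟩⟩ := hP w
  have h1 : e ⟨w, bot_le, le_rfl⟩ ≠ ∅ := by
    intro h
    rw [← iso_bot e] at h
    exact hw (congrArg Subtype.val (e.injective h))
  obtain ⟨j, hj⟩ := Finset.nonempty_iff_ne_empty.2 h1
  refine ⟨(e.symm {j}).1, (e.symm {j}ᶜ).1, iso_atom e j, ⟨?_, ?_⟩, ?_, ?_⟩
  · intro b _; exact bot_le
  · intro v hv
    have hva : v ≤ (e.symm {j}).1 := hv (by simp)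
    have hvc : v ≤ (e.symm {j}ᶜ).1 := hv (by simp)
    have hvw := hva.trans (e.symm {j}).2.2
    have ha : (⟨v, bot_le, hvw⟩ : Set.Icc (⊥ : P) w) ≤ e.symm {j} := hva
    have hc : (⟨v, bot_le, hvw⟩ : Set.Icc (⊥ : P) w) ≤ e.symm {j}ᶜ := hvc
    rw [OrderIso.le_symm_apply] at ha hc
    have h3 : e ⟨v, bot_le, hvw⟩ = ∅ := by
      have := Finset.subset_inter ha hc
      simpa using this
    rw [← iso_bot e] at h3
    exact (congrArg Subtype.val (e.injective h3)).le
  · rintro b (rfl | rfl)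
    · exact (e.symm {j}).2.2
    · exact (e.symm {j}ᶜ).2.2
  · intro z hz hzw
    have hva : (e.symm {j}).1 ≤ z := hz (by simp)
    have hvc : (e.symm {j}ᶜ).1 ≤ z := hz (by simp)
    have ha : e.symm {j} ≤ (⟨z, bot_le, hzw⟩ : Set.Icc (⊥ : P) w) := hva
    have hc : e.symm {j}ᶜ ≤ (⟨z, bot_le, hzw⟩ : Set.Icc (⊥ : P) w) := hvc
    rw [OrderIso.symm_apply_le] at ha hc
    have h3 : Finset.univ ⊆ e ⟨z, bot_le, hzw⟩ := by
      have := Finset.union_subset ha hc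
      simpa using this
    have h4 : e ⟨w, bot_le, le_rfl⟩ ≤ e ⟨z, bot_le, hzw⟩ := (Finset.subset_univ _).trans h3
    exact le_antisymm hzw (e.le_iff_le.1 h4)

lemma iso_card {n : ℕ} {x : Fin n → P} (hinj : Function.Injective x)
    (hatom : ∀ i, IsAtom (x i)) (hsurj : ∀ a : P, IsAtom a → ∃ i, x i = a) {z : P} {m : ℕ}
    (e : Set.Icc (⊥ : P) z ≃o Finset (Fin m)) : m = (vsupp x z).card := by
  choose f hf using fun j => hsurj _ (iso_atom e j)
  have hfi : Function.Injective f := by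
    intro a b hab
    have h1 : (e.symm {a}).1 = (e.symm {b}).1 := by rw [← hf, ← hf, hab]
    have h2 := e.symm.injective (Subtype.ext h1)
    simpa using h2
  have : vsupp x z = Finset.univ.image f := by
    ext i
    rw [mem_vsupp]
    constructor
    · intro hi
      obtain ⟨j, hj⟩ := iso_of_atom e (hatom i) hi
      rw [Finset.mem_image]
      refine ⟨j, Finset.mem_univ _, hinj ?_⟩
      rw [hf, ← hj, e.symm_apply_apply]
    · intro hi
      obtain ⟨j, -, rfl⟩ := Finset.mem_image.1 hi
      rw [hf]
      exact (e.symm {j}).2.2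
  rw [this, Finset.card_image_of_injective _ hfi]
  simp

lemma height_eq_of_card (hP : IsSimplicialPoset P) {n : ℕ} {x : Fin n → P}
    (hinj : Function.Injective x)
    (hatom : ∀ i, IsAtom (x i)) (hsurj : ∀ a : P, IsAtom a → ∃ i, x i = a) {y z : P}
    (h : (vsupp x y).card = (vsupp x z).card) : Order.height y = Order.height z := by
  obtain ⟨m, ⟨e⟩⟩ := hP y
  obtain ⟨m', ⟨e'⟩⟩ := hP z
  have h1 := iso_card hinj hatom hsurj e
  have h2 := iso_card hinj hatom hsurj e'
  obtain rfl : m = m' := by omega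
  have h3 := Order.krullDim_eq_of_orderIso (e.trans e'.symm)
  rw [Set.Icc_bot, Set.Icc_bot, ← Order.height_eq_krullDim_Iic,
    ← Order.height_eq_krullDim_Iic] at h3
  exact_mod_cast h3

lemma vsupp_eq_empty (hP : IsSimplicialPoset P) {n : ℕ} {x : Fin n → P}
    (hsurj : ∀ a : P, IsAtom a → ∃ i, x i = a) {y : P} (h : vsupp x y = ∅) : y = ⊥ := by
  by_contra hy
  obtain ⟨a, c, ha, -, hw⟩ := exists_compl hP hy
  obtain ⟨i, rfl⟩ := hsurj a ha
  have : i ∈ vsupp x y := by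
    rw [mem_vsupp]; exact hw.1 (by simp)
  simp [h] at this

end PosetPart

section RingPart

variable {P : Type} [Fintype P] [PartialOrder P] [OrderBot P]
variable {k : Type} [Field k]

lemma fv_bot : fv P k ⊥ = 1 := by
  have : (X (⊥ : P) - 1 : MvPolynomial P k) ∈ faceIdeal P k :=
    Ideal.subset_span (Or.inr rfl)
  have h := (Ideal.Quotient.mk_eq_mk_iff_sub_mem (I := faceIdeal P k) _ _).2 this
  rw [map_one] at h
  exact h

lemma fv_mul_zero {w y : P} (h : upperBounds {w, y} = ∅) : fv P k w * fv P k y = 0 := by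
  have : (X w * X y : MvPolynomial P k) ∈ faceIdeal P k :=
    Ideal.subset_span (Or.inl (Or.inl ⟨w, y, h, rfl⟩))
  have h := Ideal.Quotient.eq_zero_iff_mem.2 this
  rw [map_mul] at h
  exact h

lemma fv_mul {w y m : P} (h : (upperBounds {w, y}).Nonempty) (hm : IsGLB {w, y} m) :
    fv P k w * fv P k y =
      fv P k m * ∑ z ∈ (Set.toFinite (MUB w y)).toFinset, fv P k z := by
  have : (X w * X y - X m * ∑ z ∈ (Set.toFinite (MUB w y)).toFinset, X z : MvPolynomial P k)
      ∈ faceIdeal P k :=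
    Ideal.subset_span (Or.inl (Or.inr ⟨w, y, m, h, hm, rfl⟩))
  have h := (Ideal.Quotient.mk_eq_mk_iff_sub_mem (I := faceIdeal P k) _ _).2 this
  rw [map_mul, map_mul, map_sum] at h
  exact h

/-- The image of a vertex variable under restriction to the face `z`. -/
def resVar {n : ℕ} (x : Fin n → P) (k : Type) [Field k] (z : P) (i : Fin n) :
    MvPolynomial {i // x i ≤ z} k :=
  if h : x i ≤ z then X ⟨i, h⟩ else 0

/-- The image of a face variable under restriction to the face `z`. -/
def resFace {n : ℕ} (x : Fin n → P) (k : Type) [Field k] (z w : P) :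
    MvPolynomial {i // x i ≤ z} k :=
  if w ≤ z then ∏ i ∈ vsupp x w, resVar x k z i else 0

lemma res_vanish (hP : IsSimplicialPoset P) {n : ℕ} {x : Fin n → P}
    (hatom : ∀ i, IsAtom (x i)) (z : P) :
    ∀ f ∈ faceIdeal P k, (aeval (resFace x k z) : MvPolynomial P k →ₐ[k] _) f = 0 := by
  suffices h : faceIdeal P k ≤
      RingHom.ker (aeval (resFace x k z) : MvPolynomial P k →ₐ[k] _) by
    intro f hf
    exact h hf
  refine Ideal.span_le.2 ?_
  rintro f ((⟨w, y, h, rfl⟩ | ⟨w, y, m, h, hm, rfl⟩) | rfl)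
  · rw [SetLike.mem_coe, RingHom.mem_ker, map_mul, aeval_X, aeval_X]
    by_cases hw : w ≤ z
    · by_cases hy : y ≤ z
      · exfalso
        have : z ∈ upperBounds {w, y} := by
          rintro b (rfl | rfl) <;> assumption
        rw [h] at this
        exact this
      · simp [resFace, hy]
    · simp [resFace, hw]
  · rw [SetLike.mem_coe, RingHom.mem_ker, map_sub, map_mul, map_mul, map_sum]
    simp only [aeval_X]
    by_cases hwy : w ≤ z ∧ y ≤ z
    · obtain ⟨hw, hy⟩ := hwy
      have hmw : m ≤ w := hm.1 (by simp)
      have hmy : m ≤ y := hm.1 (by simp)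
      obtain ⟨u, huz, hwu, hyu, hlub, hsup⟩ := exists_join hP hatom hw hy
      have hu : u ∈ MUB w y := by
        constructor
        · rintro b (rfl | rfl) <;> assumption
        · intro v hv hvu
          exact le_antisymm hvu (hlub v (hvu.trans huz) (hv (by simp)) (hv (by simp)))
      rw [Finset.sum_eq_single u]
      · simp only [resFace, hw, hy, huz, hmw.trans hw, if_true]
        rw [hsup]
        have : vsupp x m = vsupp x w ∩ vsupp x y := by
          ext i
          simp only [Finset.mem_inter, mem_vsupp]
          constructor
          · intro h; exact ⟨h.trans hmw, h.trans hmy⟩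
          · rintro ⟨h1, h2⟩
            apply hm.2
            rintro b (rfl | rfl) <;> assumption
        rw [this, ← Finset.prod_union_inter]
        ring
      · intro v hv hvu
        rw [Set.Finite.mem_toFinset] at hv
        rw [resFace, if_neg]
        intro hvz
        exact hvu (hv.2 u hu.1 (hlub v hvz (hv.1 (by simp)) (hv.1 (by simp)))).symm
      · intro h'
        exact absurd ((Set.Finite.mem_toFinset _).2 hu) h'
    · have h0 : resFace x k z w * resFace x k z y = 0 := by
        by_cases hw : w ≤ z
        · have hy : ¬ y ≤ z := fun hy => hwy ⟨hw, hy⟩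
          simp [resFace, hy]
        · simp [resFace, hw]
      rw [h0, Finset.sum_eq_zero]
      · simp
      · intro v hv
        rw [Set.Finite.mem_toFinset] at hv
        rw [resFace, if_neg]
        intro hvz
        exact hwy ⟨(hv.1 (by simp)).trans hvz, (hv.1 (by simp)).trans hvz⟩
  · rw [SetLike.mem_coe, RingHom.mem_ker, map_sub, aeval_X, map_one]
    have : vsupp x (⊥ : P) = ∅ := by
      ext i
      simp [mem_vsupp, (hatom i).1]
    simp [resFace, this]

/-- Restriction of the face ring to the face `z`. -/
def res (hP : IsSimplicialPoset P) {n : ℕ} {x : Fin n → P} (k : Type) [Field k]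
    (hatom : ∀ i, IsAtom (x i)) (z : P) : FaceRing P k →ₐ[k] MvPolynomial {i // x i ≤ z} k :=
  Ideal.Quotient.liftₐ (faceIdeal P k) (aeval (resFace x k z)) (res_vanish hP hatom z)

lemma res_fv (hP : IsSimplicialPoset P) {n : ℕ} {x : Fin n → P}
    (hatom : ∀ i, IsAtom (x i)) (z w : P) :
    res hP k hatom z (fv P k w) = resFace x k z w := by
  have : res hP k hatom z (fv P k w) = aeval (resFace x k z) (X w : MvPolynomial P k) := rfl
  rw [this, aeval_X]

lemma res_atom (hP : IsSimplicialPoset P) {n : ℕ} {x : Fin n → P}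
    (hinj : Function.Injective x)
    (hatom : ∀ i, IsAtom (x i)) (z : P) (i : Fin n) (h : x i ≤ z) :
    res hP k hatom z (fv P k (x i)) = X ⟨i, h⟩ := by
  have : vsupp x (x i) = {i} := by
    ext j
    rw [mem_vsupp, Finset.mem_singleton]
    constructor
    · intro hj
      rcases (hatom i).le_iff.1 hj with h' | h'
      · exact absurd h' (hatom j).1
      · exact hinj h'
    · rintro rfl; exact le_rfl
  rw [res_fv, resFace, if_pos h, this, Finset.prod_singleton, resVar, dif_pos h]

lemma fv_atom_mul_ne_zero (hP : IsSimplicialPoset P) {n : ℕ} {x : Fin n → P}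
    (hinj : Function.Injective x)
    (hatom : ∀ i, IsAtom (x i)) (z : P) (i : Fin n) (h : x i ≤ z) :
    fv P k (x i) * fv P k z ≠ 0 := by
  intro h0
  have h1 := congrArg (res hP k hatom z) h0
  rw [map_mul, map_zero, res_atom hP hinj hatom z i h, res_fv, resFace, if_pos le_rfl] at h1
  rcases mul_eq_zero.1 h1 with h2 | h2
  · exact X_ne_zero _ h2
  · obtain ⟨j, hj, h3⟩ := Finset.prod_eq_zero_iff.1 h2
    rw [mem_vsupp] at hj
    rw [resVar, dif_pos hj] at h3
    exact X_ne_zero _ h3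

lemma fv_sq (hP : IsSimplicialPoset P) {w a c : P} (hg : IsGLB {a, c} ⊥) (hw : w ∈ MUB a c) :
    fv P k w ^ 2 = fv P k w * (fv P k a * fv P k c) := by
  rw [fv_mul ⟨w, hw.1⟩ hg, fv_bot, one_mul, Finset.mul_sum, Finset.sum_eq_single w, sq]
  · intro z hz hzw
    rw [Set.Finite.mem_toFinset] at hz
    apply fv_mul_zero
    by_contra hne
    obtain ⟨u, hu⟩ := Set.nonempty_iff_ne_empty.2 hne
    obtain ⟨m, hm⟩ := exists_meet hP (w := w) (y := z) (hu (by simp)) (hu (by simp))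
    have hmu : m ∈ upperBounds {a, c} := by
      intro b hb
      apply hm.2
      rintro v (rfl | rfl)
      · exact hw.1 hb
      · exact hz.1 hb
    have h1 : m = w := hw.2 m hmu (hm.1 (by simp))
    have h2 : m = z := hz.2 m hmu (hm.1 (by simp))
    exact hzw (h2.symm.trans h1)
  · intro h
    exact absurd ((Set.Finite.mem_toFinset _).2 hw) h

lemma prod_atoms_mem (hP : IsSimplicialPoset P) {n : ℕ} (x : Fin n → P) (S : Finset (Fin n)) :
    ∏ i ∈ S, fv P k (x i) ∈ Ideal.span {r | ∃ u, S ⊆ vsupp x u ∧ r = fv P k u} := by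
  induction S using Finset.induction_on with
  | empty =>
    apply Ideal.subset_span
    exact ⟨⊥, by simp, by simp [fv_bot]⟩
  | insert i S hi ih =>
    rw [Finset.prod_insert hi]
    have h1 : ∀ r ∈ Ideal.span {r | ∃ u, S ⊆ vsupp x u ∧ r = fv P k u},
        fv P k (x i) * r ∈ Ideal.span {r | ∃ u, insert i S ⊆ vsupp x u ∧ r = fv P k u} := by
      intro r hr
      induction hr using Submodule.span_induction with
      | mem r hr =>
        obtain ⟨u, hu, rfl⟩ := hr
        by_cases hne : (upperBounds {x i, u}).Nonempty
        · obtain ⟨v, hv⟩ := hne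
          obtain ⟨m, hm⟩ := exists_meet hP (w := x i) (y := u) (hv (by simp)) (hv (by simp))
          rw [fv_mul ⟨v, hv⟩ hm]
          apply Ideal.mul_mem_left
          apply Ideal.sum_mem
          intro t ht
          rw [Set.Finite.mem_toFinset] at ht
          apply Ideal.subset_span
          refine ⟨t, ?_, rfl⟩
          have hit : x i ≤ t := ht.1 (by simp)
          have hut : u ≤ t := ht.1 (by simp)
          intro j hj
          rw [mem_vsupp]
          rcases Finset.mem_insert.1 hj with rfl | hj
          · exact hit
          · exact ((mem_vsupp _ _ _).1 (hu hj)).trans hut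
        · rw [fv_mul_zero (Set.not_nonempty_iff_eq_empty.1 hne)]
          exact Ideal.zero_mem _
      | zero => rw [mul_zero]; exact Ideal.zero_mem _
      | add a b _ _ ha hb => rw [mul_add]; exact Ideal.add_mem _ ha hb
      | smul a b _ hb =>
        rw [smul_eq_mul, mul_left_comm]
        exact Ideal.mul_mem_left _ _ hb
    exact h1 _ ih

/-- The structure map `A → A_P`. -/
abbrev structMap {n : ℕ} (x : Fin n → P) (k : Type) [Field k] :
    MvPolynomial (Fin n) k →ₐ[k] FaceRing P k :=
  MvPolynomial.aeval (fun i => fv P k (x i))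

lemma structMap_esymm {n : ℕ} (x : Fin n → P) (j : ℕ) :
    structMap x k (esymm (Fin n) k j) =
      ∑ S ∈ Finset.powersetCard j Finset.univ, ∏ i ∈ S, fv P k (x i) := by
  simp [structMap, esymm, map_sum, map_prod]

lemma esymm_eq_zero_of_lt (hP : IsSimplicialPoset P) {n : ℕ} (x : Fin n → P) (j : ℕ)
    (h : ∀ u, (vsupp x u).card < j) : structMap x k (esymm (Fin n) k j) = 0 := by
  rw [structMap_esymm]
  apply Finset.sum_eq_zero
  intro S hS
  rw [Finset.mem_powersetCard] at hS
  have h1 := prod_atoms_mem (k := k) hP x S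
  have h2 : {r | ∃ u, S ⊆ vsupp x u ∧ r = fv P k u} = ∅ := by
    ext r
    simp only [Set.mem_ofPred_eq, Set.mem_empty_iff_false, iff_false]
    rintro ⟨u, hu, -⟩
    have := Finset.card_le_card hu
    have := h u
    omega
  rw [h2, Ideal.span_empty] at h1
  simpa using h1

lemma esymm_mul_max {n : ℕ} (x : Fin n → P) (j : ℕ) {y : P} (hy : IsMax y)
    (h : (vsupp x y).card < j) : structMap x k (esymm (Fin n) k j) * fv P k y = 0 := by
  rw [structMap_esymm, Finset.sum_mul]
  apply Finset.sum_eq_zero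
  intro S hS
  rw [Finset.mem_powersetCard] at hS
  have : ¬ S ⊆ vsupp x y := by
    intro hsub
    have := Finset.card_le_card hsub
    omega
  obtain ⟨i, hi, hiy⟩ := Finset.not_subset.1 this
  rw [mem_vsupp] at hiy
  have h0 : fv P k (x i) * fv P k y = 0 := by
    apply fv_mul_zero
    by_contra hne
    obtain ⟨u, hu⟩ := Set.nonempty_iff_ne_empty.2 hne
    have h1 : x i ≤ u := hu (by simp)
    have h2 : y ≤ u := hu (by simp)
    exact hiy (h1.trans (hy h2))
  rw [← Finset.mul_prod_erase _ _ hi, mul_right_comm, h0, zero_mul]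

lemma nilp_of_esymm {B : Type*} [CommRing B] {n : ℕ} (b : Fin n → B)
    (h : ∀ j, 0 < j → (Finset.univ.val.map b).esymm j = 0) (i : Fin n) : b i ^ n = 0 := by
  have h1 := Multiset.prod_X_sub_X_eq_sum_esymm (Finset.univ.val.map b)
  have h2 := congrArg (Polynomial.eval (b i)) h1
  rw [Finset.sum_eq_single 0] at h2
  · have h3 : Polynomial.eval (b i)
        ((Finset.univ.val.map b).map fun t => Polynomial.X - Polynomial.C t).prod = 0 := by
      rw [Polynomial.eval_multiset_prod]
      apply Multiset.prod_eq_zero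
      simp only [Multiset.map_map, Multiset.mem_map]
      exact ⟨i, by simp, by simp⟩
    rw [h3] at h2
    simpa [Multiset.esymm] using h2.symm
  · intro j _ hj
    rw [h j (Nat.pos_of_ne_zero hj)]
    simp
  · simp

lemma finite_quot_aux (hP : IsSimplicialPoset P) {n : ℕ} {x : Fin n → P}
    (hsurj : ∀ a : P, IsAtom a → ∃ i, x i = a) {B : Type*} [CommRing B] [Algebra k B]
    (q : FaceRing P k →ₐ[k] B) (hq : Function.Surjective q)
    (hI : ∀ j, 0 < j → q (structMap x k (esymm (Fin n) k j)) = 0) :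
    Module.Finite k B := by
  have hat : ∀ i, q (fv P k (x i)) ^ n = 0 := by
    apply nilp_of_esymm
    intro j hj
    have h1 := hI j hj
    rw [structMap_esymm, map_sum] at h1
    rw [Finset.esymm_map_val, ← h1]
    simp only [map_prod]
  have hface : ∀ w : P, IsIntegral k (q (fv P k w)) := by
    intro w
    by_cases hw : w = ⊥
    · rw [hw, fv_bot, map_one]
      exact isIntegral_one
    · obtain ⟨a, c, ha, hg, hm⟩ := exists_compl hP hw
      obtain ⟨i, rfl⟩ := hsurj a ha
      have h1 := congrArg q (fv_sq (k := k) hP hg hm)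
      rw [map_pow, map_mul, map_mul] at h1
      have h2 : (q (fv P k w) ^ 2) ^ n = 0 := by
        rw [h1, mul_pow, mul_pow, hat, zero_mul, mul_zero]
      rw [← pow_mul] at h2
      refine IsIntegral.of_pow (n := 2 * n) ?_ ?_
      · have := i.pos
        omega
      · rw [h2]; exact isIntegral_zero
  have hadj : Algebra.adjoin k (Set.range fun w : P => q (fv P k w)) = ⊤ := by
    have h1 := MvPolynomial.adjoin_range_X (R := k) (σ := P)
    have h2 := congrArg (Subalgebra.map
      (q.comp (Ideal.Quotient.mkₐ k (faceIdeal P k)))) h1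
    rw [AlgHom.map_adjoin, ← Set.range_comp, Algebra.map_top] at h2
    have h3 : (q.comp (Ideal.Quotient.mkₐ k (faceIdeal P k))).range = ⊤ := by
      rw [AlgHom.range_eq_top]
      exact hq.comp (Ideal.Quotient.mkₐ_surjective k _)
    rw [h3] at h2
    exact h2
  have hfin := Algebra.finite_adjoin_of_finite_of_isIntegral (R := k)
    (Set.finite_range fun w : P => q (fv P k w))
    (by rintro _ ⟨w, rfl⟩; exact hface w)
  rw [hadj] at hfin
  exact Module.Finite.equiv (Subalgebra.topEquiv (R := k) (A := B)).toLinearEquiv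

lemma quot_prop {C : Type} [CommRing C] [Algebra k C] (I : Ideal C)
    (H : ∀ (B : Type) [CommRing B] [Algebra k B] (q : C →ₐ[k] B), Function.Surjective q →
      (∀ r ∈ I, q r = 0) → Module.Finite k B) : Module.Finite k (C ⧸ I) :=
  H (C ⧸ I) (Ideal.Quotient.mkₐ k I) (Ideal.Quotient.mkₐ_surjective k I)
    (fun _ hr => Ideal.Quotient.eq_zero_iff_mem.2 hr)

lemma finite_quot_ideal (hP : IsSimplicialPoset P) {n : ℕ} {x : Fin n → P}
    (hsurj : ∀ a : P, IsAtom a → ∃ i, x i = a) (I : Ideal (FaceRing P k))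
    (hI : ∀ j, 0 < j → structMap x k (esymm (Fin n) k j) ∈ I) :
    Module.Finite k (FaceRing P k ⧸ I) := by
  refine quot_prop I ?_
  intro B _ _ q hq hr
  exact finite_quot_aux hP hsurj q hq (fun j hj => hr _ (hI j hj))

lemma finite_quot (hP : IsSimplicialPoset P) {n : ℕ} {x : Fin n → P}
    (hsurj : ∀ a : P, IsAtom a → ∃ i, x i = a) {d : ℕ} (g : Fin d → FaceRing P k)
    (hI : ∀ j, 0 < j → structMap x k (esymm (Fin n) k j) ∈ Ideal.span (Set.range g))
    (N : Submodule k (FaceRing P k)) (hN : ∀ i s, g i * s ∈ N) :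
    Module.Finite k (FaceRing P k ⧸ N) := by
  have h1 : Module.Finite k (FaceRing P k ⧸ Ideal.span (Set.range g)) :=
    finite_quot_ideal hP hsurj _ hI
  have h2 : (Ideal.span (Set.range g)).restrictScalars k ≤ N := by
    intro r hr
    rw [Submodule.restrictScalars_mem, Ideal.mem_span_range_iff_exists_fun] at hr
    obtain ⟨c, rfl⟩ := hr
    apply Submodule.sum_mem
    intro i _
    rw [mul_comm]
    exact hN _ _
  have h3 : Module.Finite k (FaceRing P k ⧸ (Ideal.span (Set.range g)).restrictScalars k) :=
    Module.Finite.equiv (Submodule.Quotient.restrictScalarsEquiv k (Ideal.span (Set.range g))).symm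
  exact Module.Finite.of_surjective (Submodule.factor h2) (Submodule.factor_surjective h2)

lemma card_le_dim (hP : IsSimplicialPoset P) {n : ℕ} {x : Fin n → P}
    (hinj : Function.Injective x) (hatom : ∀ i, IsAtom (x i))
    (J : Ideal (MvPolynomial (Fin n) k)) (hJ : ∀ a ∈ J, structMap x k a = 0) (z : P) :
    (((vsupp x z).card : ℕ) : WithBot ℕ∞) ≤ ringKrullDim (MvPolynomial (Fin n) k ⧸ J) := by
  let f : MvPolynomial (Fin n) k →ₐ[k] MvPolynomial {i // x i ≤ z} k :=
    (res hP k hatom z).comp (structMap x k)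
  have hf : Function.Surjective f := by
    rw [← AlgHom.range_eq_top, eq_top_iff, ← MvPolynomial.adjoin_range_X, Algebra.adjoin_le_iff]
    rintro _ ⟨⟨i, hi⟩, rfl⟩
    refine ⟨X i, ?_⟩
    have : f (X i) = res hP k hatom z (fv P k (x i)) := by simp [f, structMap]
    exact this.trans (res_atom hP hinj hatom z i hi)
  let g : MvPolynomial (Fin n) k ⧸ J →+* MvPolynomial {i // x i ≤ z} k :=
    Ideal.Quotient.lift J f.toRingHom (fun a ha => by
      have : f a = res hP k hatom z (structMap x k a) := rfl
      exact this.trans (by rw [hJ a ha, map_zero]))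
  have hg : Function.Surjective g := by
    intro b
    obtain ⟨a, rfl⟩ := hf b
    exact ⟨Ideal.Quotient.mk J a, rfl⟩
  have h1 := ringKrullDim_le_of_surjective g hg
  rw [MvPolynomial.ringKrullDim_of_isNoetherianRing, ringKrullDim_eq_zero_of_field, zero_add] at h1
  have h2 : Nat.card {i // x i ≤ z} = (vsupp x z).card := by
    rw [Nat.card_eq_fintype_card, Fintype.card_subtype]
    rfl
  rwa [h2] at h1

lemma exists_dim {n : ℕ} (J : Ideal (MvPolynomial (Fin n) k)) (hJ : (0 : WithBot ℕ∞) ≤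
    ringKrullDim (MvPolynomial (Fin n) k ⧸ J)) :
    ∃ d : ℕ, ringKrullDim (MvPolynomial (Fin n) k ⧸ J) = (d : WithBot ℕ∞) := by
  have h1 := ringKrullDim_le_of_surjective (Ideal.Quotient.mk J) Ideal.Quotient.mk_surjective
  rw [MvPolynomial.ringKrullDim_of_isNoetherianRing, ringKrullDim_eq_zero_of_field, zero_add] at h1
  generalize ringKrullDim (MvPolynomial (Fin n) k ⧸ J) = D at *
  induction D with
  | bot => simp at hJ
  | coe D =>
    induction D with
    | top =>
      exfalso
      have h2 : ((⊤ : ℕ∞) : WithBot ℕ∞) ≤ (((Nat.card (Fin n) : ℕ) : ℕ∞) : WithBot ℕ∞) := h1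
      rw [WithBot.coe_le_coe] at h2
      exact absurd h2 (by simp)
    | coe d => exact ⟨d, rfl⟩

lemma esymm_mem_irrel {n j : ℕ} (hj : 0 < j) :
    esymm (Fin n) k j ∈ Ideal.span (Set.range (X : Fin n → MvPolynomial (Fin n) k)) := by
  rw [esymm]
  apply Ideal.sum_mem
  intro S hS
  rw [Finset.mem_powersetCard] at hS
  obtain ⟨i, hi⟩ := Finset.card_pos.1 (by omega : 0 < S.card)
  rw [← Finset.mul_prod_erase _ _ hi]
  exact Ideal.mul_mem_right _ _ (Ideal.subset_span ⟨i, rfl⟩)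

lemma esymm_homog {n j : ℕ} : (esymm (Fin n) k j).IsHomogeneous j := by
  rw [esymm]
  apply IsHomogeneous.sum
  intro S hS
  rw [Finset.mem_powersetCard] at hS
  have := IsHomogeneous.prod S (fun i => (X i : MvPolynomial (Fin n) k)) (fun _ => 1)
    (fun i _ => isHomogeneous_X _ _)
  simpa [hS.2] using this

set_option synthInstance.maxHeartbeats 1000000 in
set_option maxHeartbeats 2000000 in
lemma not_lt_aux (hP : IsSimplicialPoset P) {n : ℕ} {x : Fin n → P}
    (hinj : Function.Injective x) (hatom : ∀ i, IsAtom (x i))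
    (hsurj : ∀ a : P, IsAtom a → ∃ i, x i = a)
    (hB : IsBuchsbaumFaceRing P k n x) {y z : P} (hy : IsMax y)
    (hlt : (vsupp x y).card < (vsupp x z).card) : False := by
  letI : Module (MvPolynomial (Fin n) k) (FaceRing P k) :=
    Module.compHom _
      (MvPolynomial.aeval (fun i => fv P k (x i)) :
        MvPolynomial (Fin n) k →ₐ[k] FaceRing P k).toRingHom
  have hsmul : ∀ (a : MvPolynomial (Fin n) k) (s : FaceRing P k),
    a • s = structMap x k a * s := fun _ _ => rfl
  set J := Module.annihilator (MvPolynomial (Fin n) k) (FaceRing P k) with hJdef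
  have hJ : ∀ a ∈ J, structMap x k a = 0 := by
    intro a ha
    have := Module.mem_annihilator.1 ha 1
    rwa [hsmul, mul_one] at this
  have hdim := card_le_dim hP hinj hatom J hJ
  obtain ⟨d, hd⟩ := exists_dim J (le_trans (by positivity) (hdim z))
  have hdle : ∀ u, (vsupp x u).card ≤ d := by
    intro u
    have := hdim u
    rw [hd] at this
    exact_mod_cast this
  let θ : Fin d → MvPolynomial (Fin n) k := fun i => esymm (Fin n) k (d - i)
  have hdpos : 0 < d := by
    have := hdle z
    omega
  have key := hB d hd θ (fun i => ⟨esymm_mem_irrel (by omega), _, esymm_homog⟩) (by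
    refine finite_quot hP hsurj (fun i => structMap x k (θ i)) ?_ _ ?_
    · intro j hj
      by_cases hjd : j ≤ d
      · apply Ideal.subset_span
        refine ⟨⟨d - j, by omega⟩, ?_⟩
        have : d - (d - j) = j := by omega
        simp only [θ, this]
      · rw [esymm_eq_zero_of_lt hP x j (fun u => by have := hdle u; omega)]
        exact Ideal.zero_mem _
    · intro i s
      exact Submodule.subset_span ⟨i, s, rfl⟩) ⟨0, hdpos⟩
  have hempty : {r : FaceRing P k | ∃ j : Fin d, j < ⟨0, hdpos⟩ ∧
      ∃ s' : FaceRing P k, r = θ j • s'} = ∅ := by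
    ext r
    simp only [Set.mem_ofPred_eq, Set.mem_empty_iff_false, iff_false]
    rintro ⟨j, hj, -⟩
    exact absurd (Fin.lt_def.1 hj) (by simp)
  have hmem : fv P k y ∈ {s : FaceRing P k | θ ⟨0, hdpos⟩ • s ∈
          Submodule.span k {r : FaceRing P k |
            ∃ j : Fin d, j < ⟨0, hdpos⟩ ∧ ∃ s' : FaceRing P k, r = θ j • s'}} := by
    have h0 : θ ⟨0, hdpos⟩ • fv P k y = 0 := by
      rw [hsmul]
      exact esymm_mul_max x _ hy (by have := hdle z; simp only [Nat.sub_zero]; omega)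
    rw [Set.mem_ofPred_eq, h0]
    exact Submodule.zero_mem _
  have hmem2 := key.le hmem
  have hne : (vsupp x y).Nonempty := by
    rw [Finset.nonempty_iff_ne_empty]
    intro h0
    have hyb := vsupp_eq_empty hP hsurj h0
    have hzb : z = y := le_antisymm (hy (hyb ▸ bot_le)) (hyb ▸ bot_le)
    rw [hzb] at hlt
    exact lt_irrefl _ hlt
  obtain ⟨i, hi⟩ := hne
  rw [mem_vsupp] at hi
  have h5 := hmem2 (X i) (Ideal.subset_span ⟨i, rfl⟩)
  have h6 : structMap x k (X i) * fv P k y ∈ (⊥ : Submodule k (FaceRing P k)) := by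
    rw [← Submodule.span_empty, ← hempty]
    exact h5
  rw [Submodule.mem_bot, structMap, aeval_X] at h6
  exact fv_atom_mul_ne_zero hP hinj hatom y i hi h6

end RingPart

/-- Theorem 5.4 (purity part of the converse): if `A_P` is a Buchsbaum `A`-module
(over an infinite field `k`), then `P` is pure — all maximal faces have the same
dimension (equivalently, the same rank). -/
theorem buchsbaum_module_implies_pure
    (P : Type) [Fintype P] [PartialOrder P] [OrderBot P]
    (k : Type) [Field k] (hk : Infinite k)
    (hP : IsSimplicialPoset P) (n : ℕ) (x : Fin n → P)
    (hinj : Function.Injective x) (hatom : ∀ i, IsAtom (x i))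
    (hsurj : ∀ a : P, IsAtom a → ∃ i, x i = a)
    (hB : IsBuchsbaumFaceRing P k n x) :
    ∀ y z : P, IsMax y → IsMax z → Order.height y = Order.height z := by
  intro y z hy hz
  apply height_eq_of_card hP hinj hatom hsurj
  rcases lt_trichotomy (vsupp x y).card (vsupp x z).card with h | h | h
  · exact (not_lt_aux hP hinj hatom hsurj hB hy h).elim
  · exact h
  · exact (not_lt_aux hP hinj hatom hsurj hB hz h).elim

end
end
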